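/- Fix an integer k ≥ 0. Let λ^{(0)} ↗ λ^{(1)} ↗ ⋯ be the Plancherel growth process, let Λ^{(n)} = (λ^{(n)}_0, …, λ^{(n)}_k) ∈ ℕ_0^{k+1} denote the lengths of its bottom k+1 rows, and for t ∈ ℝ set n_t = n + ⌊t√n⌋. Then, as n → ∞, the random function t ↦ Λ^{(n_t)} − Λ^{(n)} ∈ ℤ^{k+1} converges in distribution (in the sense of finite-dimensional distributions) to a tuple of k+1 independent standard Poisson processes on ℝ. -/

import Mathlib

open MeasureTheory Filter

/-- The number of standard Young tableaux of shape `μ`: bijective fillings of the cells of `μ`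
by `0, 1, …, μ.card - 1` that are strictly increasing along rows and columns. -/
noncomputable def sytCount (μ : YoungDiagram) : ℕ :=
  Nat.card {T : μ.cells → Fin μ.card //
    Function.Bijective T ∧
      ∀ a b : μ.cells, (a : ℕ × ℕ).1 ≤ (b : ℕ × ℕ).1 → (a : ℕ × ℕ).2 ≤ (b : ℕ × ℕ).2 →
        a ≠ b → T a < T b}

/-- `lam 0 ↗ lam 1 ↗ ⋯` is a Plancherel growth process: the probability of any prescribed
initial path `∅ = μ⁽⁰⁾ ↗ μ⁽¹⁾ ↗ ⋯ ↗ μ⁽ⁿ⁾` in the Young graph equals `d_{μ⁽ⁿ⁾} / n!`,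
which characterizes the distribution of the sequence of RSK shapes of an i.i.d. uniform
sequence. -/
def IsPlancherelGrowthProcess {Ω : Type*} [MeasurableSpace Ω] (P : Measure Ω)
    (lam : ℕ → Ω → YoungDiagram) : Prop :=
  IsProbabilityMeasure P ∧
  (∀ (n : ℕ) (y : YoungDiagram), MeasurableSet {ω | lam n ω = y}) ∧
  ∀ (n : ℕ) (path : ℕ → YoungDiagram), path 0 = ⊥ →
    (∀ i, i < n → path i ≤ path (i + 1) ∧ (path (i + 1)).card = (path i).card + 1) →
    P {ω | ∀ i ≤ n, lam i ω = path i} =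
      (sytCount (path n) : ENNReal) / (Nat.factorial n : ENNReal)

/-- The event `E_r⁽ⁿ⁺¹⁾` that the box added in step `n+1` of the growth process
(i.e. the unique box of `λ⁽ⁿ⁺¹⁾ ∖ λ⁽ⁿ⁾`) lies in the row with index `r`. -/
def growthEvent {Ω : Type*} (lam : ℕ → Ω → YoungDiagram) (n r : ℕ) : Set Ω :=
  {ω | (lam (n + 1) ω).rowLen r = (lam n ω).rowLen r + 1}

/-- `n_t = n + ⌊t√n⌋` (truncated at `0`). -/
noncomputable def timeIndex (n : ℕ) (t : ℝ) : ℕ :=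
  ((n : ℤ) + ⌊t * Real.sqrt n⌋).toNat

/-- The probability that an integer-valued Poisson random variable with mean `μ ≥ 0` takes the
value `m ∈ ℤ`. -/
noncomputable def poissonProbZ (μ : ℝ) (m : ℤ) : ℝ :=
  if 0 ≤ m then Real.exp (-μ) * μ ^ m.toNat / (Nat.factorial m.toNat : ℝ) else 0

namespace PG

/-- add a box to row `s` -/
def up (a : ℕ → ℕ) (s : ℕ) : ℕ → ℕ := fun i => a i + if i = s then 1 else 0
/-- remove a box from row `s` -/
def dn (a : ℕ → ℕ) (s : ℕ) : ℕ → ℕ := fun i => a i - if i = s then 1 else 0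

/-- `a` is a partition of `n` -/
def IsP (n : ℕ) (a : ℕ → ℕ) : Prop :=
  Antitone a ∧ a n = 0 ∧ ∑ i ∈ Finset.range n, a i = n

lemma IsP.zero_of_le {n : ℕ} {a : ℕ → ℕ} (h : IsP n a) {i : ℕ} (hi : n ≤ i) : a i = 0 := by
  have := h.1 hi
  have := h.2.1
  omega

lemma sum_eq_of_zero {a : ℕ → ℕ} {n K : ℕ} (hz : ∀ i, n ≤ i → a i = 0) (hK : n ≤ K) :
    ∑ i ∈ Finset.range K, a i = ∑ i ∈ Finset.range n, a i := by
  symm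
  apply Finset.sum_subset
  · intro i; simp; omega
  · intro i _ h2
    apply hz
    simpa using h2

lemma IsP.sum {n : ℕ} {a : ℕ → ℕ} (h : IsP n a) {K : ℕ} (hK : n ≤ K) :
    ∑ i ∈ Finset.range K, a i = n := by
  rw [sum_eq_of_zero (fun i hi => h.zero_of_le hi) hK, h.2.2]

lemma isP_of {n K : ℕ} {a : ℕ → ℕ} (ha : Antitone a) (hz : ∀ i, K ≤ i → a i = 0)
    (hs : ∑ i ∈ Finset.range K, a i = n) : IsP n a := by
  have h0 : a n = 0 := by
    by_contra hne
    have h1 : ∀ i ∈ Finset.range (n + 1), 1 ≤ a i := by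
      intro i hi
      have := ha (show i ≤ n by simp at hi; omega)
      omega
    have h2 : n + 1 ≤ ∑ i ∈ Finset.range (n + 1), a i := by
      calc n + 1 = ∑ i ∈ Finset.range (n + 1), 1 := by simp
        _ ≤ _ := Finset.sum_le_sum h1
    have hK : n + 1 ≤ K := by
      by_contra h
      exact hne (hz n (by omega))
    have h3 : ∑ i ∈ Finset.range (n + 1), a i ≤ ∑ i ∈ Finset.range K, a i :=
      Finset.sum_le_sum_of_subset (by intro i; simp; omega)
    omega
  refine ⟨ha, h0, ?_⟩
  have hz' : ∀ i, n ≤ i → a i = 0 := fun i hi => by have := ha hi; omega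
  rw [← sum_eq_of_zero hz' (le_max_left n K), sum_eq_of_zero hz (le_max_right n K), hs]

lemma sum_up (a : ℕ → ℕ) {s K : ℕ} (h : s < K) :
    ∑ i ∈ Finset.range K, up a s i = ∑ i ∈ Finset.range K, a i + 1 := by
  simp [up, Finset.sum_add_distrib, h]

lemma up_self (a : ℕ → ℕ) (s : ℕ) : up a s s = a s + 1 := by simp [up]
lemma up_ne (a : ℕ → ℕ) {s i : ℕ} (h : i ≠ s) : up a s i = a i := by simp [up, h]
lemma dn_self (a : ℕ → ℕ) (s : ℕ) : dn a s s = a s - 1 := by simp [dn]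
lemma dn_ne (a : ℕ → ℕ) {s i : ℕ} (h : i ≠ s) : dn a s i = a i := by simp [dn, h]

lemma dn_up (a : ℕ → ℕ) (s : ℕ) : dn (up a s) s = a := by
  funext i; simp [up, dn]

lemma up_dn (a : ℕ → ℕ) {s : ℕ} (h : 1 ≤ a s) : up (dn a s) s = a := by
  funext i; by_cases hi : i = s
  · subst hi; simp [up, dn]; omega
  · simp [up, dn, hi]

lemma up_injective (s : ℕ) : Function.Injective (fun a => up a s) := fun a b h => by
  have := congrArg (fun x => dn x s) h
  simpa [dn_up] using this

lemma up_injective_right (a : ℕ → ℕ) : Function.Injective (up a) := fun s t h => by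
  by_contra hne
  have := congrFun h s
  rw [up_self, up_ne a hne] at this
  omega

/-- addability -/
lemma antitone_up {a : ℕ → ℕ} (ha : Antitone a) (s : ℕ) :
    Antitone (up a s) ↔ (s = 0 ∨ a s < a (s - 1)) := by
  constructor
  · intro h
    by_cases hs : s = 0
    · exact Or.inl hs
    · right
      have := h (show s - 1 ≤ s by omega)
      rw [up_self, up_ne a (by omega)] at this
      omega
  · intro h
    apply antitone_nat_of_succ_le
    intro i
    have := ha (show i ≤ i + 1 by omega)
    by_cases h1 : i + 1 = s
    · subst h1
      rw [up_self, up_ne a (by omega)]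
      rcases h with h | h
      · omega
      · simp at h; omega
    · rw [up_ne a h1]
      simp only [up]; omega

/-- removability -/
lemma antitone_dn {a : ℕ → ℕ} (ha : Antitone a) {s : ℕ} (h : a (s + 1) < a s) :
    Antitone (dn a s) := by
  apply antitone_nat_of_succ_le
  intro i
  have := ha (show i ≤ i + 1 by omega)
  by_cases h1 : i = s
  · subst h1; rw [dn_self, dn_ne a (by omega)]; omega
  · rw [dn_ne a h1]; simp only [dn]; omega

lemma removable_of_antitone_up {a : ℕ → ℕ} (ha : Antitone a) (s : ℕ) :
    up a s (s + 1) < up a s s := by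
  rw [up_self, up_ne a (by omega)]
  have := ha (show s ≤ s + 1 by omega)
  omega

lemma IsP.up {n : ℕ} {a : ℕ → ℕ} (h : IsP n a) {s : ℕ} (hs : Antitone (up a s)) :
    IsP (n + 1) (up a s) := by
  apply isP_of (K := max (s + 1) n) hs
  · intro i hi
    rw [up_ne a (by omega)]
    exact h.zero_of_le (by omega)
  · rw [sum_up a (by omega), h.sum (by omega)]

lemma IsP.le_of_up {n : ℕ} {a : ℕ → ℕ} (h : IsP n a) {s : ℕ} (hs : Antitone (PG.up a s)) :
    s ≤ n := by
  by_contra hlt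
  rcases (antitone_up h.1 s).1 hs with h1 | h1
  · omega
  · have := h.zero_of_le (show n ≤ s - 1 by omega); omega

lemma IsP.dn {n : ℕ} {a : ℕ → ℕ} (h : IsP (n + 1) a) {s : ℕ} (hs : a (s + 1) < a s) :
    IsP n (dn a s) := by
  have hsn : s < n + 1 := by
    by_contra hlt
    have := h.zero_of_le (show n + 1 ≤ s by omega); omega
  apply isP_of (K := n + 1) (antitone_dn h.1 hs)
  · intro i hi; rw [dn_ne a (by omega)]; exact h.zero_of_le hi
  · have h1 := sum_up (PG.dn a s) hsn
    rw [up_dn a (by omega), h.2.2] at h1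
    omega

lemma isP_zero_iff {a : ℕ → ℕ} : IsP 0 a ↔ a = 0 := by
  constructor
  · intro h; funext i; exact h.zero_of_le (Nat.zero_le i)
  · rintro rfl; exact ⟨fun _ _ _ => le_rfl, rfl, by simp⟩

lemma IsP.le {n : ℕ} {a : ℕ → ℕ} (h : IsP n a) (i : ℕ) : a i ≤ n := by
  by_cases hi : i < n
  · have := Finset.single_le_sum (f := a) (fun i _ => Nat.zero_le _) (Finset.mem_range.2 hi)
    rw [h.2.2] at this; exact this
  · rw [h.zero_of_le (by omega)]; omega

lemma finite_isP (n : ℕ) : {a | IsP n a}.Finite := by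
  have : Set.InjOn (fun (a : ℕ → ℕ) (i : Fin n) => (⟨min (a i) n, by omega⟩ : Fin (n + 1)))
      {a | IsP n a} := by
    intro a ha b hb hab
    funext i
    by_cases hi : i < n
    · have := congrFun hab ⟨i, hi⟩
      simp only [Fin.mk.injEq] at this
      have h1 := IsP.le ha i
      have h2 := IsP.le hb i
      omega
    · rw [IsP.zero_of_le ha (by omega), IsP.zero_of_le hb (by omega)]
  exact Set.Finite.of_finite_image (Set.toFinite _) this

/-- partitions of `n` -/
noncomputable def PP (n : ℕ) : Finset (ℕ → ℕ) := (finite_isP n).toFinset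

@[simp] lemma mem_PP {n : ℕ} {a : ℕ → ℕ} : a ∈ PP n ↔ IsP n a := by simp [PP]

lemma PP_zero : PP 0 = {0} := by
  ext a; simp [isP_zero_iff]

/-- number of standard tableaux -/
def dm : ℕ → (ℕ → ℕ) → ℝ
  | 0, _ => 1
  | (n + 1), a => ∑ s ∈ Finset.range (n + 1), if a (s + 1) < a s then dm n (dn a s) else 0

lemma dm_nonneg (n : ℕ) (a : ℕ → ℕ) : 0 ≤ dm n a := by
  induction n generalizing a with
  | zero => simp [dm]
  | succ n ih =>
    rw [dm]
    apply Finset.sum_nonneg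
    intro s _
    split_ifs
    · exact ih _
    · rfl

lemma dm_pos {n : ℕ} {a : ℕ → ℕ} (h : IsP n a) : 0 < dm n a := by
  induction n generalizing a with
  | zero => simp [dm]
  | succ n ih =>
    rw [dm]
    have hex : ∃ s, s < n + 1 ∧ a (s + 1) < a s := by
      by_contra hne
      push Not at hne
      have h1 : ∀ s, s ≤ n + 1 → a 0 ≤ a s := by
        intro s hs
        induction s with
        | zero => rfl
        | succ s ihs => exact (ihs (by omega)).trans (hne s (by omega))
      have h2 := h1 (n + 1) le_rfl
      rw [h.2.1] at h2
      have h3 : ∑ i ∈ Finset.range (n + 1), a i = 0 := by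
        apply Finset.sum_eq_zero
        intro i _
        have := h.1 (Nat.zero_le i)
        omega
      have := h.2.2
      omega
    obtain ⟨s, hs, hlt⟩ := hex
    apply Finset.sum_pos'
    · intro i _
      split_ifs
      · exact dm_nonneg _ _
      · rfl
    · exact ⟨s, by simpa using hs, by rw [if_pos hlt]; exact ih (h.dn hlt)⟩

end PG

namespace PG

noncomputable def VV {K : ℕ} (x : Fin K → ℝ) : ℝ := (Matrix.vandermonde x).det

lemma VV_eq {K : ℕ} (x : Fin K → ℝ) :
    VV x = ∑ σ : Equiv.Perm (Fin K), ((Equiv.Perm.sign σ : ℤ) : ℝ) *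
      ∏ i, (descPochhammer ℝ (σ i)).eval (x i) := by
  unfold VV
  rw [Matrix.det_eval_matrixOfPolynomials_eq_det_vandermonde x
    (fun j : Fin K => descPochhammer ℝ j) (fun i => descPochhammer_natDegree ℝ i)
    (fun i => monic_descPochhammer ℝ i), ← Matrix.det_transpose, Matrix.det_apply']
  rfl

lemma desc_shift (j : ℕ) (x : ℝ) :
    x * (descPochhammer ℝ j).eval (x - 1) = (x - j) * (descPochhammer ℝ j).eval x := by
  have h1 := descPochhammer_succ_eval j x
  have h2 := congrArg (Polynomial.eval x) (descPochhammer_succ_left ℝ j)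
  rw [h1] at h2
  simp at h2
  linarith

lemma VV_VI {K : ℕ} (x : Fin K → ℝ) :
    ∑ s, x s * VV (Function.update x s (x s - 1)) = (∑ s, x s - ∑ s : Fin K, (s : ℝ)) * VV x := by
  have key : ∀ s, x s * VV (Function.update x s (x s - 1)) =
      ∑ σ : Equiv.Perm (Fin K), (x s - (σ s : ℕ)) * (((Equiv.Perm.sign σ : ℤ) : ℝ) *
      ∏ i, (descPochhammer ℝ (σ i)).eval (x i)) := by
    intro s
    rw [VV_eq, Finset.mul_sum]
    refine Finset.sum_congr rfl fun σ _ => ?_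
    rw [← Finset.mul_prod_erase _ _ (Finset.mem_univ s), ← Finset.mul_prod_erase _ _ (Finset.mem_univ s)]
    have : ∏ i ∈ Finset.univ.erase s, (descPochhammer ℝ (σ i)).eval (Function.update x s (x s - 1) i)
      = ∏ i ∈ Finset.univ.erase s, (descPochhammer ℝ (σ i)).eval (x i) := by
      refine Finset.prod_congr rfl fun i hi => ?_
      rw [Function.update_of_ne (Finset.ne_of_mem_erase hi)]
    rw [this, Function.update_self]
    have := desc_shift (σ s) (x s)
    linear_combination (((Equiv.Perm.sign σ : ℤ) : ℝ) * ∏ i ∈ Finset.univ.erase s, (descPochhammer ℝ (σ i)).eval (x i)) * this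
  rw [Finset.sum_congr rfl fun s _ => key s, Finset.sum_comm, VV_eq x, Finset.mul_sum]
  refine Finset.sum_congr rfl fun σ _ => ?_
  rw [← Finset.sum_mul, Finset.sum_sub_distrib, Equiv.sum_comp σ (fun i : Fin K => ((i : ℕ) : ℝ))]

lemma VV_perm {K : ℕ} (x : Fin K → ℝ) (σ : Equiv.Perm (Fin K)) :
    VV (x ∘ σ) = ((Equiv.Perm.sign σ : ℤ) : ℝ) * VV x := by
  unfold VV
  rw [← Matrix.det_permute]
  rfl

lemma VV_zero {K : ℕ} (x : Fin (K + 1) → ℝ) :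
    VV x = (∏ j : Fin K, (x j.succ - x 0)) * VV (fun j : Fin K => x j.succ) := by
  unfold VV
  rw [Matrix.det_vandermonde, Matrix.det_vandermonde, Fin.prod_univ_succ, Fin.prod_Ioi_zero]
  congr 1
  refine Finset.prod_congr rfl fun i _ => ?_
  rw [Fin.prod_Ioi_succ]

lemma VV_upd {K : ℕ} (x : Fin (K + 1) → ℝ) (s : Fin (K + 1)) (y : ℝ) :
    VV (Function.update x s y) * ∏ j ∈ Finset.univ.erase s, (x s - x j) =
    VV x * ∏ j ∈ Finset.univ.erase s, (y - x j) := by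
  have h0 : ∀ z : ℝ, ∃ c : ℝ, VV (Function.update x s z) = c * ∏ j ∈ Finset.univ.erase s, (z - x j) ∧
      ∀ w : ℝ, VV (Function.update x s w) = c * ∏ j ∈ Finset.univ.erase s, (w - x j) := by
    suffices ∃ c : ℝ, ∀ w : ℝ, VV (Function.update x s w) = c * ∏ j ∈ Finset.univ.erase s, (w - x j) by
      obtain ⟨c, hc⟩ := this
      exact fun z => ⟨c, hc z, hc⟩
    set σ := Equiv.swap 0 s
    refine ⟨((Equiv.Perm.sign σ : ℤ) : ℝ) * (-1) ^ K * VV (fun j : Fin K => x (σ j.succ)), fun w => ?_⟩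
    have h1 := VV_perm (Function.update x s w) σ
    have h2 : Function.update x s w ∘ σ = Function.update (x ∘ σ) 0 w := by
      funext i
      by_cases hi : i = 0
      · subst hi; simp [σ]
      · have : σ i ≠ s := by
          intro h
          apply hi
          have : σ (σ i) = σ s := by rw [h]
          simpa [σ] using this
        simp [hi, this]
    rw [h2, VV_zero] at h1
    have h3 : ∏ j ∈ Finset.univ.erase s, (w - x j) = ∏ j : Fin K, (w - x (σ j.succ)) := by
      have e1 : ∏ j ∈ Finset.univ.erase s, (w - x j) = ∏ j ∈ Finset.univ.erase 0, (w - x (σ j)) := by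
        symm
        refine Finset.prod_bij (fun j _ => σ j) ?_ ?_ ?_ ?_
        · intro j hj
          simp only [Finset.mem_erase, Finset.mem_univ, and_true] at hj ⊢
          intro h
          apply hj
          have : σ (σ j) = σ s := by rw [h]
          simpa [σ] using this
        · intro i _ j _ h; exact σ.injective h
        · intro j hj
          refine ⟨σ j, ?_, by simp [σ]⟩
          simp only [Finset.mem_erase, Finset.mem_univ, and_true] at hj ⊢
          intro h
          apply hj
          have : σ (σ j) = σ 0 := by rw [h]
          simpa [σ] using this
        · intro _ _; rfl
      rw [e1]
      have e2 := Finset.mul_prod_erase Finset.univ (fun j => if j = 0 then 1 else (w - x (σ j))) (Finset.mem_univ (0 : Fin (K+1)))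
      rw [Fin.prod_univ_succ] at e2
      simp only [if_true, one_mul, Fin.succ_ne_zero, if_false] at e2
      rw [← e2]
      refine Finset.prod_congr rfl fun i hi => ?_
      simp [Finset.ne_of_mem_erase hi]
    have hs : ((Equiv.Perm.sign σ : ℤ) : ℝ) * ((Equiv.Perm.sign σ : ℤ) : ℝ) = 1 := by
      rcases Int.units_eq_one_or (Equiv.Perm.sign σ) with h | h <;> simp [h]
    have h4 : ∏ j : Fin K, (w - x (σ j.succ)) = (-1) ^ K * ∏ j : Fin K, (x (σ j.succ) - w) := by
      have : ∏ j : Fin K, (w - x (σ j.succ)) = ∏ j : Fin K, ((-1) * (x (σ j.succ) - w)) :=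
        Finset.prod_congr rfl fun i _ => by ring
      rw [this, Finset.prod_mul_distrib]
      simp
    rw [h3, h4]
    simp only [Function.update_self, ne_eq, Fin.succ_ne_zero, not_false_eq_true,
      Function.update_of_ne, Function.comp] at h1
    have h5 : ((-1 : ℝ)) ^ K * (-1) ^ K = 1 := by rw [← mul_pow]; simp
    linear_combination (-VV (Function.update x s w)) * hs - ((Equiv.Perm.sign σ : ℤ) : ℝ) * h1 - (((Equiv.Perm.sign σ : ℤ) : ℝ) * (∏ j : Fin K, (x (σ j.succ) - w)) * VV (fun j : Fin K => x (σ j.succ))) * h5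
  obtain ⟨c, _, hc⟩ := h0 0
  have h1 := hc (x s)
  rw [Function.update_eq_self] at h1
  rw [hc y, h1]
  ring

end PG

namespace PG

def LL (M : ℕ) (a : ℕ → ℕ) (i : ℕ) : ℕ := a i + (M - i)

noncomputable def xx (M : ℕ) (a : ℕ → ℕ) : Fin (M + 1) → ℝ := fun i => (LL M a i : ℝ)
noncomputable def ff (M : ℕ) (a : ℕ → ℕ) : ℝ := ∏ i : Fin (M + 1), ((LL M a i).factorial : ℝ)

lemma ff_ne (M : ℕ) (a : ℕ → ℕ) : ff M a ≠ 0 :=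
  Finset.prod_ne_zero_iff.mpr fun i _ => by positivity

lemma xx_up (M : ℕ) (a : ℕ → ℕ) (s : Fin (M + 1)) :
    xx M (up a s) = Function.update (xx M a) s (xx M a s + 1) := by
  funext i
  by_cases h : i = s
  · subst h; simp [xx, LL, up_self]; ring
  · have : (i : ℕ) ≠ s := fun h' => h (Fin.ext h')
    simp [xx, LL, h, up_ne _ this]

lemma ff_up (M : ℕ) (a : ℕ → ℕ) (s : Fin (M + 1)) :
    ff M (up a s) = ff M a * (xx M a s + 1) := by
  unfold ff
  rw [← Finset.mul_prod_erase _ _ (Finset.mem_univ s), ← Finset.mul_prod_erase _ _ (Finset.mem_univ s)]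
  have : ∏ i ∈ Finset.univ.erase s, ((LL M (up a s) i).factorial : ℝ)
      = ∏ i ∈ Finset.univ.erase s, ((LL M a i).factorial : ℝ) := by
    refine Finset.prod_congr rfl fun i hi => ?_
    have h := Finset.ne_of_mem_erase hi
    have : (i : ℕ) ≠ s := fun h' => h (Fin.ext h')
    simp [LL, up_ne _ this]
  rw [this]
  have h2 : LL M (up a s) s = LL M a s + 1 := by simp [LL, up_self]; ring
  rw [h2, Nat.factorial_succ]
  push_cast
  simp only [xx]
  ring

lemma xx_dn (M : ℕ) (a : ℕ → ℕ) (s : Fin (M + 1)) (h : 1 ≤ a s) :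
    xx M (dn a s) = Function.update (xx M a) s (xx M a s - 1) := by
  have h1 := xx_up M (dn a s) s
  rw [up_dn a h] at h1
  rw [h1]; simp

lemma ff_dn (M : ℕ) (a : ℕ → ℕ) (s : Fin (M + 1)) (h : 1 ≤ a s) :
    ff M a = ff M (dn a s) * xx M a s := by
  have h1 := ff_up M (dn a s) s
  have h2 := xx_up M (dn a s) s
  rw [up_dn a h] at h1 h2
  rw [h1, h2]; simp

lemma VV_eq_zero {K : ℕ} (x : Fin K → ℝ) {i j : Fin K} (hij : i ≠ j) (h : x i = x j) : VV x = 0 :=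
  Matrix.det_vandermonde_eq_zero_iff.mpr ⟨i, j, h, hij⟩

lemma frob (M : ℕ) : ∀ (n : ℕ) (a : ℕ → ℕ), IsP n a → n ≤ M →
    dm n a * (VV (xx M 0) / ff M 0) = n.factorial * (VV (xx M a) / ff M a) := by
  intro n
  induction n with
  | zero =>
    intro a ha _
    rw [isP_zero_iff] at ha
    subst ha
    simp [dm]
  | succ n ih =>
    intro a ha hn
    have h1 : dm (n + 1) a = ∑ s : Fin (M + 1), if a (s + 1) < a s then dm n (dn a s) else 0 := by
      rw [Fin.sum_univ_eq_sum_range (fun s => if a (s + 1) < a s then dm n (dn a s) else 0)]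
      rw [dm]
      apply Finset.sum_subset
      · intro i; simp; omega
      · intro i _ h2
        simp at h2
        have := ha.zero_of_le (i := i) (by omega)
        simp [this]
    have h2 : ∀ s : Fin (M + 1), (if a (s + 1) < a s then dm n (dn a s) else 0) * (VV (xx M 0) / ff M 0)
        = n.factorial * (xx M a s * VV (Function.update (xx M a) s (xx M a s - 1)) / ff M a) := by
      intro s
      split_ifs with hs
      · rw [ih _ (ha.dn hs) (by omega)]
        have h3 : 1 ≤ a s := by omega
        rw [xx_dn M a s h3, ff_dn M a s h3]
        have h4 : xx M a s ≠ 0 := by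
          have : 0 < LL M a s := by simp [LL]; omega
          simp only [xx]; positivity
        have := ff_ne M (dn a s)
        field_simp
      · rw [zero_mul]
        have hle := ha.1 (Nat.le_succ (s : ℕ))
        simp only [Nat.succ_eq_add_one] at hle
        by_cases hM : (s : ℕ) = M
        · have : xx M a s = 0 := by
            simp [xx, LL, hM, ha.zero_of_le hn]
          simp [this]
        · have hlt : (s : ℕ) + 1 < M + 1 := by omega
          have : VV (Function.update (xx M a) s (xx M a s - 1)) = 0 := by
            refine VV_eq_zero _ (i := s) (j := ⟨s + 1, hlt⟩) ?_ ?_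
            · intro h; have := congrArg Fin.val h; simp at this
            · have hne : (⟨(s : ℕ) + 1, hlt⟩ : Fin (M + 1)) ≠ s := by
                intro h; have := congrArg Fin.val h; simp at this
              rw [Function.update_self, Function.update_of_ne hne]
              have : LL M a s = LL M a (s + 1) + 1 := by simp only [LL]; omega
              simp only [xx, this]; push_cast; ring
          simp [this]
    rw [h1, Finset.sum_mul, Finset.sum_congr rfl fun s _ => h2 s, ← Finset.mul_sum, ← Finset.sum_div, VV_VI]
    have h5 : ∑ s : Fin (M + 1), xx M a s - ∑ s : Fin (M + 1), ((s : ℕ) : ℝ) = n + 1 := by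
      have e1 : ∑ s : Fin (M + 1), xx M a s = ∑ s ∈ Finset.range (M + 1), ((a s : ℝ) + ((M - s : ℕ) : ℝ)) := by
        rw [← Fin.sum_univ_eq_sum_range (fun s => ((a s : ℝ) + ((M - s : ℕ) : ℝ)))]
        refine Finset.sum_congr rfl fun s _ => ?_
        simp [xx, LL]
      rw [e1, Fin.sum_univ_eq_sum_range (fun s => (s : ℝ)), Finset.sum_add_distrib]
      have e2 := Finset.sum_range_reflect (fun s => (s : ℝ)) (M + 1)
      simp only [Nat.add_sub_cancel] at e2
      rw [e2]
      have e3 := ha.sum (K := M + 1) (by omega)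
      have e4 : ∑ s ∈ Finset.range (M + 1), (a s : ℝ) = n + 1 := by exact_mod_cast e3
      rw [e4]; ring
    rw [h5, Nat.factorial_succ]
    push_cast
    ring

/-- shifted coordinates -/
noncomputable def cc (a : ℕ → ℕ) (i : ℕ) : ℝ := (a i : ℝ) - i

lemma xx_eq (M : ℕ) (a : ℕ → ℕ) (i : Fin (M + 1)) : xx M a i = cc a i + M := by
  have : (i : ℕ) ≤ M := by omega
  simp only [xx, LL, cc]; push_cast [this]; ring

lemma cc_strictAnti {a : ℕ → ℕ} (ha : Antitone a) : StrictAnti (cc a) := by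
  intro i j hij
  have := ha hij.le
  simp only [cc]
  have h1 : (a j : ℝ) ≤ a i := by exact_mod_cast this
  have h2 : (i : ℝ) < j := by exact_mod_cast hij
  linarith

lemma VV_ne {M : ℕ} {a : ℕ → ℕ} (ha : Antitone a) : VV (xx M a) ≠ 0 := by
  refine Matrix.det_vandermonde_ne_zero_iff.mpr ?_
  intro i j h
  rw [xx_eq, xx_eq] at h
  have : (i : ℕ) = j := (cc_strictAnti ha).injective (by linarith)
  exact Fin.ext this

lemma prod_erase_fin (M : ℕ) (f : ℕ → ℝ) (s : Fin (M + 1)) :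
    ∏ j ∈ Finset.univ.erase s, f j = ∏ j ∈ (Finset.range (M + 1)).erase s, f j := by
  refine Finset.prod_bij (fun j _ => (j : ℕ)) ?_ ?_ ?_ ?_
  · intro j hj
    have := Finset.ne_of_mem_erase hj
    simp only [Finset.mem_erase, Finset.mem_range]
    exact ⟨fun h => this (Fin.ext h), j.2⟩
  · intro i _ j _ h; exact Fin.ext h
  · intro j hj
    simp only [Finset.mem_erase, Finset.mem_range] at hj
    refine ⟨⟨j, hj.2⟩, ?_, rfl⟩
    simp only [Finset.mem_erase, Finset.mem_univ, and_true]
    intro h; exact hj.1 (congrArg Fin.val h)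
  · intro _ _; rfl

/-- transition probabilities -/
noncomputable def tp (n : ℕ) (a : ℕ → ℕ) (s : ℕ) : ℝ :=
  open Classical in
  if Antitone (up a s) then dm (n + 1) (up a s) / ((n + 1) * dm n a) else 0

lemma tp_nonneg (n : ℕ) (a : ℕ → ℕ) (s : ℕ) : 0 ≤ tp n a s := by
  unfold tp
  split_ifs
  · have := dm_nonneg n a
    have := dm_nonneg (n+1) (up a s)
    positivity
  · rfl

lemma tp_eq {n : ℕ} {a : ℕ → ℕ} (h : IsP n a) {M : ℕ} (hM : n + 1 ≤ M) {s : ℕ} (hs : s < M) :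
    tp n a s * ∏ j ∈ (Finset.range (M + 1)).erase s, (cc a s - cc a j) =
      ∏ j ∈ Finset.range M, (cc a s + 1 - cc a j) := by
  unfold tp
  split_ifs with hu
  · have f1 := frob M n a h (by omega)
    have f2 := frob M (n + 1) (up a s) (h.up hu) hM
    set S : Fin (M + 1) := ⟨s, by omega⟩
    have hS : (S : ℕ) = s := rfl
    rw [← hS, xx_up, ff_up] at f2
    have f3 := VV_upd (xx M a) S (xx M a S + 1)
    have e1 : ∏ j ∈ Finset.univ.erase S, (xx M a S - xx M a j) = ∏ j ∈ (Finset.range (M + 1)).erase s, (cc a s - cc a j) := by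
      rw [← hS, ← prod_erase_fin M (fun j => cc a S - cc a j)]
      refine Finset.prod_congr rfl fun i _ => ?_
      rw [xx_eq, xx_eq]; ring
    have e2 : ∏ j ∈ Finset.univ.erase S, (xx M a S + 1 - xx M a j) = ∏ j ∈ (Finset.range (M + 1)).erase s, (cc a s + 1 - cc a j) := by
      rw [← hS, ← prod_erase_fin M (fun j => cc a S + 1 - cc a j)]
      refine Finset.prod_congr rfl fun i _ => ?_
      rw [xx_eq, xx_eq]; ring
    rw [e1, e2] at f3
    have e3 : ∏ j ∈ (Finset.range (M + 1)).erase s, (cc a s + 1 - cc a j)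
        = (∏ j ∈ Finset.range M, (cc a s + 1 - cc a j)) * (xx M a S + 1) := by
      have g1 := Finset.mul_prod_erase (Finset.range (M+1)) (fun j => cc a s + 1 - cc a j) (a := s) (by simp; omega)
      have g2 : cc a s + 1 - cc a s = 1 := by ring
      simp only [g2, one_mul] at g1
      rw [g1, Finset.prod_range_succ, xx_eq]
      have : cc a M = - M := by simp [cc, h.zero_of_le (i := M) (by omega)]
      rw [this]; ring
    rw [e3] at f3
    have n1 := ff_ne M a
    have n2 : xx M a S + 1 ≠ 0 := by simp only [xx]; positivity
    have n3 := VV_ne (M := M) h.1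
    have n4 := dm_pos h
    have n5 : VV (xx M 0) ≠ 0 := VV_ne (fun _ _ _ => le_rfl)
    have n6 := ff_ne M 0
    have hfac : (Nat.factorial n : ℝ) ≠ 0 := by positivity
    set D := ∏ j ∈ (Finset.range (M + 1)).erase s, (cc a s - cc a j)
    set N := ∏ j ∈ Finset.range M, (cc a s + 1 - cc a j)
    set U := VV (Function.update (xx M a) S (xx M a S + 1))
    set d' := dm (n + 1) (up a S)
    rw [Nat.factorial_succ] at f2
    push_cast at f2
    field_simp at f1 f2 ⊢
    -- f1 : dm * V0 * ffa = n! * Va * ff0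
    have g : ((d' * D) * ((Nat.factorial n : ℝ) * VV (xx M a) * ff M 0)) = (N * ((n + 1) * dm n a)) * ((Nat.factorial n : ℝ) * VV (xx M a) * ff M 0) := by
      have : (xx M a S + 1) * VV (xx M 0) * ff M a ≠ 0 := by positivity
      apply mul_right_cancel₀ this
      have a1 : d' * VV (xx M 0) * ff M a * (xx M a S + 1) = (n+1) * (Nat.factorial n) * U * ff M 0 := by linarith
      have a2 : dm n a * VV (xx M 0) * ff M a = (Nat.factorial n) * VV (xx M a) * ff M 0 := by linarith
      have a3 : U * D = VV (xx M a) * N * (xx M a S + 1) := by linarith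
      linear_combination (D * ((Nat.factorial n : ℝ) * VV (xx M a) * ff M 0)) * a1 + ((n+1) * (Nat.factorial n) * ff M 0 * ((Nat.factorial n : ℝ) * VV (xx M a) * ff M 0)) * a3 - (N * (n+1) * ((Nat.factorial n : ℝ) * VV (xx M a) * ff M 0) * (xx M a S + 1)) * a2
    have := mul_right_cancel₀ (by positivity) g
    linarith
  · rw [zero_mul]
    symm
    rw [antitone_up h.1] at hu
    push Not at hu
    obtain ⟨h1, h2⟩ := hu
    apply Finset.prod_eq_zero (i := s - 1)
    · simp; omega
    · have h3 := h.1 (show s - 1 ≤ s by omega)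
      have h4 : a s = a (s - 1) := by omega
      simp only [cc, h4]
      have : ((s - 1 : ℕ) : ℝ) = s - 1 := by push_cast [show 1 ≤ s by omega]; ring
      rw [this]; ring

lemma tp_zero {n : ℕ} {a : ℕ → ℕ} (h : IsP n a) {s : ℕ} (hs : n + 1 ≤ s) : tp n a s = 0 := by
  unfold tp
  rw [if_neg]
  intro hu
  have := h.le_of_up hu
  omega

end PG

namespace PG

noncomputable def tm (n : ℕ) (a : ℕ → ℕ) (m : ℕ) : ℝ :=
  ∑ s ∈ Finset.range (n + 1), tp n a s * cc a s ^ m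

lemma sum_tp_ext {n : ℕ} {a : ℕ → ℕ} (h : IsP n a) {K : ℕ} (hK : n + 1 ≤ K) (f : ℕ → ℝ) :
    ∑ s ∈ Finset.range (n + 1), tp n a s * f s = ∑ s ∈ Finset.range K, tp n a s * f s := by
  apply Finset.sum_subset
  · intro i; simp; omega
  · intro i _ h2
    rw [tp_zero h (by simpa using h2), zero_mul]

lemma lagr {n : ℕ} {a : ℕ → ℕ} (h : IsP n a) {M : ℕ} (hM : n + 1 ≤ M) (z : ℝ) :
    ∑ i ∈ Finset.range (M + 1), tp n a i * ∏ j ∈ (Finset.range (M + 1)).erase i, (z - cc a j)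
      = ∏ j ∈ Finset.range M, (z + 1 - cc a j) := by
  classical
  set P : Polynomial ℝ := ∏ j ∈ Finset.range M, (Polynomial.X - Polynomial.C (cc a j - 1)) with hP
  have hdeg : P.degree < (Finset.range (M + 1)).card := by
    rw [hP, Polynomial.degree_prod]
    simp only [Polynomial.degree_X_sub_C]
    simp
    exact_mod_cast Nat.lt_succ_self M
  have hev : ∀ x : ℝ, P.eval x = ∏ j ∈ Finset.range M, (x + 1 - cc a j) := by
    intro x
    rw [hP, Polynomial.eval_prod]
    refine Finset.prod_congr rfl fun j _ => ?_
    simp; ring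
  have hinj : Set.InjOn (cc a) (Finset.range (M + 1)) := (cc_strictAnti h.1).injective.injOn
  have h1 := Lagrange.eq_interpolate hinj hdeg
  have h2 := congrArg (Polynomial.eval z) h1
  rw [hev, Lagrange.interpolate_apply, Polynomial.eval_finset_sum] at h2
  rw [h2]
  refine Finset.sum_congr rfl fun i hi => ?_
  rw [Polynomial.eval_mul, Polynomial.eval_C, hev]
  have h3 : tp n a i * ∏ j ∈ (Finset.range (M + 1)).erase i, (cc a i - cc a j) =
      ∏ j ∈ Finset.range M, (cc a i + 1 - cc a j) := by
    by_cases hiM : i < M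
    · exact tp_eq h hM hiM
    · have : i = M := by simp at hi; omega
      subst this
      rw [tp_zero h hM, zero_mul]
      symm
      apply Finset.prod_eq_zero (i := i - 1)
      · simp; omega
      · simp only [cc, h.zero_of_le (i := i) (by omega), h.zero_of_le (i := i - 1) (by omega)]
        push_cast [show 1 ≤ i by omega]; ring
  rw [← h3, Lagrange.basis, Polynomial.eval_prod]
  rw [mul_assoc, ← Finset.prod_mul_distrib]
  congr 1
  refine Finset.prod_congr rfl fun j hj => ?_
  have hne : cc a i - cc a j ≠ 0 := by
    intro h0
    exact Finset.ne_of_mem_erase hj ((cc_strictAnti h.1).injective (by linarith))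
  rw [Lagrange.basisDivisor]
  simp
  field_simp

lemma lagr_rev {n : ℕ} {a : ℕ → ℕ} (h : IsP n a) {M : ℕ} (hM : n + 1 ≤ M) :
    ∑ i ∈ Finset.range (M + 1), Polynomial.C (tp n a i) *
        ∏ j ∈ (Finset.range (M + 1)).erase i, (1 - Polynomial.C (cc a j) * Polynomial.X)
      = ∏ j ∈ Finset.range M, (1 - Polynomial.C (cc a j - 1) * Polynomial.X) := by
  apply Polynomial.eq_of_infinite_eval_eq
  apply Set.Infinite.mono (s := Set.Ioi 0)
  swap
  · exact Set.Ioi_infinite 0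
  intro w hw
  have hw : (0:ℝ) < w := hw
  simp only [Set.mem_setOf_eq]
  rw [Polynomial.eval_finset_sum, Polynomial.eval_prod]
  have h1 := lagr h hM w⁻¹
  have h2 := congrArg (fun x => x * w ^ M) h1
  simp only [Finset.sum_mul] at h2
  convert h2 using 1
  · refine Finset.sum_congr rfl fun i hi => ?_
    rw [Polynomial.eval_mul, Polynomial.eval_prod, mul_assoc]
    simp only [Polynomial.eval_C]
    congr 1
    have : w ^ M = ∏ j ∈ (Finset.range (M + 1)).erase i, w := by
      rw [Finset.prod_const, Finset.card_erase_of_mem hi]; simp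
    rw [this, ← Finset.prod_mul_distrib]
    refine Finset.prod_congr rfl fun j _ => ?_
    simp; field_simp
  · have : w ^ M = ∏ j ∈ Finset.range M, w := by simp
    rw [this, ← Finset.prod_mul_distrib]
    refine Finset.prod_congr rfl fun j _ => ?_
    simp; field_simp; ring

noncomputable def ln (c : ℝ) : PowerSeries ℝ := 1 - PowerSeries.C c * PowerSeries.X

lemma geo_ln (c : ℝ) : PowerSeries.mk (fun m => c ^ m) * ln c = 1 := by
  ext m
  rw [ln, mul_sub, mul_one, ← mul_assoc]
  rcases m with _ | m
  · simp
  · rw [map_sub, PowerSeries.coeff_succ_mul_X, PowerSeries.coeff_mul_C]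
    simp [PowerSeries.coeff_one]
    ring

noncomputable def TT (n : ℕ) (a : ℕ → ℕ) : PowerSeries ℝ := PowerSeries.mk (tm n a)

lemma TT_mul {n : ℕ} {a : ℕ → ℕ} (h : IsP n a) {M : ℕ} (hM : n + 1 ≤ M) :
    TT n a * ∏ j ∈ Finset.range (M + 1), ln (cc a j) = ∏ j ∈ Finset.range M, ln (cc a j - 1) := by
  have h1 : TT n a = ∑ i ∈ Finset.range (M + 1), PowerSeries.C (tp n a i) * PowerSeries.mk (fun m => cc a i ^ m) := by
    ext m
    rw [map_sum, TT, PowerSeries.coeff_mk, tm, sum_tp_ext h (show n + 1 ≤ M + 1 by omega)]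
    simp
  have h2 := congrArg (fun q : Polynomial ℝ => (Polynomial.coeToPowerSeries.ringHom q)) (lagr_rev h hM)
  simp only [map_sum, map_mul, map_prod, map_sub, map_one, Polynomial.coeToPowerSeries.ringHom_apply,
    Polynomial.coe_C, Polynomial.coe_X] at h2
  have h3 : ∏ j ∈ Finset.range M, ln (cc a j - 1) = ∏ x ∈ Finset.range M, (1 - (PowerSeries.C (cc a x) - 1) * PowerSeries.X) :=
    Finset.prod_congr rfl fun j _ => by simp [ln]
  rw [h3, ← h2, h1, Finset.sum_mul]
  refine Finset.sum_congr rfl fun i hi => ?_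
  rw [← Finset.mul_prod_erase _ _ hi, mul_assoc, ← mul_assoc (PowerSeries.mk _), geo_ln, one_mul]
  rfl

lemma ln_ne (c : ℝ) : ln c ≠ 0 := by
  intro h
  have := congrArg (PowerSeries.coeff 0) h
  simp [ln] at this

lemma cc_up_self (a : ℕ → ℕ) (s : ℕ) : cc (up a s) s = cc a s + 1 := by
  simp [cc, up_self]; ring
lemma cc_up_ne (a : ℕ → ℕ) {s i : ℕ} (h : i ≠ s) : cc (up a s) i = cc a i := by
  simp [cc, up_ne a h]

lemma TT_up {n : ℕ} {a : ℕ → ℕ} (h : IsP n a) {s : ℕ} (hu : Antitone (up a s)) :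
    TT (n + 1) (up a s) * (ln (cc a s + 1) * ln (cc a s - 1)) = TT n a * (ln (cc a s) * ln (cc a s)) := by
  have hs : s ≤ n := h.le_of_up hu
  have h1 := TT_mul h (M := n + 2) (by omega)
  have h2 := TT_mul (h.up hu) (M := n + 2) (by omega)
  have m1 : s ∈ Finset.range (n + 2 + 1) := by simp; omega
  have m2 : s ∈ Finset.range (n + 2) := by simp; omega
  rw [← Finset.mul_prod_erase _ _ m1, ← Finset.mul_prod_erase _ _ m2] at h1 h2
  have e1 : ∏ j ∈ (Finset.range (n + 2 + 1)).erase s, ln (cc (up a s) j) = ∏ j ∈ (Finset.range (n + 2 + 1)).erase s, ln (cc a j) :=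
    Finset.prod_congr rfl fun j hj => by rw [cc_up_ne a (Finset.ne_of_mem_erase hj)]
  have e2 : ∏ j ∈ (Finset.range (n + 2)).erase s, ln (cc (up a s) j - 1) = ∏ j ∈ (Finset.range (n + 2)).erase s, ln (cc a j - 1) :=
    Finset.prod_congr rfl fun j hj => by rw [cc_up_ne a (Finset.ne_of_mem_erase hj)]
  rw [e1, e2, cc_up_self] at h2
  rw [show cc a s + 1 - 1 = cc a s by ring] at h2
  set Q := ∏ j ∈ (Finset.range (n + 2 + 1)).erase s, ln (cc a j)
  set R := ∏ j ∈ (Finset.range (n + 2)).erase s, ln (cc a j - 1)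
  have hQ : Q ≠ 0 := Finset.prod_ne_zero_iff.mpr fun j _ => ln_ne _
  apply mul_right_cancel₀ hQ
  linear_combination (ln (cc a s - 1)) * h2 - ln (cc a s) * h1

noncomputable def hh (c : ℝ) (j : ℕ) : ℝ := ((c + 1) ^ (j + 1) - (c - 1) ^ (j + 1)) / 2

lemma hh_mul (c : ℝ) : PowerSeries.mk (hh c) * PowerSeries.X * (ln (c + 1) * ln (c - 1)) = PowerSeries.X := by
  have h1 : PowerSeries.mk (hh c) * PowerSeries.X * PowerSeries.C 2 = PowerSeries.mk (fun m => (c+1) ^ m) - PowerSeries.mk (fun m => (c-1) ^ m) := by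
    ext m
    rw [PowerSeries.coeff_mul_C]
    rcases m with _ | m
    · simp
    · rw [PowerSeries.coeff_succ_mul_X]
      simp [hh]
  have h2 := geo_ln (c + 1)
  have h3 := geo_ln (c - 1)
  have h4 : ln (c - 1) - ln (c + 1) = PowerSeries.C 2 * PowerSeries.X := by
    simp only [ln]
    have : PowerSeries.C (2:ℝ) = PowerSeries.C (c + 1) - PowerSeries.C (c - 1) := by
      rw [← map_sub]; congr 1; ring
    rw [this]
    ring
  have hC : (PowerSeries.C (2:ℝ)) ≠ 0 := by
    intro h
    have := congrArg (PowerSeries.coeff 0) h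
    simp at this
  apply mul_right_cancel₀ hC
  linear_combination (ln (c + 1) * ln (c - 1)) * h1 + ln (c - 1) * h2 - ln (c + 1) * h3 + h4

lemma TT_up' {n : ℕ} {a : ℕ → ℕ} (h : IsP n a) {s : ℕ} (hu : Antitone (up a s)) :
    TT (n + 1) (up a s) = TT n a + (TT n a * PowerSeries.mk (hh (cc a s))) * PowerSeries.X * PowerSeries.X := by
  have h1 := TT_up h hu
  have h2 := hh_mul (cc a s)
  have h3 : ln (cc a s) * ln (cc a s) - ln (cc a s + 1) * ln (cc a s - 1) = PowerSeries.X * PowerSeries.X := by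
    simp only [ln, map_add, map_sub, map_one]
    ring
  apply mul_right_cancel₀ (mul_ne_zero (ln_ne (cc a s + 1)) (ln_ne (cc a s - 1)))
  linear_combination h1 + (-TT n a * PowerSeries.X) * h2 + TT n a * h3

lemma tm_up_two {n : ℕ} {a : ℕ → ℕ} (h : IsP n a) {s : ℕ} (hu : Antitone (up a s)) (m : ℕ) :
    tm (n + 1) (up a s) (m + 2) = tm n a (m + 2) +
      ∑ q ∈ Finset.HasAntidiagonal.antidiagonal m, tm n a q.1 * hh (cc a s) q.2 := by
  have h1 := congrArg (PowerSeries.coeff (m + 2)) (TT_up' h hu)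
  rw [map_add, PowerSeries.coeff_succ_mul_X, PowerSeries.coeff_succ_mul_X, PowerSeries.coeff_mul] at h1
  simpa [TT] using h1

lemma tm_up_one {n : ℕ} {a : ℕ → ℕ} (h : IsP n a) {s : ℕ} (hu : Antitone (up a s)) :
    tm (n + 1) (up a s) 1 = tm n a 1 := by
  have h1 := congrArg (PowerSeries.coeff 1) (TT_up' h hu)
  rw [map_add, PowerSeries.coeff_succ_mul_X] at h1
  simpa [TT] using h1

lemma tm_zero {n : ℕ} {a : ℕ → ℕ} (h : IsP n a) : tm n a 0 = 1 := by
  have h1 := congrArg PowerSeries.constantCoeff (TT_mul h (M := n + 1) le_rfl)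
  rw [map_mul, map_prod, map_prod] at h1
  simpa [TT, ln] using h1

lemma sum_tp {n : ℕ} {a : ℕ → ℕ} (h : IsP n a) : ∑ s ∈ Finset.range (n + 1), tp n a s = 1 := by
  have := tm_zero h
  simpa [tm] using this

lemma tp_empty : tp 0 0 0 = 1 := by
  have := sum_tp (isP_zero_iff.mpr rfl)
  simpa using this

lemma tm_empty (m : ℕ) : tm 0 0 m = 0 ^ m := by
  simp [tm, tp_empty, cc]

lemma IsP.exists_dn {n : ℕ} {a : ℕ → ℕ} (h : IsP (n + 1) a) :
    ∃ b s, IsP n b ∧ Antitone (PG.up b s) ∧ a = PG.up b s := by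
  have hp := dm_pos h
  rw [dm] at hp
  obtain ⟨s, _, hs⟩ := Finset.exists_ne_zero_of_sum_ne_zero hp.ne'
  have hr : a (s + 1) < a s := by
    by_contra hc
    simp [hc] at hs
  refine ⟨PG.dn a s, s, h.dn hr, ?_, ?_⟩
  · rw [up_dn a (by omega)]; exact h.1
  · rw [up_dn a (by omega)]

lemma tm_one {n : ℕ} {a : ℕ → ℕ} (h : IsP n a) : tm n a 1 = 0 := by
  induction n generalizing a with
  | zero => rw [isP_zero_iff] at h; subst h; rw [tm_empty]; simp
  | succ n ih =>
    obtain ⟨b, s, hb, hu, rfl⟩ := h.exists_dn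
    rw [tm_up_one hb hu, ih hb]

end PG

namespace PG

lemma tp_of {n : ℕ} {a : ℕ → ℕ} {s : ℕ} (h : Antitone (up a s)) :
    tp n a s = dm (n + 1) (up a s) / ((n + 1) * dm n a) := by
  unfold tp; rw [if_pos h]
lemma tp_not {n : ℕ} {a : ℕ → ℕ} {s : ℕ} (h : ¬ Antitone (up a s)) : tp n a s = 0 := by
  unfold tp; rw [if_neg h]

lemma sum_updn (n : ℕ) (s : ℕ) (G : (ℕ → ℕ) → (ℕ → ℕ) → ℝ) : open Classical in
    (∑ a ∈ PP n, if Antitone (up a s) then G a (up a s) else 0) =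
      ∑ b ∈ PP (n + 1), if b (s + 1) < b s then G (dn b s) b else 0 := by
  classical
  rw [← Finset.sum_filter, ← Finset.sum_filter]
  refine Finset.sum_bij' (fun a _ => up a s) (fun b _ => dn b s) ?_ ?_ ?_ ?_ ?_
  · intro a ha
    simp only [Finset.mem_filter, mem_PP] at ha ⊢
    refine ⟨ha.1.up ha.2, removable_of_antitone_up ha.1.1 s⟩
  · intro b hb
    simp only [Finset.mem_filter, mem_PP] at hb ⊢
    refine ⟨hb.1.dn hb.2, ?_⟩
    rw [up_dn b (by omega)]; exact hb.1.1
  · intro a _; exact dn_up a s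
  · intro b hb
    simp only [Finset.mem_filter, mem_PP] at hb
    exact up_dn b (by omega)
  · intro a _
    simp only [dn_up]

noncomputable def EE (n : ℕ) (F : (ℕ → ℕ) → ℝ) : ℝ :=
  ∑ a ∈ PP n, dm n a ^ 2 / n.factorial * F a

lemma EE_congr {n : ℕ} {F G : (ℕ → ℕ) → ℝ} (h : ∀ a, IsP n a → F a = G a) : EE n F = EE n G :=
  Finset.sum_congr rfl fun a ha => by rw [h a (by simpa using ha)]

lemma EE_mono {n : ℕ} {F G : (ℕ → ℕ) → ℝ} (h : ∀ a, IsP n a → F a ≤ G a) : EE n F ≤ EE n G :=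
  Finset.sum_le_sum fun a ha => by
    have := h a (by simpa using ha)
    gcongr

lemma EE_nonneg {n : ℕ} {F : (ℕ → ℕ) → ℝ} (h : ∀ a, IsP n a → 0 ≤ F a) : 0 ≤ EE n F :=
  Finset.sum_nonneg fun a ha => by
    have := h a (by simpa using ha)
    positivity

lemma EE_add (n : ℕ) (F G : (ℕ → ℕ) → ℝ) : EE n (fun a => F a + G a) = EE n F + EE n G := by
  simp [EE, mul_add, Finset.sum_add_distrib]

lemma EE_sub (n : ℕ) (F G : (ℕ → ℕ) → ℝ) : EE n (fun a => F a - G a) = EE n F - EE n G := by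
  simp [EE, mul_sub, Finset.sum_sub_distrib]

lemma EE_mul (n : ℕ) (c : ℝ) (F : (ℕ → ℕ) → ℝ) : EE n (fun a => c * F a) = c * EE n F := by
  simp only [EE, Finset.mul_sum]
  exact Finset.sum_congr rfl fun a _ => by ring

lemma EE_sum {ι : Type*} (n : ℕ) (S : Finset ι) (F : ι → (ℕ → ℕ) → ℝ) :
    EE n (fun a => ∑ i ∈ S, F i a) = ∑ i ∈ S, EE n (F i) := by
  simp only [EE, Finset.mul_sum]
  exact Finset.sum_comm

lemma EE_succ (n : ℕ) (F : (ℕ → ℕ) → ℝ) :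
    EE (n + 1) F = EE n (fun a => ∑ s ∈ Finset.range (n + 1), tp n a s * F (up a s)) := by
  classical
  have h1 : EE n (fun a => ∑ s ∈ Finset.range (n + 1), tp n a s * F (up a s)) =
      ∑ s ∈ Finset.range (n + 1), ∑ a ∈ PP n, if Antitone (up a s) then
        (fun a b => dm n a * dm (n + 1) b / (n + 1).factorial * F b) a (up a s) else 0 := by
    rw [EE_sum]
    refine Finset.sum_congr rfl fun s _ => Finset.sum_congr rfl fun a ha => ?_
    have hp := dm_pos (by simpa using ha : IsP n a)
    beta_reduce
    split_ifs with hu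
    · rw [tp_of hu, Nat.factorial_succ]; push_cast; field_simp
    · rw [tp_not hu]; simp
  rw [h1]
  rw [Finset.sum_congr rfl fun s _ => sum_updn n s (fun a b => dm n a * dm (n + 1) b / (n + 1).factorial * F b)]
  rw [Finset.sum_comm]
  refine Finset.sum_congr rfl fun b _ => ?_
  have : dm (n + 1) b ^ 2 / ↑(n + 1).factorial * F b = (∑ s ∈ Finset.range (n + 1), if b (s + 1) < b s then dm n (dn b s) else 0) * (dm (n + 1) b / ↑(n + 1).factorial * F b) := by
    have : (∑ s ∈ Finset.range (n + 1), if b (s + 1) < b s then dm n (dn b s) else 0) = dm (n + 1) b := by rw [dm]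
    rw [this]; ring
  rw [this, Finset.sum_mul]
  refine Finset.sum_congr rfl fun s _ => ?_
  split_ifs
  · ring
  · ring

lemma EE_zero (F : (ℕ → ℕ) → ℝ) : EE 0 F = F 0 := by
  simp [EE, PP_zero, dm]

lemma EE_one (n : ℕ) : EE n (fun _ => 1) = 1 := by
  induction n with
  | zero => rw [EE_zero]
  | succ n ih =>
    rw [EE_succ]
    conv_rhs => rw [← ih]
    exact EE_congr fun a ha => by simpa using sum_tp ha

lemma EE_const (n : ℕ) (c : ℝ) : EE n (fun _ => c) = c := by
  have := EE_mul n c (fun _ => 1)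
  simpa [EE_one] using this

lemma EE_cs (n : ℕ) (F G : (ℕ → ℕ) → ℝ) :
    (EE n (fun a => F a * G a)) ^ 2 ≤ EE n (fun a => F a ^ 2) * EE n (fun a => G a ^ 2) := by
  unfold EE
  refine Finset.sum_sq_le_sum_mul_sum_of_sq_le_mul _ ?_ ?_ ?_
  · intros; positivity
  · intros; positivity
  · intros; apply le_of_eq; ring

lemma EE_cs' (n : ℕ) (F G : (ℕ → ℕ) → ℝ) :
    |EE n (fun a => F a * G a)| ≤ Real.sqrt (EE n (fun a => F a ^ 2)) * Real.sqrt (EE n (fun a => G a ^ 2)) := by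
  rw [← Real.sqrt_mul (EE_nonneg fun _ _ => by positivity), ← Real.sqrt_sq_eq_abs]
  exact Real.sqrt_le_sqrt (EE_cs n F G)

lemma EE_abs (n : ℕ) (F : (ℕ → ℕ) → ℝ) : |EE n F| ≤ EE n (fun a => |F a|) := by
  unfold EE
  refine (Finset.abs_sum_le_sum_abs _ _).trans (le_of_eq ?_)
  refine Finset.sum_congr rfl fun a _ => ?_
  rw [abs_mul, abs_of_nonneg (by positivity : 0 ≤ dm n a ^ 2 / (n.factorial : ℝ))]

end PG

namespace PG

open Finset.HasAntidiagonal (antidiagonal)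

noncomputable def cat (m : ℕ) : ℝ := if Even m then (catalan (m / 2) : ℝ) else 0

lemma cat_zero : cat 0 = 1 := by simp [cat]
lemma cat_one : cat 1 = 0 := by simp [cat]
lemma cat_even (k : ℕ) : cat (2 * k) = catalan k := by simp [cat]
lemma cat_odd (k : ℕ) : cat (2 * k + 1) = 0 := by
  simp [cat]

lemma sum_even (f : ℕ → ℝ) (hf : ∀ k, f (2 * k + 1) = 0) (k : ℕ) :
    ∑ i ∈ Finset.range (2 * k + 1), f i = ∑ i ∈ Finset.range (k + 1), f (2 * i) := by
  induction k with
  | zero => simp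
  | succ k ih =>
    rw [show 2 * (k + 1) + 1 = (2 * k + 1) + 1 + 1 by ring, Finset.sum_range_succ, Finset.sum_range_succ, ih,
      Finset.sum_range_succ _ (k + 1), hf, show 2 * k + 1 + 1 = 2 * (k + 1) by ring]
    ring

lemma cat_rec (m : ℕ) : cat (m + 2) = ∑ q ∈ antidiagonal m, cat q.1 * cat q.2 := by
  rw [Finset.Nat.sum_antidiagonal_eq_sum_range_succ (fun i j => cat i * cat j)]
  rcases Nat.even_or_odd' m with ⟨k, rfl | rfl⟩
  · rw [show 2 * k + 2 = 2 * (k + 1) by ring, cat_even, Nat.succ_eq_add_one, sum_even _ (fun j => by simp [cat_odd])]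
    rw [catalan_succ', Finset.Nat.sum_antidiagonal_eq_sum_range_succ (fun i j => catalan i * catalan j)]
    push_cast
    refine Finset.sum_congr rfl fun i _ => ?_
    rw [cat_even, show 2 * k - 2 * i = 2 * (k - i) by omega, cat_even]
  · rw [show 2 * k + 1 + 2 = 2 * (k + 1) + 1 by ring, cat_odd]
    symm
    refine Finset.sum_eq_zero fun i hi => ?_
    rcases Nat.even_or_odd' i with ⟨j, rfl | rfl⟩
    · simp at hi
      rw [show 2 * k + 1 - 2 * j = 2 * (k - j) + 1 by omega, cat_odd, mul_zero]
    · rw [cat_odd, zero_mul]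

lemma cat_rec' (m : ℕ) : ∑ q ∈ antidiagonal m, ((q.2 : ℝ) + 1) * (cat q.1 * cat q.2) = ((m + 2 : ℕ) : ℝ) / 2 * cat (m + 2) := by
  have h1 : ∑ q ∈ antidiagonal m, ((q.2 : ℝ) + 1) * (cat q.1 * cat q.2) = ∑ q ∈ antidiagonal m, ((q.1 : ℝ) + 1) * (cat q.1 * cat q.2) := by
    rw [← Finset.Nat.sum_antidiagonal_swap]
    refine Finset.sum_congr rfl fun q _ => ?_
    simp only [Prod.fst_swap, Prod.snd_swap]; ring
  have h2 : ∑ q ∈ antidiagonal m, ((q.2 : ℝ) + 1) * (cat q.1 * cat q.2) + ∑ q ∈ antidiagonal m, ((q.1 : ℝ) + 1) * (cat q.1 * cat q.2) = ((m + 2 : ℕ) : ℝ) * cat (m + 2) := by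
    rw [cat_rec, ← Finset.sum_add_distrib, Finset.mul_sum]
    refine Finset.sum_congr rfl fun q hq => ?_
    rw [Finset.HasAntidiagonal.mem_antidiagonal] at hq
    rw [← hq]; push_cast; ring
  linarith

/-! the ring of functions of `(n, a, c)` -/

abbrev RR := (ℕ × (ℕ → ℕ) × ℝ) → ℝ

noncomputable def ta (m : ℕ) : RR := fun x => tm x.1 x.2.1 m
def chi : RR := fun x => x.2.2

noncomputable def Lw (d : ℤ) : Submodule ℝ RR :=
  Submodule.span ℝ {f | ∃ (j : ℕ) (l : List ℕ), ((j + l.sum : ℕ) : ℤ) ≤ d ∧ f = chi ^ j * (l.map ta).prod}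

lemma Lw_gen {d : ℤ} (j : ℕ) (l : List ℕ) (h : ((j + l.sum : ℕ) : ℤ) ≤ d) :
    chi ^ j * (l.map ta).prod ∈ Lw d := Submodule.subset_span ⟨j, l, h, rfl⟩

lemma Lw_mono {d e : ℤ} (h : d ≤ e) : Lw d ≤ Lw e := by
  apply Submodule.span_mono
  rintro f ⟨j, l, h1, h2⟩
  exact ⟨j, l, h1.trans h, h2⟩

lemma Lw_mul {d e : ℤ} {f g : RR} (hf : f ∈ Lw d) (hg : g ∈ Lw e) : f * g ∈ Lw (d + e) := by
  have h := Submodule.mul_mem_mul hf hg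
  rw [Lw, Lw, Submodule.span_mul_span] at h
  refine Submodule.span_mono ?_ h
  rintro _ ⟨f, ⟨j, l, h1, rfl⟩, g, ⟨j', l', h1', rfl⟩, rfl⟩
  refine ⟨j + j', l ++ l', ?_, ?_⟩
  · simp only [List.sum_append]; push_cast at *; linarith
  · simp only [List.map_append, List.prod_append]; ring

lemma Lw_list (l : List ℕ) : (l.map ta).prod ∈ Lw l.sum := by
  have := Lw_gen (d := l.sum) 0 l (by simp)
  simpa using this

lemma Lw_ta (m : ℕ) : ta m ∈ Lw m := by
  have := Lw_list [m]
  simpa using this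

lemma Lw_chi (j : ℕ) : chi ^ j ∈ Lw j := by
  have := Lw_gen (d := j) j [] (by simp)
  simpa using this

noncomputable def hR (j : ℕ) : RR := fun x => hh x.2.2 j

lemma hR_lead (j : ℕ) : hR j - ((j : ℝ) + 1) • chi ^ j ∈ Lw ((j : ℤ) - 1) := by
  -- recursion h_{j+2} = 2 c h_{j+1} - (c^2-1) h_j
  have key : ∀ j : ℕ, hR j - ((j : ℝ) + 1) • chi ^ j ∈ Lw ((j : ℤ) - 1) ∧
      hR (j + 1) - (((j + 1 : ℕ) : ℝ) + 1) • chi ^ (j + 1) ∈ Lw (((j + 1 : ℕ) : ℤ) - 1) := by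
    intro j
    induction j with
    | zero =>
      constructor
      · have : hR 0 - (((0 : ℕ) : ℝ) + 1) • chi ^ 0 = 0 := by
          funext x; simp [hR, hh, chi]
        rw [this]; exact Submodule.zero_mem _
      · have : hR (0 + 1) - (((0 + 1 : ℕ) : ℝ) + 1) • chi ^ (0 + 1) = 0 := by
          funext x; simp [hR, hh, chi]; ring
        rw [this]; exact Submodule.zero_mem _
    | succ j ih =>
      refine ⟨ih.2, ?_⟩
      have e : hR (j + 1 + 1) - (((j + 1 + 1 : ℕ) : ℝ) + 1) • chi ^ (j + 1 + 1) =
          (2 : ℝ) • (chi ^ 1 * (hR (j + 1) - (((j + 1 : ℕ) : ℝ) + 1) • chi ^ (j + 1)))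
          - chi ^ 2 * (hR j - ((j : ℝ) + 1) • chi ^ j)
          + ((hR j - ((j : ℝ) + 1) • chi ^ j) + ((j : ℝ) + 1) • chi ^ j) := by
        funext x
        simp [hR, hh, chi]; ring
      rw [e]
      have hw : ∀ d : ℤ, d ≤ ((j + 1 + 1 : ℕ) : ℤ) - 1 → Lw d ≤ Lw (((j + 1 + 1 : ℕ) : ℤ) - 1) := fun d hd => Lw_mono hd
      refine Submodule.add_mem _ (Submodule.sub_mem _ (Submodule.smul_mem _ _ ?_) ?_) (Submodule.add_mem _ ?_ (Submodule.smul_mem _ _ ?_))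
      · exact hw _ (by push_cast; linarith) (Lw_mul (Lw_chi 1) ih.2)
      · exact hw _ (by push_cast; linarith) (Lw_mul (Lw_chi 2) ih.1)
      · exact hw _ (by push_cast; linarith) ih.1
      · exact hw _ (by push_cast; linarith) (Lw_chi j)
  exact (key j).1

noncomputable def de : ℕ → RR
  | 0 => 0
  | 1 => 0
  | (m + 2) => ∑ q ∈ antidiagonal m, ta q.1 * hR q.2

noncomputable def De : ℕ → RR
  | 0 => 0
  | 1 => 0
  | (m + 2) => ∑ q ∈ antidiagonal m, ((q.2 : ℝ) + 1) • (ta q.1 * chi ^ q.2)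

lemma De_mem (m : ℕ) : De m ∈ Lw ((m : ℤ) - 2) := by
  rcases m with _ | _ | m
  · exact Submodule.zero_mem _
  · exact Submodule.zero_mem _
  · rw [De]
    refine Submodule.sum_mem _ fun q hq => Submodule.smul_mem _ _ ?_
    rw [Finset.HasAntidiagonal.mem_antidiagonal] at hq
    refine Lw_mono ?_ (Lw_mul (Lw_ta _) (Lw_chi _))
    rw [← hq]; push_cast; linarith

lemma de_sub (m : ℕ) : de m - De m ∈ Lw ((m : ℤ) - 3) := by
  rcases m with _ | _ | m
  · simp [de, De]
  · simp [de, De]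
  · rw [de, De, ← Finset.sum_sub_distrib]
    refine Submodule.sum_mem _ fun q hq => ?_
    rw [Finset.HasAntidiagonal.mem_antidiagonal] at hq
    have : ta q.1 * hR q.2 - ((q.2 : ℝ) + 1) • (ta q.1 * chi ^ q.2) = ta q.1 * (hR q.2 - ((q.2 : ℝ) + 1) • chi ^ q.2) := by
      rw [mul_sub, mul_smul_comm]
    rw [this]
    refine Lw_mono ?_ (Lw_mul (Lw_ta _) (hR_lead _))
    rw [← hq]; push_cast; linarith

lemma de_mem (m : ℕ) : de m ∈ Lw ((m : ℤ) - 2) := by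
  have := Submodule.add_mem _ (Lw_mono (by linarith) (de_sub m)) (De_mem m)
  simpa using this

noncomputable def PL (l : List ℕ) : RR := (l.map (fun m => ta m + de m)).prod
noncomputable def QL (l : List ℕ) : RR := (l.map ta).prod
noncomputable def lead : List ℕ → RR
  | [] => 0
  | (m :: l) => De m * QL l + ta m * lead l

lemma lead_mem (l : List ℕ) : lead l ∈ Lw ((l.sum : ℤ) - 2) := by
  induction l with
  | nil => exact Submodule.zero_mem _
  | cons m l ih =>
    rw [lead, List.sum_cons]
    refine Submodule.add_mem _ (Lw_mono ?_ (Lw_mul (De_mem m) (Lw_list l))) (Lw_mono ?_ (Lw_mul (Lw_ta m) ih))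
    · push_cast; linarith
    · push_cast; linarith

lemma PL_sub (l : List ℕ) : PL l - QL l - lead l ∈ Lw ((l.sum : ℤ) - 3) := by
  induction l with
  | nil => simp [PL, QL, lead]
  | cons m l ih =>
    have e : PL (m :: l) - QL (m :: l) - lead (m :: l) =
        ta m * (PL l - QL l - lead l) + de m * ((PL l - QL l - lead l) + lead l) + (de m - De m) * QL l := by
      simp only [PL, QL, lead, List.map_cons, List.prod_cons]
      ring
    rw [e, List.sum_cons]
    have h2 : (PL l - QL l - lead l) + lead l ∈ Lw ((l.sum : ℤ) - 2) :=
      Submodule.add_mem _ (Lw_mono (by linarith) ih) (lead_mem l)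
    refine Submodule.add_mem _ (Submodule.add_mem _ (Lw_mono ?_ (Lw_mul (Lw_ta m) ih)) (Lw_mono ?_ (Lw_mul (de_mem m) h2)))
      (Lw_mono ?_ (Lw_mul (de_sub m) (Lw_list l)))
    all_goals push_cast; linarith

/-- averaged functional -/
noncomputable def AA (n : ℕ) (f : RR) : ℝ :=
  EE n (fun a => ∑ s ∈ Finset.range (n + 1), tp n a s * f (n, a, cc a s))

lemma AA_add (n : ℕ) (f g : RR) : AA n (f + g) = AA n f + AA n g := by
  unfold AA
  rw [← EE_add]
  refine EE_congr fun a _ => ?_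
  rw [← Finset.sum_add_distrib]
  exact Finset.sum_congr rfl fun s _ => by simp [mul_add]

lemma AA_smul (n : ℕ) (c : ℝ) (f : RR) : AA n (c • f) = c * AA n f := by
  unfold AA
  rw [← EE_mul]
  refine EE_congr fun a _ => ?_
  rw [Finset.mul_sum]
  exact Finset.sum_congr rfl fun s _ => by simp; ring

lemma AA_zero (n : ℕ) : AA n 0 = 0 := by
  have := AA_smul n 0 0
  simpa using this

lemma AA_sum {ι : Type*} (n : ℕ) (S : Finset ι) (f : ι → RR) : AA n (∑ i ∈ S, f i) = ∑ i ∈ S, AA n (f i) := by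
  classical
  induction S using Finset.induction_on with
  | empty => simp [AA_zero]
  | insert i S hi ih => rw [Finset.sum_insert hi, Finset.sum_insert hi, AA_add, ih]

/-- expectation of a monomial -/
noncomputable def MM (l : List ℕ) (n : ℕ) : ℝ := EE n (fun a => (l.map (tm n a)).prod)

lemma QL_apply (l : List ℕ) (x : ℕ × (ℕ → ℕ) × ℝ) : QL l x = (l.map (tm x.1 x.2.1)).prod := by
  induction l with
  | nil => simp [QL]
  | cons m l ih =>
    simp only [QL, List.map_cons, List.prod_cons, Pi.mul_apply] at ih ⊢
    rw [ih]; rfl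

lemma AA_gen (n j : ℕ) (l : List ℕ) : AA n (chi ^ j * QL l) = MM (j :: l) n := by
  unfold AA MM
  refine EE_congr fun a _ => ?_
  simp only [List.map_cons, List.prod_cons, Pi.mul_apply, Pi.pow_apply, QL_apply, chi, tm, Finset.sum_mul]
  exact Finset.sum_congr rfl fun s _ => by ring

lemma MM_zero_cons (n : ℕ) (l : List ℕ) : MM (0 :: l) n = MM l n := by
  refine EE_congr fun a ha => ?_
  simp [tm_zero ha]

lemma AA_QL (n : ℕ) (l : List ℕ) : AA n (QL l) = MM l n := by
  have := AA_gen n 0 l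
  rw [MM_zero_cons] at this
  simpa using this

lemma MM_succ (n : ℕ) (l : List ℕ) : MM l (n + 1) = AA n (PL l) := by
  unfold MM AA
  rw [EE_succ]
  refine EE_congr fun a ha => Finset.sum_congr rfl fun s _ => ?_
  by_cases hu : Antitone (up a s)
  · congr 1
    induction l with
    | nil => simp [PL]
    | cons m l ih =>
      simp only [PL, List.map_cons, List.prod_cons, Pi.mul_apply] at ih ⊢
      rw [ih]
      congr 1
      rcases m with _ | _ | m
      · simp [ta, de, tm_zero ha, tm_zero (ha.up hu)]
      · simp [ta, de, tm_up_one ha hu]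
      · rw [tm_up_two ha hu]
        simp [ta, de, hR]
  · rw [tp_not hu]; simp

lemma MM_diff (n : ℕ) (l : List ℕ) : MM l (n + 1) - MM l n = AA n (lead l) + AA n (PL l - QL l - lead l) := by
  have : PL l = QL l + lead l + (PL l - QL l - lead l) := by ring
  rw [MM_succ, ← AA_QL n l]
  conv_lhs => rw [this, AA_add, AA_add]
  ring

lemma MM_perm (n : ℕ) {l l' : List ℕ} (h : l.Perm l') : MM l n = MM l' n := by
  unfold MM
  refine EE_congr fun a _ => ?_
  exact (h.map _).prod_eq

end PG

namespace PG
open Finset.HasAntidiagonal (antidiagonal)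

lemma tendsto_rt : Tendsto (fun n : ℕ => Real.sqrt n) atTop atTop :=
  Real.tendsto_sqrt_atTop.comp tendsto_natCast_atTop_atTop

lemma stolz {u v : ℕ → ℝ} (κ : ℝ) (hv : ∀ n, v n < v (n + 1)) (hv0 : v 0 = 0) (hvt : Tendsto v atTop atTop)
    (h : Tendsto (fun n => (u (n + 1) - u n) / (v (n + 1) - v n)) atTop (nhds κ)) :
    Tendsto (fun n => u n / v n) atTop (nhds κ) := by
  have h1 : (fun n => (u (n + 1) - u n) - κ * (v (n + 1) - v n)) =o[atTop] (fun n => v (n + 1) - v n) := by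
    apply Asymptotics.isLittleO_of_tendsto'
    · exact Eventually.of_forall fun n hn => by have := hv n; linarith
    · have := h.sub_const κ
      rw [sub_self] at this
      refine this.congr fun n => ?_
      have : v (n + 1) - v n ≠ 0 := by have := hv n; linarith
      field_simp
  have hs : ∀ n, ∑ i ∈ Finset.range n, (v (i + 1) - v i) = v n := fun n => by
    rw [Finset.sum_range_sub, hv0, sub_zero]
  have h2 := h1.sum_range (fun n => by have := hv n; simp; linarith) (by simpa only [hs] using hvt)
  simp only [hs, Finset.sum_sub_distrib, ← Finset.mul_sum] at h2
  have hs' : ∀ n, ∑ i ∈ Finset.range n, (u (i + 1)) - ∑ i ∈ Finset.range n, u i = u n - u 0 := fun n => by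
    rw [← Finset.sum_sub_distrib, Finset.sum_range_sub]
  have hsv' : ∀ n, ∑ i ∈ Finset.range n, (v (i + 1)) - ∑ i ∈ Finset.range n, v i = v n := fun n => by
    rw [← Finset.sum_sub_distrib, hs]
  simp only [hs', hsv'] at h2
  have h3 := h2.tendsto_div_nhds_zero
  have h4 : Tendsto (fun n => u 0 / v n) atTop (nhds 0) := tendsto_const_nhds.div_atTop hvt
  have h5 := (h3.add h4).add_const κ
  simp only [zero_add] at h5
  refine h5.congr' ?_
  filter_upwards [hvt.eventually_gt_atTop 0] with n hn
  field_simp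
  ring

lemma rt_pow_diff (w : ℕ) : Tendsto (fun n : ℕ => (Real.sqrt ((n + 1 : ℕ) : ℝ) ^ (w + 2) - Real.sqrt n ^ (w + 2)) / Real.sqrt n ^ w)
    atTop (nhds (((w + 2 : ℕ) : ℝ) / 2)) := by
  have hd : HasDerivAt (fun x : ℝ => Real.sqrt x ^ (w + 2)) (((w + 2 : ℕ) : ℝ) / 2) 1 := by
    refine ((Real.hasDerivAt_sqrt (one_ne_zero)).fun_pow (w + 2)).congr_deriv ?_
    simp; ring
  rw [hasDerivAt_iff_tendsto_slope_zero] at hd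
  have ht : Tendsto (fun n : ℕ => (1 : ℝ) / n) atTop (nhdsWithin 0 {0}ᶜ) := by
    rw [tendsto_nhdsWithin_iff]
    refine ⟨tendsto_one_div_atTop_nhds_zero_nat, ?_⟩
    filter_upwards [eventually_gt_atTop 0] with n hn
    simp; omega
  refine (hd.comp ht).congr' ?_
  filter_upwards [eventually_gt_atTop 0] with n hn
  have hn' : (0 : ℝ) < n := by exact_mod_cast hn
  have hs : 0 < Real.sqrt n := Real.sqrt_pos.mpr hn'
  have e1 : Real.sqrt (1 + 1 / (n : ℝ)) = Real.sqrt ((n + 1 : ℕ) : ℝ) / Real.sqrt n := by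
    rw [← Real.sqrt_div (by positivity)]
    congr 1; push_cast; field_simp
  have e2 : (n : ℝ) = Real.sqrt n ^ 2 := (Real.sq_sqrt hn'.le).symm
  simp only [Function.comp, smul_eq_mul, e1, Real.sqrt_one, one_pow, div_pow]
  rw [one_div, inv_inv]
  field_simp
  linear_combination ((Real.sqrt ((n + 1 : ℕ) : ℝ) ^ (w + 2) - Real.sqrt n ^ (w + 2)) * Real.sqrt n ^ w) * e2

lemma rt_stolz {u : ℕ → ℝ} (w : ℕ) (κ : ℝ)
    (h : Tendsto (fun n => (u (n + 1) - u n) / Real.sqrt n ^ w) atTop (nhds (((w + 2 : ℕ) : ℝ) / 2 * κ))) :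
    Tendsto (fun n : ℕ => u n / Real.sqrt n ^ (w + 2)) atTop (nhds κ) := by
  apply stolz κ (v := fun n : ℕ => Real.sqrt n ^ (w + 2))
  · intro n
    apply pow_lt_pow_left₀ _ (Real.sqrt_nonneg _) (by omega)
    apply Real.sqrt_lt_sqrt (by positivity)
    push_cast; linarith
  · simp
  · exact (tendsto_pow_atTop (by omega)).comp tendsto_rt
  · have hne : ((w + 2 : ℕ) : ℝ) / 2 ≠ 0 := by positivity
    have h2 := h.div (rt_pow_diff w) hne
    rw [mul_div_cancel_left₀ _ hne] at h2
    refine h2.congr' ?_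
    filter_upwards [eventually_gt_atTop 0] with n hn
    have hs : 0 < Real.sqrt (n : ℝ) ^ w := pow_pos (Real.sqrt_pos.mpr (by exact_mod_cast hn)) w
    simp only [Pi.div_apply]
    rw [div_div_div_cancel_right₀ hs.ne']

def Good (l : List ℕ) : Prop :=
  Tendsto (fun n : ℕ => MM l n / Real.sqrt n ^ l.sum) atTop (nhds (l.map cat).prod)

lemma Lw_small {W : ℕ} (IH : ∀ l : List ℕ, l.sum < W → Good l) {d : ℤ} {e : ℕ} (hde : d < e) (hd : d < W)
    {f : RR} (hf : f ∈ Lw d) : Tendsto (fun n : ℕ => AA n f / Real.sqrt n ^ e) atTop (nhds 0) := by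
  induction hf using Submodule.span_induction with
  | mem f hf =>
    obtain ⟨j, l, h1, rfl⟩ := hf
    have hg := IH (j :: l) (by rw [List.sum_cons]; have := h1.trans_lt hd; exact_mod_cast this)
    have h2 : j + l.sum < e := by have := h1.trans_lt hde; exact_mod_cast this
    unfold Good at hg
    rw [List.sum_cons] at hg
    have h3 : Tendsto (fun n : ℕ => (Real.sqrt n ^ (e - (j + l.sum)))⁻¹) atTop (nhds 0) :=
      ((tendsto_pow_atTop (by omega)).comp tendsto_rt).inv_tendsto_atTop
    have h4 := hg.mul h3
    rw [mul_zero] at h4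
    refine h4.congr fun n => ?_
    have := AA_gen n j l
    rw [QL] at this
    rw [this, ← div_eq_mul_inv, div_div, ← pow_add]
    congr 2; omega
  | zero => simp [AA_zero]
  | add f g _ _ hf hg =>
    have := hf.add hg
    rw [add_zero] at this
    refine this.congr fun n => ?_
    rw [AA_add]; ring
  | smul c f _ hf =>
    have := hf.const_mul c
    rw [mul_zero] at this
    refine this.congr fun n => ?_
    rw [AA_smul]; ring

lemma lead_lim {W : ℕ} (IH : ∀ l : List ℕ, l.sum < W + 2 → Good l) (l pre : List ℕ) (h : pre.sum + l.sum = W + 2) :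
    Tendsto (fun n : ℕ => AA n (QL pre * lead l) / Real.sqrt n ^ W) atTop
      (nhds ((l.sum : ℝ) / 2 * ((pre.map cat).prod * (l.map cat).prod))) := by
  induction l generalizing pre with
  | nil => simp [lead, AA_zero]
  | cons m l ih =>
    have h2 := ih (m :: pre) (by simp only [List.sum_cons] at h ⊢; omega)
    have h1 : Tendsto (fun n : ℕ => AA n (QL pre * (De m * QL l)) / Real.sqrt n ^ W) atTop
        (nhds ((m : ℝ) / 2 * ((pre.map cat).prod * (cat m * (l.map cat).prod)))) := by
      rcases m with _ | _ | m
      · simp [De, AA_zero]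
      · simp [De, AA_zero, cat_one]
      · have e : ∀ n, AA n (QL pre * (De (m + 2) * QL l)) = ∑ q ∈ antidiagonal m, ((q.2 : ℝ) + 1) * MM (q.2 :: q.1 :: (pre ++ l)) n := by
          intro n
          have : QL pre * (De (m + 2) * QL l) = ∑ q ∈ antidiagonal m, ((q.2 : ℝ) + 1) • (chi ^ q.2 * QL (q.1 :: (pre ++ l))) := by
            rw [De, Finset.sum_mul, Finset.mul_sum]
            refine Finset.sum_congr rfl fun q _ => ?_
            simp only [QL, List.map_cons, List.prod_cons, List.map_append, List.prod_append]
            rw [smul_mul_assoc, mul_smul_comm]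
            congr 1
            ring
          rw [this, AA_sum]
          refine Finset.sum_congr rfl fun q _ => ?_
          rw [AA_smul, AA_gen]
        have e2 : ((m + 2 : ℕ) : ℝ) / 2 * ((pre.map cat).prod * (cat (m + 2) * (l.map cat).prod)) =
            ∑ q ∈ antidiagonal m, ((q.2 : ℝ) + 1) * (cat q.2 * (cat q.1 * ((pre.map cat).prod * (l.map cat).prod))) := by
          have := cat_rec' m
          calc _ = (((m + 2 : ℕ) : ℝ) / 2 * cat (m + 2)) * ((pre.map cat).prod * (l.map cat).prod) := by ring
            _ = _ := by
              rw [← this, Finset.sum_mul]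
              exact Finset.sum_congr rfl fun q _ => by ring
        rw [show m + 1 + 1 = m + 2 by ring, e2]
        simp only [e, Finset.sum_div]
        refine tendsto_finset_sum _ fun q hq => ?_
        rw [Finset.HasAntidiagonal.mem_antidiagonal] at hq
        have hsum : (q.2 :: q.1 :: (pre ++ l)).sum = W := by
          simp only [List.sum_cons, List.sum_append] at h ⊢; omega
        have hg := IH (q.2 :: q.1 :: (pre ++ l)) (by omega)
        unfold Good at hg
        rw [hsum] at hg
        have := hg.const_mul ((q.2 : ℝ) + 1)
        simp only [List.map_cons, List.prod_cons, List.map_append, List.prod_append] at this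
        refine this.congr fun n => ?_
        ring
    have h3 := h1.add h2
    convert h3 using 2
    · rw [lead, ← add_div, ← AA_add]
      congr 2
      simp only [QL, List.map_cons, List.prod_cons]
      ring
    · simp only [List.sum_cons, List.map_cons, List.prod_cons]
      push_cast; ring

lemma good (l : List ℕ) : Good l := by
  suffices ∀ W, ∀ l : List ℕ, l.sum = W → Good l from this _ l rfl
  intro W
  induction W using Nat.strong_induction_on with
  | _ W IH =>
    intro l hl
    by_cases h1 : 1 ∈ l
    · have e1 : ∀ n, MM l n = 0 := by
        intro n
        rw [← EE_const n 0]
        refine EE_congr fun a ha => ?_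
        apply List.prod_eq_zero
        rw [List.mem_map]
        exact ⟨1, h1, tm_one ha⟩
      have e2 : (l.map cat).prod = 0 := by
        apply List.prod_eq_zero
        rw [List.mem_map]
        exact ⟨1, h1, cat_one⟩
      simp [Good, e1, e2]
    · rcases W with _ | _ | W
      · have h0 : ∀ m ∈ l, m = 0 := by
          intro m hm
          have := List.single_le_sum (l := l) (by simp) m hm
          omega
        have e1 : ∀ n, MM l n = 1 := by
          intro n
          rw [← EE_one n]
          refine EE_congr fun a ha => ?_
          apply List.prod_eq_one
          intro x hx
          rw [List.mem_map] at hx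
          obtain ⟨m, hm, rfl⟩ := hx
          rw [h0 m hm, tm_zero ha]
        have e2 : (l.map cat).prod = 1 := by
          apply List.prod_eq_one
          intro x hx
          rw [List.mem_map] at hx
          obtain ⟨m, hm, rfl⟩ := hx
          rw [h0 m hm, cat_zero]
        simp [Good, e1, e2, hl]
      · exfalso
        have h0 : ∀ m ∈ l, m = 0 := by
          intro m hm
          have := List.single_le_sum (l := l) (by simp) m hm
          have : m ≠ 1 := fun h => h1 (h ▸ hm)
          omega
        have := List.sum_eq_zero h0
        omega
      · have IH' : ∀ l : List ℕ, l.sum < W + 2 → Good l := fun l' h => IH _ h l' rfl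
        unfold Good
        rw [hl]
        apply rt_stolz
        have t1 := lead_lim IH' l [] (by simpa using hl)
        have t2 := Lw_small IH' (d := (l.sum : ℤ) - 3) (e := W) (by rw [hl]; push_cast; linarith) (by rw [hl]; push_cast; linarith) (PL_sub l)
        have t3 := t1.add t2
        convert t3 using 2
        · rw [MM_diff, ← add_div]; simp [QL]
        · rw [hl]; simp; left; ring

end PG

namespace PG

noncomputable def er (r n : ℕ) : ℝ := EE n (fun a => tp n a r)

lemma er_nonneg (r n : ℕ) : 0 ≤ er r n := EE_nonneg fun _ _ => tp_nonneg _ _ _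

lemma tp_sq (r n : ℕ) : EE n (fun a => tp n a r ^ 2) ≤ 1 / (n + 1) := by
  classical
  have h1 : EE n (fun a => tp n a r ^ 2) = ∑ a ∈ PP n, if Antitone (up a r) then
      (fun _ b => dm (n + 1) b ^ 2 / (n + 1).factorial * (1 / (n + 1))) a (up a r) else 0 := by
    refine Finset.sum_congr rfl fun a ha => ?_
    have hp := dm_pos (by simpa using ha : IsP n a)
    beta_reduce
    split_ifs with hu
    · rw [tp_of hu, Nat.factorial_succ]; push_cast; field_simp
    · rw [tp_not hu]; simp
  rw [h1, sum_updn n r (fun _ b => dm (n + 1) b ^ 2 / (n + 1).factorial * (1 / (n + 1)))]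
  have h2 := EE_const (n + 1) (1 / ((n : ℝ) + 1))
  refine le_trans ?_ h2.le
  unfold EE
  refine Finset.sum_le_sum fun b _ => ?_
  beta_reduce
  split_ifs
  · exact le_refl _
  · positivity

lemma er_le (r n : ℕ) : er r n ≤ 1 / Real.sqrt (n + 1) := by
  have h1 := EE_cs n (fun a => tp n a r) (fun _ => 1)
  simp only [mul_one, one_pow] at h1
  rw [EE_one, mul_one] at h1
  have h2 := h1.trans (tp_sq r n)
  have h3 : (1 / Real.sqrt ((n : ℝ) + 1)) ^ 2 = 1 / (n + 1) := by
    rw [div_pow, one_pow, Real.sq_sqrt (by positivity)]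
  rw [← h3] at h2
  exact (pow_le_pow_iff_left₀ (er_nonneg r n) (by positivity) (by norm_num)).mp h2

lemma E_row (r n : ℕ) : EE n (fun a => (a r : ℝ)) = ∑ j ∈ Finset.range n, er r j := by
  induction n with
  | zero => rw [EE_zero]; simp
  | succ n ih =>
    rw [Finset.sum_range_succ, ← ih, EE_succ, er, ← EE_add]
    refine EE_congr fun a ha => ?_
    have h1 : ∀ s, tp n a s * ((up a s r : ℕ) : ℝ) = tp n a s * a r + tp n a s * (if r = s then 1 else 0) := by
      intro s
      simp only [up]
      push_cast
      ring
    simp only [h1, Finset.sum_add_distrib, ← Finset.sum_mul, sum_tp ha, one_mul]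
    congr 1
    simp only [mul_ite, mul_one, mul_zero, Finset.sum_ite_eq, Finset.mem_range]
    split_ifs with h
    · rfl
    · rw [tp_zero ha (by omega)]

noncomputable def Bs (n s : ℕ) : ℝ := open Classical in
  ∑ a ∈ PP n, if Antitone (up a s) then dm n a * dm (n + 1) (up a s) else 0

lemma er_eq (s n : ℕ) : er s n = Bs n s / (n + 1).factorial := by
  classical
  unfold er Bs EE
  rw [Finset.sum_div]
  refine Finset.sum_congr rfl fun a ha => ?_
  have hp := dm_pos (by simpa using ha : IsP n a)
  beta_reduce
  split_ifs with hu
  · rw [tp_of hu, Nat.factorial_succ]; push_cast; field_simp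
  · rw [tp_not hu]; simp

lemma dm_I1 {n : ℕ} {a : ℕ → ℕ} (h : IsP n a) : open Classical in
    ((n : ℝ) + 1) * dm n a = ∑ y ∈ Finset.range (n + 1), if Antitone (up a y) then dm (n + 1) (up a y) else 0 := by
  classical
  have h1 := sum_tp h
  have hp := dm_pos h
  have h2 : ∀ s, tp n a s = (if Antitone (up a s) then dm (n + 1) (up a s) else 0) / ((n + 1) * dm n a) := by
    intro s
    split_ifs with hu
    · exact tp_of hu
    · rw [tp_not hu]; simp
  simp only [h2, ← Finset.sum_div] at h1
  rw [div_eq_one_iff_eq (by positivity)] at h1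
  exact h1.symm

lemma cover {a : ℕ → ℕ} (ha : Antitone a) {s y : ℕ} (hsy : y ≠ s) (hr : a (y + 1) < a y)
    (hA : Antitone (up (dn a y) s)) : Antitone (up a s) ∧ up a s (y + 1) < up a s y ∧ up (dn a y) s = dn (up a s) y := by
  have e : up (dn a y) s = dn (up a s) y := by
    funext i
    simp only [up, dn]
    by_cases h1 : i = s
    · have : i ≠ y := fun h => hsy (h.symm.trans h1)
      simp [h1, this, Ne.symm hsy]
    · simp [h1]
  have hA' : Antitone (up a s) := by
    have : up a s = fun i => max (a i) (up (dn a y) s i) := by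
      funext i
      simp only [up, dn]
      by_cases h1 : i = s
      · have : i ≠ y := fun h => hsy (h.symm.trans h1)
        simp [h1, Ne.symm hsy]
      · simp [h1]
    rw [this]
    exact fun i j hij => max_le_max (ha hij) (hA hij)
  refine ⟨hA', ?_, e⟩
  have h3 := hA (Nat.le_succ y)
  rw [e, Nat.succ_eq_add_one, dn_ne _ (by omega), dn_self] at h3
  have : 1 ≤ up a s y := by simp only [up]; omega
  omega

lemma Bs_point {n : ℕ} {a : ℕ → ℕ} (h : IsP (n + 1) a) (s : ℕ) : open Classical in
    (∑ y ∈ Finset.range (n + 1), if a (y + 1) < a y then (if Antitone (up (dn a y) s) then dm (n + 1) (up (dn a y) s) else 0) else 0)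
      ≤ (if Antitone (up a s) then dm (n + 2) (up a s) else 0) +
        ((if a (s + 1) < a s then dm (n + 1) a else 0) - (if Antitone (up a s) then dm (n + 1) a else 0)) := by
  classical
  set b : ℕ → ℝ := fun y => if Antitone (up a s) then (if up a s (y + 1) < up a s y then dm (n + 1) (dn (up a s) y) else 0) else 0 with hb
  set R : ℝ := if a (s + 1) < a s then dm (n + 1) a else 0
  have hbs : b s = if Antitone (up a s) then dm (n + 1) a else 0 := by
    simp only [hb]
    rw [if_pos (removable_of_antitone_up h.1 s), dn_up]
  have hbn : ∀ y, 0 ≤ b y := by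
    intro y
    simp only [hb]
    split_ifs
    · exact dm_nonneg _ _
    · exact le_rfl
    · exact le_rfl
  have hbig : (if Antitone (up a s) then dm (n + 2) (up a s) else 0) = ∑ y ∈ Finset.range (n + 2), b y := by
    simp only [hb]
    split_ifs with hu
    · rw [dm]
    · simp
  have hR : 0 ≤ R := by
    simp only [R]; split_ifs
    · exact dm_nonneg _ _
    · exact le_rfl
  have h1 : ∀ y, (if a (y + 1) < a y then (if Antitone (up (dn a y) s) then dm (n + 1) (up (dn a y) s) else 0) else 0)
      ≤ b y + if y = s then R - b s else 0 := by
    intro y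
    by_cases hys : y = s
    · subst hys
      simp only [if_true]
      rw [show b y + (R - b y) = R by ring]
      simp only [R]
      split_ifs with h1 h2
      · rw [up_dn a (by omega)]
      · exact dm_nonneg _ _
      · exact le_rfl
    · simp only [hys, if_false, add_zero]
      split_ifs with h1 h2
      · obtain ⟨c1, c2, c3⟩ := cover h.1 hys h1 h2
        simp only [hb]
        rw [if_pos c1, if_pos c2, c3]
      · exact hbn y
      · exact hbn y
  have h2 : ∀ y, 0 ≤ b y + if y = s then R - b s else 0 := by
    intro y
    split_ifs with hy
    · rw [hy]; linarith
    · simpa using hbn y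
  have h3 := Finset.sum_le_sum fun y (_ : y ∈ Finset.range (n + 1)) => h1 y
  refine h3.trans ?_
  have h4 : ∑ i ∈ Finset.range (n + 1), (b i + if i = s then R - b s else 0) ≤ ∑ i ∈ Finset.range (n + 2), (b i + if i = s then R - b s else 0) := by
    rw [Finset.sum_range_succ _ (n + 1)]
    have := h2 (n + 1)
    linarith
  refine h4.trans ?_
  rw [Finset.sum_add_distrib, ← hbig, ← hbs]
  simp only [Finset.sum_ite_eq', Finset.mem_range]
  by_cases h5 : s < n + 2
  · rw [if_pos h5]
  · have h6 : R = 0 := by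
      simp only [R]
      rw [h.zero_of_le (i := s) (by omega)]; simp
    have h7 : b s = 0 := by
      rw [hbs, if_neg]
      intro hu
      have := h.le_of_up hu
      omega
    rw [if_neg h5, h6, h7]; simp

lemma Bs_ineq (n r : ℕ) : ((n : ℝ) + 1) * ∑ s ∈ Finset.range (r + 1), Bs n s ≤ ∑ s ∈ Finset.range (r + 1), Bs (n + 1) s := by
  classical
  have h1 : ∀ s, ((n : ℝ) + 1) * Bs n s = ∑ a ∈ PP (n + 1), dm (n + 1) a *
      ∑ y ∈ Finset.range (n + 1), if a (y + 1) < a y then (if Antitone (up (dn a y) s) then dm (n + 1) (up (dn a y) s) else 0) else 0 := by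
    intro s
    simp only [Finset.mul_sum]
    rw [Finset.sum_comm]
    have e : ∀ y, (∑ a ∈ PP (n + 1), dm (n + 1) a * if a (y + 1) < a y then (if Antitone (up (dn a y) s) then dm (n + 1) (up (dn a y) s) else 0) else 0)
        = ∑ a ∈ PP n, if Antitone (up a y) then (fun μ l => dm (n + 1) l * (if Antitone (up μ s) then dm (n + 1) (up μ s) else 0)) a (up a y) else 0 := by
      intro y
      rw [sum_updn n y (fun μ l => dm (n + 1) l * (if Antitone (up μ s) then dm (n + 1) (up μ s) else 0))]
      refine Finset.sum_congr rfl fun a _ => ?_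
      rw [mul_ite, mul_zero]
    simp only [e]
    rw [Finset.sum_comm, Bs, Finset.mul_sum]
    refine Finset.sum_congr rfl fun a ha => ?_
    split_ifs with hu
    · rw [← mul_assoc, dm_I1 (by simpa using ha), Finset.sum_mul]
      refine Finset.sum_congr rfl fun y _ => ?_
      split_ifs <;> simp
    · simp
  rw [Finset.mul_sum]
  simp only [h1]
  rw [Finset.sum_comm]
  simp only [Bs]
  rw [Finset.sum_comm (s := Finset.range (r + 1))]
  refine Finset.sum_le_sum fun a ha => ?_
  have ha' : IsP (n + 1) a := by simpa using ha
  have hp := dm_pos ha'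
  simp only [← mul_ite_zero]
  rw [← Finset.mul_sum, ← Finset.mul_sum]
  apply mul_le_mul_of_nonneg_left _ hp.le
  have h2 := Finset.sum_le_sum fun s (_ : s ∈ Finset.range (r + 1)) => Bs_point ha' s
  refine h2.trans ?_
  rw [Finset.sum_add_distrib]
  have h3 : ∑ s ∈ Finset.range (r + 1), ((if a (s + 1) < a s then dm (n + 1) a else 0) - (if Antitone (up a s) then dm (n + 1) a else 0))
      = (if a (r + 1) < a r then dm (n + 1) a else 0) - dm (n + 1) a := by
    clear h2
    induction r with
    | zero => simp [antitone_up ha'.1]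
    | succ r ih =>
      rw [Finset.sum_range_succ, ih]
      have : Antitone (up a (r + 1)) ↔ a (r + 1) < a r := by
        rw [antitone_up ha'.1]; simp
      simp only [this]
      ring
  rw [h3]
  have : (if a (r + 1) < a r then dm (n + 1) a else 0) ≤ dm (n + 1) a := by
    split_ifs
    · exact le_rfl
    · exact hp.le
  linarith

noncomputable def SS (r n : ℕ) : ℝ := ((n : ℝ) + 1) * ∑ s ∈ Finset.range (r + 1), er s n

lemma SS_mono (r : ℕ) : Monotone (SS r) := by
  apply monotone_nat_of_le_succ
  intro n
  have h := Bs_ineq n r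
  have e : ∀ n, SS r n = (∑ s ∈ Finset.range (r + 1), Bs n s) / n.factorial := by
    intro n
    unfold SS
    simp only [er_eq, ← Finset.sum_div]
    rw [Nat.factorial_succ]; push_cast; field_simp
  rw [e, e, Nat.factorial_succ, div_le_div_iff₀ (by positivity) (by positivity)]
  push_cast
  have : (0:ℝ) < n.factorial := by positivity
  nlinarith

end PG

namespace PG

noncomputable def Lp (p : Polynomial ℝ) : ℝ := p.sum fun i c => c * cat i

lemma Lp_add (p q : Polynomial ℝ) : Lp (p + q) = Lp p + Lp q := by
  unfold Lp
  rw [Polynomial.sum_add_index]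
  · intro i; simp
  · intro i b c; ring

lemma Lp_monomial (n : ℕ) (c : ℝ) : Lp (Polynomial.monomial n c) = c * cat n := by
  unfold Lp
  rw [Polynomial.sum_monomial_index]; simp

noncomputable def Gam (n : ℕ) (a : ℕ → ℕ) (p : Polynomial ℝ) : ℝ :=
  ∑ s ∈ Finset.range (n + 1), tp n a s * p.eval (cc a s / Real.sqrt n)

lemma Gam_eq (n : ℕ) (a : ℕ → ℕ) (p : Polynomial ℝ) :
    Gam n a p = ∑ i ∈ p.support, p.coeff i * (tm n a i / Real.sqrt n ^ i) := by
  unfold Gam tm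
  simp only [Polynomial.eval_eq_sum, Polynomial.sum, Finset.mul_sum, Finset.sum_div]
  rw [Finset.sum_comm]
  refine Finset.sum_congr rfl fun i _ => Finset.sum_congr rfl fun s _ => ?_
  rw [div_pow]; ring

lemma E_Gam (p : Polynomial ℝ) : Tendsto (fun n => EE n (fun a => Gam n a p)) atTop (nhds (Lp p)) := by
  have h : ∀ n, EE n (fun a => Gam n a p) = ∑ i ∈ p.support, p.coeff i * (MM [i] n / Real.sqrt n ^ i) := by
    intro n
    simp only [Gam_eq]
    rw [EE_sum]
    refine Finset.sum_congr rfl fun i _ => ?_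
    rw [EE_mul]
    simp only [div_eq_inv_mul]
    rw [EE_mul]
    simp [MM]
  simp only [h]
  unfold Lp Polynomial.sum
  refine tendsto_finsetSum _ fun i _ => ?_
  have := good [i]
  unfold Good at this
  simp only [List.sum_cons, List.sum_nil, add_zero, List.map_cons, List.map_nil, List.prod_cons, List.prod_nil, mul_one] at this
  exact this.const_mul _

lemma E_Gam2 (p : Polynomial ℝ) : Tendsto (fun n => EE n (fun a => Gam n a p ^ 2)) atTop (nhds (Lp p ^ 2)) := by
  have h : ∀ n, EE n (fun a => Gam n a p ^ 2) = ∑ i ∈ p.support, ∑ j ∈ p.support, p.coeff i * p.coeff j * (MM [i, j] n / Real.sqrt n ^ (i + j)) := by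
    intro n
    simp only [Gam_eq, sq, Finset.sum_mul_sum]
    rw [EE_sum]
    refine Finset.sum_congr rfl fun i _ => ?_
    rw [EE_sum]
    refine Finset.sum_congr rfl fun j _ => ?_
    rw [MM, div_eq_inv_mul, ← EE_mul, ← EE_mul]
    refine EE_congr fun a _ => ?_
    simp only [List.map_cons, List.map_nil, List.prod_cons, List.prod_nil, mul_one]
    rw [pow_add, mul_inv]; ring
  simp only [h]
  have e : Lp p ^ 2 = ∑ i ∈ p.support, ∑ j ∈ p.support, p.coeff i * p.coeff j * (cat i * cat j) := by
    unfold Lp Polynomial.sum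
    rw [sq, Finset.sum_mul_sum]
    refine Finset.sum_congr rfl fun i _ => Finset.sum_congr rfl fun j _ => ?_
    ring
  rw [e]
  refine tendsto_finsetSum _ fun i _ => tendsto_finsetSum _ fun j _ => ?_
  have := good [i, j]
  unfold Good at this
  simp only [List.sum_cons, List.sum_nil, add_zero, List.map_cons, List.map_nil, List.prod_cons, List.prod_nil, mul_one] at this
  exact this.const_mul _

lemma E_Gamv (p : Polynomial ℝ) : Tendsto (fun n => EE n (fun a => (Gam n a p - Lp p) ^ 2)) atTop (nhds 0) := by
  have h : ∀ n, EE n (fun a => (Gam n a p - Lp p) ^ 2) = EE n (fun a => Gam n a p ^ 2) - 2 * Lp p * EE n (fun a => Gam n a p) + Lp p ^ 2 := by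
    intro n
    rw [← EE_mul, ← EE_sub]
    conv_rhs => rw [← EE_const n (Lp p ^ 2), ← EE_add]
    refine EE_congr fun a _ => ?_
    ring
  simp only [h]
  have := ((E_Gam2 p).sub ((E_Gam p).const_mul (2 * Lp p))).add_const (Lp p ^ 2)
  convert this using 2
  ring

lemma er_tendsto (r : ℕ) : Tendsto (er r) atTop (nhds 0) := by
  refine squeeze_zero (er_nonneg r) (er_le r) ?_
  have := tendsto_rt.comp (tendsto_add_atTop_nat 1)
  refine (this.inv_tendsto_atTop).congr fun n => ?_
  simp

noncomputable def gp (y : ℝ) (k : ℕ) : Polynomial ℝ :=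
  Polynomial.monomial (2 * (k + 1) + 1) 1 + Polynomial.monomial (2 * (k + 1)) (4 - y)
    + Polynomial.monomial (2 * k + 1) (4 - 4 * y) + Polynomial.monomial (2 * k) (-4 * y)

lemma gp_eval (y : ℝ) (k : ℕ) (x : ℝ) : (gp y k).eval x = (x - y) * ((x ^ k) ^ 2 * (x + 2) ^ 2) := by
  simp only [gp, Polynomial.eval_add, Polynomial.eval_monomial]
  ring

lemma gp_Lp (y : ℝ) (k : ℕ) : Lp (gp y k) = (4 - y) * catalan (k + 1) - 4 * y * catalan k := by
  simp only [gp, Lp_add, Lp_monomial, cat_even, cat_odd]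
  ring

lemma gp_pos {y : ℝ} (hy : y < 2) : ∃ k, 0 < Lp (gp y k) := by
  have hc : ∀ k : ℕ, ((k : ℝ) + 2) * catalan (k + 1) = 2 * (2 * k + 1) * catalan k := by
    intro k
    have h1 := succ_mul_catalan_eq_centralBinom k
    have h2 := succ_mul_catalan_eq_centralBinom (k + 1)
    have h3 := Nat.succ_mul_centralBinom_succ k
    rw [← h1, ← h2] at h3
    have h4 : ((k : ℝ) + 1) * (((k : ℝ) + 2) * catalan (k + 1)) = ((k : ℝ) + 1) * (2 * (2 * k + 1) * catalan k) := by
      have := congrArg (fun x : ℕ => (x : ℝ)) h3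
      push_cast at this
      linarith
    exact mul_left_cancel₀ (by positivity) h4
  obtain ⟨k, hk⟩ := exists_nat_gt ((6 + 3 * |y|) / (2 - y))
  refine ⟨k, ?_⟩
  rw [gp_Lp]
  have hpos : (0:ℝ) < catalan k := by
    have := succ_mul_catalan_eq_centralBinom k
    have h2 := Nat.centralBinom_pos k
    rw [← this] at h2
    exact_mod_cast pos_of_mul_pos_right h2 (by omega)
  have h2y : 0 < 2 - y := by linarith
  rw [div_lt_iff₀ h2y] at hk
  have hk0 : (0:ℝ) < (k : ℝ) + 2 := by positivity
  have key : ((k : ℝ) + 2) * ((4 - y) * catalan (k + 1) - 4 * y * catalan k)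
      = catalan k * ((4 - y) * (2 * (2 * k + 1)) - 4 * y * (k + 2)) := by
    have := hc k
    linear_combination (4 - y) * this
  have : 0 < ((k : ℝ) + 2) * ((4 - y) * catalan (k + 1) - 4 * y * catalan k) := by
    rw [key]
    apply mul_pos hpos
    have := neg_abs_le y
    have := le_abs_self y
    nlinarith
  exact pos_of_mul_pos_right this hk0.le

noncomputable def low (r : ℕ) (y : ℝ) (n : ℕ) : ℝ := open Classical in
  EE n (fun a => if cc a r ≤ y * Real.sqrt n then 1 else 0)

lemma low_nonneg (r : ℕ) (y : ℝ) (n : ℕ) : 0 ≤ low r y n :=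
  EE_nonneg fun a _ => by split_ifs <;> norm_num

lemma low_bound (r : ℕ) (y : ℝ) (k : ℕ) {δ : ℝ} (hδ : 0 < δ) (n : ℕ) (hn : 1 ≤ n) (hrn : r ≤ n + 1) :
    Lp (gp y k) * low r y n ≤ δ * (EE n (fun a => Gam n a (gp y k * gp y k)) + 1)
      + 1 / δ * (∑ s ∈ Finset.range r, er s n + EE n (fun a => (Gam n a (gp y k) - Lp (gp y k)) ^ 2)) := by
  classical
  have hrt : 0 < Real.sqrt n := Real.sqrt_pos.mpr (by exact_mod_cast hn)
  have e1 : δ * (EE n (fun a => Gam n a (gp y k * gp y k)) + 1)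
      + 1 / δ * (∑ s ∈ Finset.range r, er s n + EE n (fun a => (Gam n a (gp y k) - Lp (gp y k)) ^ 2))
      = EE n (fun a => δ * (Gam n a (gp y k * gp y k) + 1) + 1 / δ * (∑ s ∈ Finset.range r, tp n a s + (Gam n a (gp y k) - Lp (gp y k)) ^ 2)) := by
    rw [EE_add, EE_mul, EE_mul, EE_add, EE_add, EE_one, EE_sum]
    rfl
  rw [e1, low, ← EE_mul]
  refine EE_mono fun a ha => ?_
  set γ := Lp (gp y k)
  set g : ℕ → ℝ := fun s => (gp y k).eval (cc a s / Real.sqrt n) with hg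
  have am : ∀ x : ℝ, x ≤ δ * x ^ 2 + 1 / δ := by
    intro x
    have : 0 ≤ (δ * x - 1) ^ 2 / δ + x := by
      rw [div_add' _ _ _ hδ.ne']
      apply div_nonneg _ hδ.le
      nlinarith [sq_nonneg (δ * x - 1), sq_nonneg (2 * (δ * x) - 1)]
    have h2 : δ * x ^ 2 + 1 / δ - x = (δ * x - 1) ^ 2 / δ + x := by
      field_simp; ring
    linarith
  have hG : Gam n a (gp y k * gp y k) = ∑ s ∈ Finset.range (n + 1), tp n a s * g s ^ 2 := by
    unfold Gam
    refine Finset.sum_congr rfl fun s _ => ?_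
    rw [Polynomial.eval_mul]; simp only [hg]; ring
  have hG0 : 0 ≤ Gam n a (gp y k * gp y k) := by
    rw [hG]; exact Finset.sum_nonneg fun s _ => mul_nonneg (tp_nonneg _ _ _) (sq_nonneg _)
  have hS0 : 0 ≤ ∑ s ∈ Finset.range r, tp n a s := Finset.sum_nonneg fun s _ => tp_nonneg _ _ _
  split_ifs with hE
  · have h1 : Gam n a (gp y k) ≤ ∑ s ∈ Finset.range r, tp n a s * g s := by
      unfold Gam
      rw [← Finset.sum_range_add_sum_Ico _ hrn]
      have : ∑ s ∈ Finset.Ico r (n + 1), tp n a s * g s ≤ 0 := by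
        refine Finset.sum_nonpos fun s hs => ?_
        apply mul_nonpos_of_nonneg_of_nonpos (tp_nonneg _ _ _)
        simp only [hg]
        rw [gp_eval]
        apply mul_nonpos_of_nonpos_of_nonneg _ (by positivity)
        have h3 := (cc_strictAnti ha.1).antitone (Finset.mem_Ico.mp hs).1
        have h4 : cc a s / Real.sqrt n ≤ y := by
          rw [div_le_iff₀ hrt]; linarith
        linarith
      simp only [hg] at this ⊢
      linarith
    have h2 : ∑ s ∈ Finset.range r, tp n a s * g s ≤ δ * Gam n a (gp y k * gp y k) + 1 / δ * ∑ s ∈ Finset.range r, tp n a s := by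
      have h3 : ∑ s ∈ Finset.range r, tp n a s * g s ≤ ∑ s ∈ Finset.range r, (δ * (tp n a s * g s ^ 2) + 1 / δ * tp n a s) := by
        refine Finset.sum_le_sum fun s _ => ?_
        have := mul_le_mul_of_nonneg_left (am (g s)) (tp_nonneg n a s)
        linarith
      rw [Finset.sum_add_distrib, ← Finset.mul_sum, ← Finset.mul_sum] at h3
      have h4 : ∑ s ∈ Finset.range r, tp n a s * g s ^ 2 ≤ Gam n a (gp y k * gp y k) := by
        rw [hG]
        refine Finset.sum_le_sum_of_subset_of_nonneg (by simpa using hrn) fun s _ _ => mul_nonneg (tp_nonneg _ _ _) (sq_nonneg _)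
      have := mul_le_mul_of_nonneg_left h4 hδ.le
      linarith
    have h5 : γ - Gam n a (gp y k) ≤ δ + 1 / δ * (Gam n a (gp y k) - γ) ^ 2 := by
      have h6 : 0 ≤ (δ - (γ - Gam n a (gp y k))) ^ 2 / δ + (γ - Gam n a (gp y k)) := by
        rw [div_add' _ _ _ hδ.ne']
        apply div_nonneg _ hδ.le
        nlinarith [sq_nonneg (δ - (γ - Gam n a (gp y k))), sq_nonneg (δ - 2 * (γ - Gam n a (gp y k))), sq_nonneg (δ + (γ - Gam n a (gp y k))) ]
      have h7 : δ + 1 / δ * (Gam n a (gp y k) - γ) ^ 2 - (γ - Gam n a (gp y k)) = (δ - (γ - Gam n a (gp y k))) ^ 2 / δ + (γ - Gam n a (gp y k)) := by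
        field_simp; ring
      linarith
    linarith
  · simp only [mul_zero]
    positivity

lemma low_tendsto (r : ℕ) {y : ℝ} (hy : y < 2) : Tendsto (low r y) atTop (nhds 0) := by
  obtain ⟨k, hk⟩ := gp_pos hy
  set γ := Lp (gp y k)
  set K := Lp (gp y k * gp y k) with hK
  rw [Metric.tendsto_atTop]
  intro ε hε
  set δ : ℝ := ε * γ / 4 / (|K| + 2) with hδ
  have hK2 : 0 < |K| + 2 := by positivity
  have hδ0 : 0 < δ := by positivity
  have h1 : ∀ᶠ n in atTop, EE n (fun a => Gam n a (gp y k * gp y k)) < |K| + 1 :=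
    (E_Gam (gp y k * gp y k)).eventually (gt_mem_nhds (by have := le_abs_self K; linarith))
  have h2 : Tendsto (fun n => ∑ s ∈ Finset.range r, er s n + EE n (fun a => (Gam n a (gp y k) - γ) ^ 2)) atTop (nhds 0) := by
    have := (tendsto_finsetSum (Finset.range r) fun s _ => er_tendsto s).add (E_Gamv (gp y k))
    simpa using this
  have h3 := h2.eventually (gt_mem_nhds (show 0 < δ * (ε * γ / 4) by positivity))
  have h4 := (h1.and (h3.and ((eventually_ge_atTop 1).and (eventually_ge_atTop r))))
  obtain ⟨N, hN⟩ := eventually_atTop.mp h4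
  refine ⟨N, fun n hn => ?_⟩
  obtain ⟨a1, a2, a3, a4⟩ := hN n hn
  rw [Real.dist_eq, sub_zero, abs_of_nonneg (low_nonneg _ _ _)]
  have hb := low_bound r y k hδ0 n a3 (by omega)
  have b1 : δ * (EE n (fun a => Gam n a (gp y k * gp y k)) + 1) ≤ ε * γ / 4 := by
    have : δ * (|K| + 2) = ε * γ / 4 := by rw [hδ]; field_simp
    rw [← this]
    apply mul_le_mul_of_nonneg_left _ hδ0.le
    linarith
  have b2 : 1 / δ * (∑ s ∈ Finset.range r, er s n + EE n (fun a => (Gam n a (gp y k) - γ) ^ 2)) ≤ ε * γ / 4 := by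
    rw [one_div, inv_mul_le_iff₀ hδ0]
    exact a2.le
  have b3 : γ * low r y n ≤ γ * (ε / 2) := by
    refine hb.trans ?_
    linarith
  have := le_of_mul_le_mul_left b3 hk
  linarith

lemma E_row_le (r n : ℕ) : EE n (fun a => (a r : ℝ)) ≤ 2 * Real.sqrt n := by
  rw [E_row]
  induction n with
  | zero => simp
  | succ n ih =>
    rw [Finset.sum_range_succ]
    have h1 := er_le r n
    have h2 : 1 / Real.sqrt ((n : ℝ) + 1) ≤ 2 * (Real.sqrt ((n : ℝ) + 1) - Real.sqrt n) := by
      have p1 : 0 < Real.sqrt ((n : ℝ) + 1) := Real.sqrt_pos.mpr (by positivity)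
      rw [div_le_iff₀ p1]
      have q1 := Real.sq_sqrt (show (0:ℝ) ≤ (n : ℝ) + 1 by positivity)
      have q2 := Real.sq_sqrt (show (0:ℝ) ≤ (n : ℝ) by positivity)
      nlinarith [sq_nonneg (Real.sqrt ((n : ℝ) + 1) - Real.sqrt n)]
    push_cast
    linarith

lemma E_row_ge (r : ℕ) {y : ℝ} (hy0 : 0 ≤ y) (hy : y < 2) : ∀ᶠ n : ℕ in atTop, y * Real.sqrt n ≤ EE n (fun a => (a r : ℝ)) := by
  classical
  have hz : ∃ z, y < z ∧ z < 2 := ⟨(y + 2) / 2, by linarith, by linarith⟩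
  obtain ⟨z, hyz, hz2⟩ := hz
  have h := (low_tendsto r hz2).eventually (gt_mem_nhds (show 0 < (z - y) / z by apply div_pos <;> linarith))
  filter_upwards [h] with n hn
  have h1 : z * Real.sqrt n * (1 - low r z n) ≤ EE n (fun a => (a r : ℝ)) := by
    have e1 : z * Real.sqrt n * (1 - low r z n) = EE n (fun a => z * Real.sqrt n * (1 - if cc a r ≤ z * Real.sqrt n then 1 else 0)) := by
      rw [EE_mul, EE_sub, EE_one, low]
    rw [e1]
    refine EE_mono fun a _ => ?_
    have hs := Real.sqrt_nonneg n
    split_ifs with hc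
    · simp
    · push Not at hc
      unfold cc at hc
      have : (0:ℝ) ≤ r := by positivity
      linarith
  rw [lt_div_iff₀ (by linarith)] at hn
  refine le_trans ?_ h1
  have hs := Real.sqrt_nonneg n
  nlinarith

lemma rt_er_le (r n : ℕ) : Real.sqrt n * er r n ≤ 1 := by
  have h := er_le r n
  have p1 : 0 < Real.sqrt ((n : ℝ) + 1) := Real.sqrt_pos.mpr (by positivity)
  rw [le_div_iff₀ p1] at h
  have : Real.sqrt n ≤ Real.sqrt ((n : ℝ) + 1) := Real.sqrt_le_sqrt (by linarith)
  nlinarith [er_nonneg r n]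

lemma SS_bound (r : ℕ) {y σ : ℝ} (hσ : 0 < σ) (hσ1 : σ < 1) (hy0 : 0 ≤ y) (hy : y < 2) :
    ∀ᶠ n : ℕ in atTop, (r + 1) * ((y - 2 * σ) * σ ^ 2 * (n * Real.sqrt n)) ≤ SS r n * ((1 - σ ^ 2) * n + 1) := by
  have h1 : ∀ᶠ n : ℕ in atTop, ∀ s ∈ Finset.range (r + 1), y * Real.sqrt n ≤ EE n (fun a => (a s : ℝ)) :=
    (Filter.eventually_all_finset _).mpr fun s _ => E_row_ge s hy0 hy
  filter_upwards [h1] with n hn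
  have hσ2 : σ ^ 2 < 1 := by nlinarith
  set n' := ⌊σ ^ 2 * n⌋₊ with hn'
  have f1 : (n' : ℝ) ≤ σ ^ 2 * n := Nat.floor_le (by positivity)
  have f2 : σ ^ 2 * n < n' + 1 := Nat.lt_floor_add_one _
  have hle : n' ≤ n := by
    have : (n' : ℝ) ≤ n := by nlinarith [(Nat.cast_nonneg n : (0:ℝ) ≤ n)]
    exact_mod_cast this
  have hA : ∀ m, ∑ s ∈ Finset.range (r + 1), EE m (fun a => (a s : ℝ)) = ∑ j ∈ Finset.range m, SS r j / (j + 1) := by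
    intro m
    simp only [E_row]
    rw [Finset.sum_comm]
    refine Finset.sum_congr rfl fun j _ => ?_
    unfold SS; field_simp
  have g1 : (r + 1) * (y * Real.sqrt n) ≤ ∑ j ∈ Finset.range n, SS r j / (j + 1) := by
    rw [← hA]
    have := Finset.sum_le_sum hn
    simpa using this
  have g2 : ∑ j ∈ Finset.range n', SS r j / (j + 1) ≤ (r + 1) * (2 * (σ * Real.sqrt n)) := by
    rw [← hA]
    have h3 := Finset.sum_le_sum fun s (_ : s ∈ Finset.range (r + 1)) => E_row_le s n'
    have h4 : Real.sqrt n' ≤ σ * Real.sqrt n := by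
      have : σ * Real.sqrt n = Real.sqrt (σ ^ 2 * n) := by
        rw [Real.sqrt_mul (by positivity), Real.sqrt_sq hσ.le]
      rw [this]
      exact Real.sqrt_le_sqrt f1
    simp only [Finset.sum_const, Finset.card_range, nsmul_eq_mul] at h3
    push_cast at h3
    refine h3.trans ?_
    gcongr
  have hS0 : 0 ≤ SS r n := mul_nonneg (by positivity) (Finset.sum_nonneg fun s _ => er_nonneg s n)
  have g3 : ∑ j ∈ Finset.range n, SS r j / (j + 1) ≤ ∑ j ∈ Finset.range n', SS r j / (j + 1) + (n - n') * (SS r n / (n' + 1)) := by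
    rw [← Finset.sum_range_add_sum_Ico _ hle]
    have : ∑ j ∈ Finset.Ico n' n, SS r j / ((j : ℝ) + 1) ≤ ∑ j ∈ Finset.Ico n' n, SS r n / (n' + 1) := by
      refine Finset.sum_le_sum fun j hj => ?_
      rw [Finset.mem_Ico] at hj
      apply div_le_div₀ hS0 (SS_mono r hj.2.le) (by positivity)
      have : (n' : ℝ) ≤ j := by exact_mod_cast hj.1
      linarith
    rw [Finset.sum_const, Nat.card_Ico, nsmul_eq_mul, Nat.cast_sub hle] at this
    linarith
  have g4 : (r + 1) * ((y - 2 * σ) * Real.sqrt n) * (n' + 1) ≤ (n - n') * SS r n := by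
    have : (r + 1) * ((y - 2 * σ) * Real.sqrt n) ≤ (n - n') * SS r n / (n' + 1) := by
      rw [mul_div_assoc]; linarith
    rwa [le_div_iff₀ (by positivity)] at this
  have g5 : (n - n') * SS r n ≤ SS r n * ((1 - σ ^ 2) * n + 1) := by
    rw [mul_comm]
    apply mul_le_mul_of_nonneg_left _ hS0
    linarith
  by_cases hys : 0 ≤ y - 2 * σ
  · have g6 : (r + 1) * ((y - 2 * σ) * Real.sqrt n) * (σ ^ 2 * n) ≤ (r + 1) * ((y - 2 * σ) * Real.sqrt n) * (n' + 1) := by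
      apply mul_le_mul_of_nonneg_left f2.le
      have := Real.sqrt_nonneg n
      positivity
    linarith
  · push Not at hys
    have : (r + 1) * ((y - 2 * σ) * σ ^ 2 * (n * Real.sqrt n)) ≤ 0 := by
      apply mul_nonpos_of_nonneg_of_nonpos (by positivity)
      apply mul_nonpos_of_nonpos_of_nonneg _ (by positivity)
      exact mul_nonpos_of_nonpos_of_nonneg hys.le (by positivity)
    refine this.trans (mul_nonneg hS0 ?_)
    have : 0 ≤ (1 - σ ^ 2) * n := mul_nonneg (by linarith) (by positivity)
    linarith

lemma rt_sum_ge (r : ℕ) {η : ℝ} (hη : η < 1) :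
    ∀ᶠ n : ℕ in atTop, (r + 1) * η ≤ Real.sqrt n * ∑ s ∈ Finset.range (r + 1), er s n := by
  -- choose parameters
  have hc : ∃ σ y : ℝ, 0 < σ ∧ σ < 1 ∧ 0 ≤ y ∧ y < 2 ∧ η < (y - 2 * σ) * σ ^ 2 / (1 - σ ^ 2) := by
    have h1 : Tendsto (fun σ : ℝ => 2 * σ ^ 2 / (1 + σ)) (nhdsWithin 1 (Set.Iio 1)) (nhds 1) := by
      have : ContinuousAt (fun σ : ℝ => 2 * σ ^ 2 / (1 + σ)) 1 := by
        apply ContinuousAt.div (by fun_prop) (by fun_prop) (by norm_num)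
      have := this.tendsto.mono_left (nhdsWithin_le_nhds (s := Set.Iio 1))
      convert this using 2; norm_num
    have h2 := (h1.eventually (lt_mem_nhds hη)).and
      ((Ioo_mem_nhdsLT (show (0:ℝ) < 1 by norm_num)))
    obtain ⟨σ, hσ1, hσ0, hσ2⟩ := h2.exists
    have h3 : Tendsto (fun y : ℝ => (y - 2 * σ) * σ ^ 2 / (1 - σ ^ 2)) (nhdsWithin 2 (Set.Iio 2)) (nhds (2 * σ ^ 2 / (1 + σ))) := by
      have : Continuous (fun y : ℝ => (y - 2 * σ) * σ ^ 2 / (1 - σ ^ 2)) := by fun_prop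
      have := (this.tendsto 2).mono_left (nhdsWithin_le_nhds (s := Set.Iio 2))
      convert this using 2
      have : 1 - σ ^ 2 ≠ 0 := by nlinarith
      have : 1 - σ ≠ 0 := by linarith
      field_simp
      ring
    have h4 := (h3.eventually (lt_mem_nhds hσ1)).and
      ((Ioo_mem_nhdsLT (show (0:ℝ) < 2 by norm_num)))
    obtain ⟨y, hy1, hy0, hy2⟩ := h4.exists
    exact ⟨σ, y, hσ0, hσ2, hy0.le, hy2, hy1⟩
  obtain ⟨σ, y, c1, c2, c3, c4, c5⟩ := hc
  have hB := SS_bound r c1 c2 c3 c4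
  have hσ2 : 0 < 1 - σ ^ 2 := by nlinarith
  set κ := (y - 2 * σ) * σ ^ 2 with hκ
  have hlim : Tendsto (fun n : ℕ => κ * ((n : ℝ) / (n + 1)) * (((n : ℝ) / ((1 - σ ^ 2) * n + 1)))) atTop (nhds (κ * 1 * (1 / (1 - σ ^ 2)))) := by
    have t0 := tendsto_natCast_atTop_atTop (R := ℝ)
    have t1 : ∀ c : ℝ, 0 < c → Tendsto (fun n : ℕ => (n : ℝ) / (c * n + 1)) atTop (nhds (1 / c)) := by
      intro c hc
      have : Tendsto (fun n : ℕ => (1 : ℝ) / (c + (n : ℝ)⁻¹)) atTop (nhds (1 / (c + 0))) := by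
        apply Tendsto.div tendsto_const_nhds _ (by linarith)
        exact tendsto_const_nhds.add t0.inv_tendsto_atTop
      rw [add_zero] at this
      refine this.congr' ?_
      filter_upwards [eventually_ge_atTop 1] with n hn
      have : (0:ℝ) < n := by exact_mod_cast hn
      field_simp
    refine (tendsto_const_nhds.mul ?_).mul (t1 _ hσ2)
    simpa using t1 1 one_pos
  have hev := hlim.eventually (lt_mem_nhds (show η < _ by rw [mul_one, mul_one_div]; exact c5))
  filter_upwards [hB, hev] with n b1 b2
  have q : Real.sqrt n * Real.sqrt n = n := Real.mul_self_sqrt (by positivity)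
  have p1 : (0:ℝ) < (1 - σ ^ 2) * n + 1 := by positivity
  have h5 : (r + 1) * (κ * ((n : ℝ) / (n + 1)) * (((n : ℝ) / ((1 - σ ^ 2) * n + 1)))) ≤ Real.sqrt n * ∑ s ∈ Finset.range (r + 1), er s n := by
    have e1 : (r + 1) * (κ * ((n : ℝ) / (n + 1)) * (((n : ℝ) / ((1 - σ ^ 2) * n + 1)))) = Real.sqrt n * ((r + 1) * (κ * (n * Real.sqrt n))) / ((n + 1) * ((1 - σ ^ 2) * n + 1)) := by
      have : Real.sqrt n * ((r + 1) * (κ * (n * Real.sqrt n))) = (r + 1) * κ * n * (Real.sqrt n * Real.sqrt n) := by ring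
      rw [this, q]; field_simp
    have e2 : Real.sqrt n * ∑ s ∈ Finset.range (r + 1), er s n = Real.sqrt n * (SS r n * ((1 - σ ^ 2) * n + 1)) / ((n + 1) * ((1 - σ ^ 2) * n + 1)) := by
      unfold SS; field_simp
    rw [e1, e2]
    gcongr
  refine le_trans ?_ h5
  gcongr

lemma rt_er_ge (r : ℕ) {ε : ℝ} (hε : 0 < ε) : ∀ᶠ n : ℕ in atTop, 1 - ε ≤ Real.sqrt n * er r n := by
  have h := rt_sum_ge r (η := 1 - ε / (r + 1)) (by have : 0 < ε / (r + 1) := by positivity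
                                                   linarith)
  filter_upwards [h] with n hn
  rw [Finset.sum_range_succ, mul_add, Finset.mul_sum] at hn
  have h2 := Finset.sum_le_sum fun s (_ : s ∈ Finset.range r) => rt_er_le s n
  simp only [Finset.sum_const, Finset.card_range, nsmul_eq_mul, mul_one] at h2
  have : ((r : ℝ) + 1) * (1 - ε / (r + 1)) = r + 1 - ε := by field_simp
  linarith

lemma tp_lim (r : ℕ) : Tendsto (fun n : ℕ => EE n (fun a => |Real.sqrt n * tp n a r - 1|)) atTop (nhds 0) := by
  have h0 : ∀ n, 0 ≤ EE n (fun a => |Real.sqrt n * tp n a r - 1|) := fun n => EE_nonneg fun _ _ => abs_nonneg _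
  rw [Metric.tendsto_atTop]
  intro ε hε
  obtain ⟨N, hN⟩ := eventually_atTop.mp (rt_er_ge r (ε := ε ^ 2 / 4) (by positivity))
  refine ⟨N, fun n hn => ?_⟩
  rw [Real.dist_eq, sub_zero, abs_of_nonneg (h0 n)]
  have h1 := hN n hn
  have h2 := EE_cs n (fun a => |Real.sqrt n * tp n a r - 1|) (fun _ => 1)
  simp only [mul_one, one_pow, sq_abs] at h2
  rw [EE_one, mul_one] at h2
  have h3 : EE n (fun a => (Real.sqrt n * tp n a r - 1) ^ 2) = n * EE n (fun a => tp n a r ^ 2) - 2 * (Real.sqrt n * er r n) + 1 := by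
    unfold er
    have : EE n (fun a => (Real.sqrt n * tp n a r - 1) ^ 2) = EE n (fun a => n * tp n a r ^ 2 - (2 * Real.sqrt n) * tp n a r + 1) := by
      refine EE_congr fun a _ => ?_
      have q : Real.sqrt n ^ 2 = n := Real.sq_sqrt (by positivity)
      linear_combination tp n a r ^ 2 * q
    rw [this, EE_add, EE_sub, EE_mul, EE_mul, EE_one]
    ring
  have h4 : (n : ℝ) * EE n (fun a => tp n a r ^ 2) ≤ 1 := by
    have := tp_sq r n
    have h5 : (n : ℝ) * EE n (fun a => tp n a r ^ 2) ≤ n * (1 / (n + 1)) := by gcongr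
    refine h5.trans ?_
    rw [mul_one_div, div_le_one (by positivity)]; linarith
  rw [h3] at h2
  have : (EE n (fun a => |Real.sqrt n * tp n a r - 1|)) ^ 2 < ε ^ 2 := by
    have : 0 < ε ^ 2 := by positivity
    linarith
  exact lt_of_pow_lt_pow_left₀ 2 hε.le this

end PG

namespace PG

structure IsFill (n : ℕ) (a : ℕ → ℕ) (T : ℕ × ℕ → ℕ) : Prop where
  out : ∀ x : ℕ × ℕ, ¬ x.2 < a x.1 → T x = 0
  lt : ∀ x : ℕ × ℕ, x.2 < a x.1 → T x < n
  surj : ∀ v < n, ∃ x : ℕ × ℕ, x.2 < a x.1 ∧ T x = v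
  mono : ∀ x y : ℕ × ℕ, x.2 < a x.1 → y.2 < a y.1 → x.1 ≤ y.1 → x.2 ≤ y.2 → x ≠ y → T x < T y
  inj : ∀ x y : ℕ × ℕ, x.2 < a x.1 → y.2 < a y.1 → T x = T y → x = y

open Classical in
noncomputable def UU : ℕ → (ℕ → ℕ) → Finset (ℕ × ℕ → ℕ)
  | 0, _ => {0}
  | n + 1, a => ((Finset.range (n + 1)).filter (fun y => a (y + 1) < a y)).biUnion
      (fun y => (UU n (dn a y)).image (fun T => Function.update T (y, a y - 1) n))

lemma mem_dn {a : ℕ → ℕ} (ha : Antitone a) {y : ℕ} (hy : a (y + 1) < a y) (x : ℕ × ℕ) :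
    x.2 < dn a y x.1 ↔ x.2 < a x.1 ∧ x ≠ (y, a y - 1) := by
  obtain ⟨i, j⟩ := x
  simp only [dn, ne_eq, Prod.mk.injEq]
  by_cases h : i = y
  · subst h; simp; omega
  · simp [h]

lemma corner_max {a : ℕ → ℕ} (ha : Antitone a) {y : ℕ} (hy : a (y + 1) < a y) {z : ℕ × ℕ} (hz : z.2 < a z.1)
    (h1 : y ≤ z.1) (h2 : a y - 1 ≤ z.2) : z = (y, a y - 1) := by
  obtain ⟨i, j⟩ := z
  simp only at *
  rcases h1.eq_or_lt with h | h
  · subst h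
    rw [Prod.mk.injEq]; exact ⟨rfl, by omega⟩
  · have := ha (show y + 1 ≤ i from h)
    omega

lemma fill_ext {n : ℕ} {a : ℕ → ℕ} (ha : Antitone a) {y : ℕ} (hy : a (y + 1) < a y) {T : ℕ × ℕ → ℕ}
    (hT : IsFill n (dn a y) T) : IsFill (n + 1) a (Function.update T (y, a y - 1) n) := by
  have hm := mem_dn ha hy
  set c : ℕ × ℕ := (y, a y - 1) with hc
  have hcC : c.2 < a c.1 := by simp only [hc]; omega
  have hu : ∀ x, x ≠ c → Function.update T c n x = T x := fun x hx => Function.update_of_ne hx _ _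
  have hus : Function.update T c n c = n := Function.update_self _ _ _
  constructor
  · intro x hx
    have : x ≠ c := by rintro rfl; exact hx hcC
    rw [hu x this]
    exact hT.out x (fun h => hx ((hm x).mp h).1)
  · intro x hx
    by_cases h : x = c
    · rw [h, hus]; omega
    · rw [hu x h]; have := hT.lt x ((hm x).mpr ⟨hx, h⟩); omega
  · intro v hv
    by_cases h : v = n
    · exact ⟨c, hcC, by rw [hus, h]⟩
    · obtain ⟨x, hx, hxv⟩ := hT.surj v (by omega)
      have := (hm x).mp hx
      exact ⟨x, this.1, by rw [hu x this.2, hxv]⟩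
  · intro x z hx hz h1 h2 hne
    by_cases hxc : x = c
    · exfalso
      have := corner_max ha hy hz (by rw [hxc] at h1; exact h1) (by rw [hxc] at h2; exact h2)
      exact hne (hxc.trans this.symm)
    · have hx' := (hm x).mpr ⟨hx, hxc⟩
      rw [hu x hxc]
      by_cases hzc : z = c
      · rw [hzc, hus]; exact hT.lt x hx'
      · rw [hu z hzc]; exact hT.mono x z hx' ((hm z).mpr ⟨hz, hzc⟩) h1 h2 hne
  · intro x z hx hz he
    by_cases hxc : x = c
    · by_cases hzc : z = c
      · rw [hxc, hzc]
      · rw [hxc, hus, hu z hzc] at he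
        have := hT.lt z ((hm z).mpr ⟨hz, hzc⟩)
        omega
    · by_cases hzc : z = c
      · rw [hzc, hus, hu x hxc] at he
        have := hT.lt x ((hm x).mpr ⟨hx, hxc⟩)
        omega
      · rw [hu x hxc, hu z hzc] at he
        exact hT.inj x z ((hm x).mpr ⟨hx, hxc⟩) ((hm z).mpr ⟨hz, hzc⟩) he

lemma fill_res {n : ℕ} {a : ℕ → ℕ} (ha : Antitone a) {T : ℕ × ℕ → ℕ} (hT : IsFill (n + 1) a T) :
    ∃ y, a (y + 1) < a y ∧ T (y, a y - 1) = n ∧ IsFill n (dn a y) (Function.update T (y, a y - 1) 0) := by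
  obtain ⟨⟨y, j⟩, hx, hxv⟩ := hT.surj n (by omega)
  have hx0 := hx
  simp only at hx
  have h1 : ¬ j + 1 < a y := by
    intro h
    have h2 := hT.mono (y, j) (y, j + 1) hx h le_rfl (Nat.le_succ j) (by simp)
    have h3 := hT.lt (y, j + 1) h
    omega
  have h2 : ¬ j < a (y + 1) := by
    intro h
    have h2 := hT.mono (y, j) (y + 1, j) hx h (Nat.le_succ y) le_rfl (by simp)
    have h3 := hT.lt (y + 1, j) h
    omega
  have hj : j = a y - 1 := by omega
  subst hj
  have hy : a (y + 1) < a y := by omega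
  refine ⟨y, hy, hxv, ?_⟩
  have hm := mem_dn ha hy
  set c : ℕ × ℕ := (y, a y - 1) with hc
  have hu : ∀ x, x ≠ c → Function.update T c 0 x = T x := fun x hx => Function.update_of_ne hx _ _
  have hus : Function.update T c 0 c = 0 := Function.update_self _ _ _
  constructor
  · intro x hx
    by_cases h : x = c
    · rw [h, hus]
    · rw [hu x h]; exact hT.out x (fun h' => hx ((hm x).mpr ⟨h', h⟩))
  · intro x hx
    obtain ⟨q1, q2⟩ := (hm x).mp hx
    rw [hu x q2]
    have := hT.lt x q1
    have : T x ≠ n := fun h => q2 (hT.inj x c q1 hx0 (h.trans hxv.symm))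
    omega
  · intro v hv
    obtain ⟨x, q1, q2⟩ := hT.surj v (by omega)
    have q3 : x ≠ c := by rintro rfl; omega
    exact ⟨x, (hm x).mpr ⟨q1, q3⟩, by rw [hu x q3, q2]⟩
  · intro x z hx hz h1 h2 hne
    obtain ⟨q1, q2⟩ := (hm x).mp hx
    obtain ⟨q3, q4⟩ := (hm z).mp hz
    rw [hu x q2, hu z q4]
    exact hT.mono x z q1 q3 h1 h2 hne
  · intro x z hx hz he
    obtain ⟨q1, q2⟩ := (hm x).mp hx
    obtain ⟨q3, q4⟩ := (hm z).mp hz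
    rw [hu x q2, hu z q4] at he
    exact hT.inj x z q1 q3 he

lemma mem_UU : ∀ (n : ℕ) (a : ℕ → ℕ), IsP n a → ∀ T, T ∈ UU n a ↔ IsFill n a T := by
  intro n
  induction n with
  | zero =>
    intro a ha T
    rw [isP_zero_iff] at ha
    subst ha
    simp only [UU, Finset.mem_singleton]
    constructor
    · rintro rfl
      constructor <;> simp
    · intro h
      funext x
      exact h.out x (by simp)
  | succ n ih =>
    intro a ha T
    simp only [UU, Finset.mem_biUnion, Finset.mem_filter, Finset.mem_range, Finset.mem_image]
    constructor
    · rintro ⟨y, ⟨_, hy⟩, T', hT', rfl⟩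
      exact fill_ext ha.1 hy ((ih _ (ha.dn hy) _).mp hT')
    · intro h
      obtain ⟨y, hy, h1, h2⟩ := fill_res ha.1 h
      have hyn : y < n + 1 := by
        by_contra hc
        have := ha.zero_of_le (i := y) (by omega)
        omega
      refine ⟨y, ⟨hyn, hy⟩, _, (ih _ (ha.dn hy) _).mpr h2, ?_⟩
      rw [Function.update_idem, ← h1, Function.update_eq_self]

lemma card_UU : ∀ (n : ℕ) (a : ℕ → ℕ), IsP n a → ((UU n a).card : ℝ) = dm n a := by
  classical
  intro n
  induction n with
  | zero => intro a _; simp [UU, dm]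
  | succ n ih =>
    intro a ha
    rw [UU, Finset.card_biUnion]
    · rw [dm, ← Finset.sum_filter]
      push_cast
      refine Finset.sum_congr rfl fun y hy => ?_
      have hy' := (Finset.mem_filter.mp hy).2
      rw [Finset.card_image_of_injOn, ih _ (ha.dn hy')]
      intro T hT T' hT' he
      have o1 := ((mem_UU n _ (ha.dn hy') T).mp hT).out (y, a y - 1) (by simp [dn])
      have o2 := ((mem_UU n _ (ha.dn hy') T').mp hT').out (y, a y - 1) (by simp [dn])
      funext x
      by_cases hx : x = (y, a y - 1)
      · rw [hx, o1, o2]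
      · have := congrFun he x
        simpa [Function.update_of_ne hx] using this
    · intro y hy z hz hyz
      rw [Function.onFun, Finset.disjoint_left]
      intro T h1 h2
      have hy' := (Finset.mem_filter.mp hy).2
      have hz' := (Finset.mem_filter.mp hz).2
      obtain ⟨T1, q1, rfl⟩ := Finset.mem_image.mp h1
      obtain ⟨T2, q2, q3⟩ := Finset.mem_image.mp h2
      have f1 := fill_ext ha.1 hy' ((mem_UU n _ (ha.dn hy') T1).mp q1)
      have e1 : Function.update T1 (y, a y - 1) n (y, a y - 1) = n := Function.update_self _ _ _
      have e2 : Function.update T1 (y, a y - 1) n (z, a z - 1) = n := by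
        rw [← q3]; exact Function.update_self _ _ _
      have := f1.inj (y, a y - 1) (z, a z - 1) (by simp only; omega) (by simp only; omega) (e1.trans e2.symm)
      exact hyz (Prod.mk.inj this).1

end PG

namespace PG

lemma isP_rowLen (μ : YoungDiagram) : IsP μ.card μ.rowLen := by
  refine isP_of (K := μ.colLen 0) (fun i j hij => μ.rowLen_anti i j hij) ?_ ?_
  · intro i hi
    by_contra h
    have : (i, 0) ∈ μ := YoungDiagram.mem_iff_lt_rowLen.mpr (by omega)
    rw [YoungDiagram.mem_iff_lt_colLen] at this
    omega
  · have h := Finset.card_eq_sum_card_fiberwise (s := μ.cells) (t := Finset.range (μ.colLen 0)) (f := Prod.fst) (by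
      intro x hx
      obtain ⟨i, j⟩ := x
      simp only [Finset.coe_range, Set.mem_Iio]
      have h1 : (i, j) ∈ μ := hx
      have h2 : (i, 0) ∈ μ := μ.up_left_mem le_rfl (Nat.zero_le j) h1
      exact YoungDiagram.mem_iff_lt_colLen.mp h2)
    rw [YoungDiagram.card, h]
    refine Finset.sum_congr rfl fun i _ => ?_
    rw [YoungDiagram.rowLen_eq_card]; rfl

lemma sytCount_eq (μ : YoungDiagram) : (sytCount μ : ℝ) = dm μ.card μ.rowLen := by
  classical
  rw [← card_UU _ _ (isP_rowLen μ)]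
  congr 1
  unfold sytCount
  rw [← Nat.card_eq_finsetCard]
  have hc : ∀ x : ℕ × ℕ, x ∈ μ.cells ↔ x.2 < μ.rowLen x.1 := fun x => YoungDiagram.mem_iff_lt_rowLen
  have hF : ∀ T : {T : μ.cells → Fin μ.card // Function.Bijective T ∧ ∀ a b : μ.cells, (a : ℕ × ℕ).1 ≤ (b : ℕ × ℕ).1 →
      (a : ℕ × ℕ).2 ≤ (b : ℕ × ℕ).2 → a ≠ b → T a < T b},
      (fun x => if h : x ∈ μ.cells then ((T.1 ⟨x, h⟩ : Fin μ.card) : ℕ) else 0) ∈ UU μ.card μ.rowLen := by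
    rintro ⟨T, hT, hm⟩
    rw [mem_UU _ _ (isP_rowLen μ)]
    constructor
    · intro x hx
      rw [← hc] at hx
      simp only [hx, dite_false]
    · intro x hx
      rw [← hc] at hx
      simp only [hx, dite_true]
      exact (T ⟨x, hx⟩).2
    · intro v hv
      obtain ⟨⟨x, hx⟩, hxv⟩ := hT.2 ⟨v, hv⟩
      refine ⟨x, (hc x).mp hx, ?_⟩
      simp only [hx, dite_true, hxv]
    · intro x y hx hy h1 h2 hne
      rw [← hc] at hx hy
      simp only [hx, hy, dite_true]
      exact hm ⟨x, hx⟩ ⟨y, hy⟩ h1 h2 (by simpa using hne)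
    · intro x y hx hy he
      rw [← hc] at hx hy
      simp only [hx, hy, dite_true] at he
      have := hT.1 (Fin.ext he)
      simpa using this
  refine Nat.card_eq_of_bijective (fun T => (⟨_, hF T⟩ : (UU μ.card μ.rowLen : Finset _))) ⟨?_, ?_⟩
  · intro T T' h
    have h2 := congrArg Subtype.val h
    apply Subtype.ext
    funext x
    have h3 := congrFun h2 x.1
    simp only [x.2, dite_true] at h3
    exact Fin.ext h3
  · rintro ⟨T, hT⟩
    have hf := (mem_UU _ _ (isP_rowLen μ) T).mp hT
    refine ⟨⟨fun x => ⟨T x.1, hf.lt x.1 ((hc _).mp x.2)⟩, ⟨?_, ?_⟩, ?_⟩, ?_⟩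
    · intro x y h
      exact Subtype.ext (hf.inj _ _ ((hc _).mp x.2) ((hc _).mp y.2) (congrArg Fin.val h))
    · rintro ⟨v, hv⟩
      obtain ⟨x, hx, hxv⟩ := hf.surj v hv
      exact ⟨⟨x, (hc x).mpr hx⟩, Fin.ext hxv⟩
    · intro x y h1 h2 hne
      exact hf.mono _ _ ((hc _).mp x.2) ((hc _).mp y.2) h1 h2 (fun h => hne (Subtype.ext h))
    · apply Subtype.ext
      funext x
      by_cases hx : x ∈ μ.cells
      · simp only [hx, dite_true]
      · simp only [hx, dite_false]
        exact (hf.out x (fun h => hx ((hc x).mpr h))).symm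

def yd (n : ℕ) (a : ℕ → ℕ) : YoungDiagram where
  cells := (Finset.range n ×ˢ Finset.range n).filter (fun x => ∀ i ≤ x.1, x.2 < a i)
  isLowerSet := by
    rintro ⟨i, j⟩ ⟨i', j'⟩ hle h
    obtain ⟨h1, h2⟩ := Prod.mk_le_mk.mp hle
    simp only [Finset.coe_filter, Finset.mem_product, Finset.mem_range, Set.mem_ofPred_eq] at h ⊢
    exact ⟨⟨by omega, by omega⟩, fun s hs => lt_of_le_of_lt h2 (h.2 s (by omega))⟩

lemma mem_yd {n : ℕ} {a : ℕ → ℕ} (h : IsP n a) (i j : ℕ) : (i, j) ∈ yd n a ↔ j < a i := by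
  change (i, j) ∈ (yd n a).cells ↔ _
  simp only [yd, Finset.mem_filter, Finset.mem_product, Finset.mem_range]
  constructor
  · intro q; exact q.2 i le_rfl
  · intro q
    refine ⟨⟨?_, lt_of_lt_of_le q (h.le i)⟩, fun s hs => lt_of_lt_of_le q (h.1 hs)⟩
    by_contra hc
    have := h.zero_of_le (i := i) (by omega)
    omega

lemma rowLen_yd {n : ℕ} {a : ℕ → ℕ} (h : IsP n a) : (yd n a).rowLen = a := by
  funext i
  have : ∀ j, j < (yd n a).rowLen i ↔ j < a i := fun j => by
    rw [← YoungDiagram.mem_iff_lt_rowLen, mem_yd h]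
  have h1 := this (a i)
  have h2 := this ((yd n a).rowLen i)
  omega

lemma card_yd {n : ℕ} {a : ℕ → ℕ} (h : IsP n a) : (yd n a).card = n := by
  have h1 := isP_rowLen (yd n a)
  rw [rowLen_yd h] at h1
  have e1 := h1.sum (le_max_left _ n)
  have e2 := h.sum (le_max_right (yd n a).card n)
  rw [e1] at e2
  exact e2

/-- extend a path by one step -/
def ext (m : ℕ) (h : ℕ → ℕ → ℕ) (s : ℕ) : ℕ → ℕ → ℕ := fun i => if i ≤ m then h i else up (h m) s

open Classical in
noncomputable def HH : ℕ → Finset (ℕ → ℕ → ℕ)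
  | 0 => {fun _ => 0}
  | m + 1 => ((HH m ×ˢ Finset.range (m + 1)).filter (fun q => Antitone (up (q.1 m) q.2))).image (fun q => ext m q.1 q.2)

structure IsPath (m : ℕ) (h : ℕ → ℕ → ℕ) : Prop where
  zero : h 0 = 0
  isP : ∀ i ≤ m, IsP i (h i)
  tail : ∀ i, m ≤ i → h i = h m
  step : ∀ i < m, ∃ s, h (i + 1) = up (h i) s

lemma ext_le {m : ℕ} {h : ℕ → ℕ → ℕ} {s i : ℕ} (hi : i ≤ m) : ext m h s i = h i := by simp [ext, hi]
lemma ext_gt {m : ℕ} {h : ℕ → ℕ → ℕ} {s i : ℕ} (hi : m < i) : ext m h s i = up (h m) s := by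
  simp [ext, Nat.not_le.mpr hi]

lemma HH_path (m : ℕ) : ∀ h ∈ HH m, IsPath m h := by
  classical
  induction m with
  | zero =>
    intro h hh
    simp only [HH, Finset.mem_singleton] at hh
    subst hh
    refine ⟨rfl, ?_, fun _ _ => rfl, fun i hi => absurd hi (by omega)⟩
    intro i hi
    obtain rfl : i = 0 := by omega
    exact isP_zero_iff.mpr rfl
  | succ m ih =>
    intro h hh
    simp only [HH, Finset.mem_image, Finset.mem_filter, Finset.mem_product, Finset.mem_range, Prod.exists] at hh
    obtain ⟨g, s, ⟨⟨hg, hs⟩, hu⟩, rfl⟩ := hh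
    have hp := ih g hg
    refine ⟨?_, ?_, ?_, ?_⟩
    · rw [ext_le (by omega)]; exact hp.zero
    · intro i hi
      by_cases him : i ≤ m
      · rw [ext_le him]; exact hp.isP i him
      · obtain rfl : i = m + 1 := by omega
        rw [ext_gt (by omega)]; exact (hp.isP m le_rfl).up hu
    · intro i hi
      rw [ext_gt (by omega), ext_gt (by omega)]
    · intro i hi
      by_cases him : i < m
      · rw [ext_le (by omega), ext_le (by omega)]; exact hp.step i him
      · obtain rfl : i = m := by omega
        exact ⟨s, by rw [ext_gt (by omega), ext_le le_rfl]⟩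

noncomputable def WE (m : ℕ) (Φ : (ℕ → ℕ → ℕ) → ℝ) : ℝ :=
  ∑ h ∈ HH m, dm m (h m) / m.factorial * Φ h

lemma WE_succ (m : ℕ) (Φ : (ℕ → ℕ → ℕ) → ℝ) :
    WE (m + 1) Φ = WE m (fun h => ∑ s ∈ Finset.range (m + 1), tp m (h m) s * Φ (ext m h s)) := by
  classical
  unfold WE
  simp only [HH]
  rw [Finset.sum_image]
  · rw [Finset.sum_filter, Finset.sum_product]
    refine Finset.sum_congr rfl fun h hh => ?_
    rw [Finset.mul_sum]
    refine Finset.sum_congr rfl fun s _ => ?_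
    have hp := dm_pos ((HH_path m h hh).isP m le_rfl)
    simp only
    split_ifs with hu
    · rw [tp_of hu, ext_gt (by omega), Nat.factorial_succ]; push_cast; field_simp
    · rw [tp_not hu]; simp
  · rintro ⟨g, s⟩ hg ⟨g', s'⟩ hg' he
    simp only [Finset.coe_filter, Finset.mem_product, Set.mem_ofPred_eq] at hg hg'
    simp only at he
    have hp := HH_path m g hg.1.1
    have hp' := HH_path m g' hg'.1.1
    have e1 : ∀ i ≤ m, g i = g' i := by
      intro i hi
      have := congrFun he i
      rwa [ext_le hi, ext_le hi] at this
    have e2 : g = g' := by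
      funext i
      by_cases hi : i ≤ m
      · exact e1 i hi
      · rw [hp.tail i (by omega), hp'.tail i (by omega)]; exact e1 m le_rfl
    subst e2
    have e3 := congrFun he (m + 1)
    rw [ext_gt (by omega), ext_gt (by omega)] at e3
    rw [up_injective_right _ e3]

lemma WE_congr {m : ℕ} {Φ Ψ : (ℕ → ℕ → ℕ) → ℝ} (h : ∀ g, IsPath m g → Φ g = Ψ g) : WE m Φ = WE m Ψ :=
  Finset.sum_congr rfl fun g hg => by rw [h g (HH_path m g hg)]

lemma WE_mono {m : ℕ} {Φ Ψ : (ℕ → ℕ → ℕ) → ℝ} (h : ∀ g, IsPath m g → Φ g ≤ Ψ g) : WE m Φ ≤ WE m Ψ :=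
  Finset.sum_le_sum fun g hg => mul_le_mul_of_nonneg_left (h g (HH_path m g hg))
    (div_nonneg (dm_nonneg _ _) (by positivity))

lemma WE_sub (m : ℕ) (Φ Ψ : (ℕ → ℕ → ℕ) → ℝ) : WE m (fun h => Φ h - Ψ h) = WE m Φ - WE m Ψ := by
  unfold WE; rw [← Finset.sum_sub_distrib]; exact Finset.sum_congr rfl fun _ _ => by ring

lemma WE_mul (m : ℕ) (c : ℝ) (Φ : (ℕ → ℕ → ℕ) → ℝ) : WE m (fun h => c * Φ h) = c * WE m Φ := by
  unfold WE; rw [Finset.mul_sum]; exact Finset.sum_congr rfl fun _ _ => by ring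

lemma WE_abs (m : ℕ) (Φ : (ℕ → ℕ → ℕ) → ℝ) : |WE m Φ| ≤ WE m (fun h => |Φ h|) := by
  unfold WE
  refine (Finset.abs_sum_le_sum_abs _ _).trans (le_of_eq ?_)
  refine Finset.sum_congr rfl fun a _ => ?_
  rw [abs_mul, abs_of_nonneg (div_nonneg (dm_nonneg _ _) (by positivity))]

lemma WE_marg (m : ℕ) (F : (ℕ → ℕ) → ℝ) : WE m (fun h => F (h m)) = EE m F := by
  induction m generalizing F with
  | zero => rw [EE_zero]; simp [WE, HH, dm]
  | succ m ih =>
    rw [WE_succ, EE_succ, ← ih]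
    refine WE_congr fun g _ => Finset.sum_congr rfl fun s _ => ?_
    rw [ext_gt (by omega)]

lemma WE_one (m : ℕ) : WE m (fun _ => 1) = 1 := (WE_marg m (fun _ => 1)).trans (EE_one m)

lemma path_prob {Ω : Type*} [MeasurableSpace Ω] {P : Measure Ω} {lam : ℕ → Ω → YoungDiagram}
    (hP : IsPlancherelGrowthProcess P lam) {M : ℕ} {h : ℕ → ℕ → ℕ} (hh : IsPath M h) :
    (P {ω | ∀ i ≤ M, lam i ω = yd i (h i)}).toReal = dm M (h M) / M.factorial := by
  rw [hP.2.2 M (fun i => yd i (h i)), ENNReal.toReal_div, ENNReal.toReal_natCast, ENNReal.toReal_natCast, sytCount_eq,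
    card_yd (hh.isP M le_rfl), rowLen_yd (hh.isP M le_rfl)]
  · ext x
    simp [yd]
  · intro i hi
    have p1 := hh.isP i (by omega)
    have p2 := hh.isP (i + 1) (by omega)
    refine ⟨?_, by rw [card_yd p1, card_yd p2]⟩
    obtain ⟨s, hs⟩ := hh.step i hi
    rintro ⟨x, y⟩ hx
    rw [mem_yd p2, hs]
    have := (mem_yd p1 x y).mp hx
    simp only [up]; omega

lemma prob_eq {Ω : Type*} [MeasurableSpace Ω] {P : Measure Ω} {lam : ℕ → Ω → YoungDiagram}
    (hP : IsPlancherelGrowthProcess P lam) (M : ℕ) (Q : (ℕ → ℕ → ℕ) → Prop)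
    (hQ : ∀ h h', (∀ i ≤ M, h i = h' i) → (Q h ↔ Q h')) : open Classical in
    (P {ω | Q (fun i => (lam i ω).rowLen)}).toReal = WE M (fun h => if Q h then 1 else 0) := by
  classical
  haveI := hP.1
  set S : (ℕ → ℕ → ℕ) → Set Ω := fun h => {ω | ∀ i ≤ M, lam i ω = yd i (h i)} with hS
  have hSm : ∀ h, MeasurableSet (S h) := by
    intro h
    have : S h = ⋂ i ∈ Finset.range (M + 1), {ω | lam i ω = yd i (h i)} := by
      ext ω; simp [hS, Nat.lt_succ_iff]
    rw [this]
    exact Finset.measurableSet_biInter _ fun i _ => hP.2.1 i _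
  have hrow : ∀ h ∈ HH M, ∀ ω ∈ S h, ∀ i ≤ M, (lam i ω).rowLen = h i := by
    intro h hh ω hω i hi
    rw [hω i hi, rowLen_yd ((HH_path M h hh).isP i hi)]
  have hdis : Set.PairwiseDisjoint (↑(HH M)) S := by
    intro g hg g' hg' hne
    rw [Function.onFun, Set.disjoint_left]
    intro ω h1 h2
    apply hne
    have p1 := HH_path M g hg
    have p2 := HH_path M g' hg'
    funext i
    have key : ∀ i ≤ M, g i = g' i := fun i hi => (hrow g hg ω h1 i hi).symm.trans (hrow g' hg' ω h2 i hi)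
    by_cases hi : i ≤ M
    · exact key i hi
    · rw [p1.tail i (by omega), p2.tail i (by omega)]; exact key M le_rfl
  have hsum : ∀ A : Finset (ℕ → ℕ → ℕ), A ⊆ HH M → (P (⋃ h ∈ A, S h)).toReal = ∑ h ∈ A, dm M (h M) / M.factorial := by
    intro A hA
    rw [measure_biUnion_finset (hdis.subset (by exact_mod_cast hA)) (fun h _ => hSm h), ENNReal.toReal_sum (fun _ _ => measure_ne_top _ _)]
    exact Finset.sum_congr rfl fun h hh => path_prob hP (HH_path M h (hA hh))
  have hfull : P (⋃ h ∈ HH M, S h)ᶜ = 0 := by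
    have hm : MeasurableSet (⋃ h ∈ HH M, S h) := Finset.measurableSet_biUnion _ fun h _ => hSm h
    rw [prob_compl_eq_zero_iff hm]
    have h1 := hsum (HH M) (Finset.Subset.refl _)
    have h2 := WE_one M
    unfold WE at h2
    simp only [mul_one] at h2
    rw [h2] at h1
    rwa [ENNReal.toReal_eq_one_iff] at h1
  have hA : P {ω | Q (fun i => (lam i ω).rowLen)} = P (⋃ h ∈ (HH M).filter Q, S h) := by
    apply measure_congr
    have : ∀ᵐ ω ∂P, ω ∈ ⋃ h ∈ HH M, S h := by
      rw [ae_iff]; exact hfull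
    filter_upwards [this] with ω hω
    apply propext
    simp only [Set.mem_iUnion] at hω
    obtain ⟨g, hg, hgω⟩ := hω
    have hq := hQ (fun i => (lam i ω).rowLen) g (hrow g hg ω hgω)
    change Q (fun i => (lam i ω).rowLen) ↔ ω ∈ ⋃ h ∈ (HH M).filter Q, S h
    rw [hq]
    simp only [Set.mem_iUnion, Finset.mem_filter]
    constructor
    · intro h; exact ⟨g, ⟨hg, h⟩, hgω⟩
    · rintro ⟨g', ⟨hg', hQ'⟩, hω'⟩
      have : g = g' := by
        by_contra hne
        exact Set.disjoint_left.mp (hdis hg hg' hne) hgω hω'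
      rwa [this]
  rw [hA, hsum _ (Finset.filter_subset _ _), Finset.sum_filter]
  unfold WE
  refine Finset.sum_congr rfl fun h _ => ?_
  beta_reduce
  by_cases hq : Q h
  · rw [if_pos hq, if_pos hq, mul_one]
  · rw [if_neg hq, if_neg hq, mul_zero]

end PG

namespace PG

lemma pz_nonneg {τ : ℝ} (h : 0 ≤ τ) (m : ℤ) : 0 ≤ poissonProbZ τ m := by
  unfold poissonProbZ; split_ifs <;> positivity

lemma pz_le_one {τ : ℝ} (h : 0 ≤ τ) (m : ℤ) : poissonProbZ τ m ≤ 1 := by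
  unfold poissonProbZ
  split_ifs
  · have := Real.pow_div_factorial_le_exp τ h m.toNat
    rw [mul_div_assoc]
    calc Real.exp (-τ) * (τ ^ m.toNat / m.toNat.factorial) ≤ Real.exp (-τ) * Real.exp τ := by gcongr
      _ = 1 := by rw [← Real.exp_add]; simp
  · norm_num

lemma pz_zero (m : ℤ) : poissonProbZ 0 m = if m = 0 then 1 else 0 := by
  unfold poissonProbZ
  by_cases h : m = 0
  · simp [h]
  · rw [if_neg h]
    split_ifs with h0
    · have : m.toNat ≠ 0 := by omega
      simp [this]
    · rfl

lemma pz_deriv (m : ℤ) (τ : ℝ) : HasDerivAt (fun τ => poissonProbZ τ m) (poissonProbZ τ (m - 1) - poissonProbZ τ m) τ := by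
  unfold poissonProbZ
  by_cases h : 0 ≤ m
  · obtain ⟨k, rfl⟩ := Int.eq_ofNat_of_zero_le h
    simp only [h, if_true, Int.toNat_natCast]
    have he : HasDerivAt (fun τ : ℝ => Real.exp (-τ)) (-Real.exp (-τ)) τ := by
      have := (hasDerivAt_neg τ).exp
      simpa using this
    cases k with
    | zero => simpa using he
    | succ k =>
      have h1 : (0 : ℤ) ≤ ((k + 1 : ℕ) : ℤ) - 1 := by push_cast; omega
      have h2 : (((k + 1 : ℕ) : ℤ) - 1).toNat = k := by push_cast; omega
      rw [if_pos h1, h2]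
      have hp := hasDerivAt_pow (k + 1) τ
      have := (he.mul hp).div_const ((k + 1).factorial : ℝ)
      refine this.congr_deriv ?_
      rw [Nat.factorial_succ]
      push_cast
      field_simp
      ring
  · have h1 : ¬ 0 ≤ m - 1 := by omega
    simp only [h, h1, if_false, sub_self]
    exact hasDerivAt_const _ _

variable {k : ℕ}

noncomputable def pp (τ : ℝ) (w : Fin (k + 1) → ℤ) : ℝ := ∏ r, poissonProbZ τ (w r)

def sh (w : Fin (k + 1) → ℤ) (s : ℕ) : Fin (k + 1) → ℤ := fun i => w i - if (i : ℕ) = s then 1 else 0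

lemma pp_nonneg {τ : ℝ} (h : 0 ≤ τ) (w : Fin (k + 1) → ℤ) : 0 ≤ pp τ w := Finset.prod_nonneg fun r _ => pz_nonneg h _
lemma pp_le_one {τ : ℝ} (h : 0 ≤ τ) (w : Fin (k + 1) → ℤ) : pp τ w ≤ 1 :=
  Finset.prod_le_one (fun r _ => pz_nonneg h _) fun r _ => pz_le_one h _

lemma pp_diff {τ : ℝ} (h : 0 ≤ τ) (w w' : Fin (k + 1) → ℤ) : |pp τ w - pp τ w'| ≤ 1 := by
  have := pp_nonneg h w; have := pp_nonneg h w'; have := pp_le_one h w; have := pp_le_one h w'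
  rw [abs_le]; constructor <;> linarith

lemma pp_zero (w : Fin (k + 1) → ℤ) : pp 0 w = if ∀ r, w r = 0 then 1 else 0 := by
  unfold pp
  simp only [pz_zero]
  split_ifs with h
  · simp [h]
  · push Not at h
    obtain ⟨r, hr⟩ := h
    exact Finset.prod_eq_zero (Finset.mem_univ r) (by simp [hr])

noncomputable def dpp (τ : ℝ) (w : Fin (k + 1) → ℤ) : ℝ := ∑ r : Fin (k + 1), (pp τ (sh w r) - pp τ w)

lemma pp_deriv (w : Fin (k + 1) → ℤ) (τ : ℝ) : HasDerivAt (fun τ => pp τ w) (dpp τ w) τ := by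
  unfold pp dpp
  have := HasDerivAt.fun_finsetProd (u := Finset.univ) (fun r (_ : r ∈ (Finset.univ : Finset (Fin (k + 1)))) => pz_deriv (w r) τ)
  refine this.congr_deriv ?_
  refine Finset.sum_congr rfl fun r _ => ?_
  unfold pp
  rw [← Finset.mul_prod_erase Finset.univ (fun i => poissonProbZ τ (w i)) (Finset.mem_univ r),
    ← Finset.mul_prod_erase Finset.univ (fun i => poissonProbZ τ (sh w r i)) (Finset.mem_univ r)]
  have : ∏ i ∈ Finset.univ.erase r, poissonProbZ τ (sh w r i) = ∏ i ∈ Finset.univ.erase r, poissonProbZ τ (w i) := by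
    refine Finset.prod_congr rfl fun i hi => ?_
    have : (i : ℕ) ≠ r := fun h => (Finset.mem_erase.mp hi).1 (Fin.ext h)
    simp [sh, this]
  rw [this]
  simp only [sh, if_true, smul_eq_mul]
  ring

lemma dpp_bound {τ : ℝ} (h : 0 ≤ τ) (w : Fin (k + 1) → ℤ) : |dpp τ w| ≤ k + 1 := by
  unfold dpp
  refine (Finset.abs_sum_le_sum_abs _ _).trans ?_
  refine (Finset.sum_le_sum fun r _ => pp_diff h _ _).trans ?_
  simp

lemma dpp_deriv (w : Fin (k + 1) → ℤ) (τ : ℝ) : HasDerivAt (fun τ => dpp τ w) (∑ r : Fin (k + 1), (dpp τ (sh w r) - dpp τ w)) τ := by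
  unfold dpp
  exact HasDerivAt.fun_sum fun r _ => (pp_deriv _ τ).sub (pp_deriv _ τ)

lemma dpp_lip {τ σ : ℝ} (h : 0 ≤ τ) (hs : τ ≤ σ) (w : Fin (k + 1) → ℤ) : |dpp σ w - dpp τ w| ≤ 2 * (k + 1) ^ 2 * (σ - τ) := by
  have := Convex.norm_image_sub_le_of_norm_hasDerivWithin_le (s := Set.Ici 0) (x := τ) (y := σ) (f := fun τ => dpp τ w)
    (C := 2 * ((k : ℝ) + 1) ^ 2) (fun x _ => (dpp_deriv w x).hasDerivWithinAt) (fun x hx => by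
      rw [Real.norm_eq_abs]
      refine (Finset.abs_sum_le_sum_abs _ _).trans ?_
      have : ∀ r : Fin (k + 1), |dpp x (sh w r) - dpp x w| ≤ 2 * (k + 1) := fun r => by
        have h1 := dpp_bound hx (sh w r)
        have h2 := dpp_bound hx w
        have := abs_sub (dpp x (sh w r)) (dpp x w)
        linarith
      refine (Finset.sum_le_sum fun r _ => this r).trans (le_of_eq ?_)
      simp only [Finset.sum_const, Finset.card_univ, Fintype.card_fin, nsmul_eq_mul]
      push_cast; ring) (convex_Ici 0) h (h.trans hs)
  simp only [Real.norm_eq_abs] at this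
  rwa [abs_of_nonneg (sub_nonneg.mpr hs)] at this

lemma pp_taylor {τ x : ℝ} (h : 0 ≤ τ) (hx : 0 ≤ x) (w : Fin (k + 1) → ℤ) :
    |pp (τ + x) w - pp τ w - x * dpp τ w| ≤ 2 * (k + 1) ^ 2 * x ^ 2 := by
  have := Convex.norm_image_sub_le_of_norm_hasDerivWithin_le (s := Set.Icc τ (τ + x)) (x := τ) (y := τ + x)
    (f := fun σ => pp σ w - σ * dpp τ w) (f' := fun σ => dpp σ w - 1 * dpp τ w)
    (C := 2 * ((k : ℝ) + 1) ^ 2 * x) (fun σ _ => ((pp_deriv w σ).sub ((hasDerivAt_id σ).mul_const (dpp τ w))).hasDerivWithinAt) (fun σ hσ => by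
      rw [Real.norm_eq_abs, one_mul]
      refine (dpp_lip h hσ.1 w).trans ?_
      have : σ - τ ≤ x := by linarith [hσ.2]
      gcongr) (convex_Icc _ _) ⟨le_rfl, by linarith⟩ ⟨by linarith, le_rfl⟩
  simp only [Real.norm_eq_abs] at this
  rw [add_sub_cancel_left, abs_of_nonneg hx] at this
  refine le_trans (le_of_eq ?_) (this.trans (le_of_eq (by ring)))
  congr 1; ring

lemma pp_cont (w : Fin (k + 1) → ℤ) : Continuous (fun τ => pp τ w) :=
  continuous_iff_continuousAt.mpr fun τ => (pp_deriv w τ).continuousAt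

/-- one-step estimate -/
lemma step_pt {m : ℕ} {a : ℕ → ℕ} (ha : IsP m a) (hk : k ≤ m) {τ x : ℝ} (h : 0 ≤ τ) (hx : 0 ≤ x) (w : Fin (k + 1) → ℤ) :
    |∑ s ∈ Finset.range (m + 1), tp m a s * pp τ (sh w s) - pp (τ + x) w|
      ≤ ∑ r ∈ Finset.range (k + 1), |tp m a r - x| + 2 * (k + 1) ^ 2 * x ^ 2 := by
  have e1 : ∑ s ∈ Finset.range (m + 1), tp m a s * pp τ (sh w s) = pp τ w + ∑ r ∈ Finset.range (k + 1), tp m a r * (pp τ (sh w r) - pp τ w) := by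
    have q1 : ∑ s ∈ Finset.range (m + 1), tp m a s * pp τ (sh w s)
        = ∑ s ∈ Finset.range (m + 1), (tp m a s * pp τ w + tp m a s * (pp τ (sh w s) - pp τ w)) :=
      Finset.sum_congr rfl fun s _ => by ring
    rw [q1, Finset.sum_add_distrib, ← Finset.sum_mul, sum_tp ha, one_mul]
    congr 1
    symm
    refine Finset.sum_subset (by simpa using hk) fun s _ hs => ?_
    have : sh w s = w := by
      funext i
      have : (i : ℕ) ≠ s := by
        have := i.2
        simp at hs; omega
      simp [sh, this]
    rw [this]; simp
  have e2 : x * dpp τ w = ∑ r ∈ Finset.range (k + 1), x * (pp τ (sh w r) - pp τ w) := by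
    unfold dpp
    rw [Finset.sum_range, Finset.mul_sum]
  have e3 : ∑ s ∈ Finset.range (m + 1), tp m a s * pp τ (sh w s) - pp (τ + x) w
      = ∑ r ∈ Finset.range (k + 1), (tp m a r - x) * (pp τ (sh w r) - pp τ w) - (pp (τ + x) w - pp τ w - x * dpp τ w) := by
    rw [e1, e2]
    simp only [sub_mul, Finset.sum_sub_distrib]
    ring
  rw [e3]
  refine (abs_sub _ _).trans (add_le_add ?_ (pp_taylor h hx w))
  refine (Finset.abs_sum_le_sum_abs _ _).trans (Finset.sum_le_sum fun r _ => ?_)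
  rw [abs_mul]
  have := pp_diff h (sh w r) w
  nlinarith [abs_nonneg (tp m a r - x)]

/-- remaining increment -/
def rem (u : Fin (k + 1) → ℤ) (a m : ℕ) (h : ℕ → ℕ → ℕ) : Fin (k + 1) → ℤ := fun r => u r - ((h m r : ℤ) - (h a r : ℤ))

lemma step_WE {a m : ℕ} (ham : a ≤ m) (hk : k ≤ m) {τ x : ℝ} (h : 0 ≤ τ) (hx : 0 ≤ x) (u : Fin (k + 1) → ℤ)
    (B : (ℕ → ℕ → ℕ) → ℝ) (hB : ∀ h h', (∀ i ≤ a, h i = h' i) → B h = B h') (hB1 : ∀ h, |B h| ≤ 1) :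
    |WE (m + 1) (fun h => B h * pp τ (rem u a (m + 1) h)) - WE m (fun h => B h * pp (τ + x) (rem u a m h))|
      ≤ ∑ r ∈ Finset.range (k + 1), EE m (fun a => |tp m a r - x|) + 2 * (k + 1) ^ 2 * x ^ 2 := by
  rw [WE_succ, ← WE_sub]
  refine (WE_abs _ _).trans ?_
  have : ∑ r ∈ Finset.range (k + 1), EE m (fun a => |tp m a r - x|) + 2 * (k + 1) ^ 2 * x ^ 2
      = WE m (fun h => ∑ r ∈ Finset.range (k + 1), |tp m (h m) r - x| + 2 * (k + 1) ^ 2 * x ^ 2) := by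
    rw [WE_marg m (fun b => ∑ r ∈ Finset.range (k + 1), |tp m b r - x| + 2 * (k + 1) ^ 2 * x ^ 2), EE_add, EE_sum, EE_const]
  rw [this]
  refine WE_mono fun g hg => ?_
  have e1 : ∑ s ∈ Finset.range (m + 1), tp m (g m) s * (B (ext m g s) * pp τ (rem u a (m + 1) (ext m g s)))
      = B g * ∑ s ∈ Finset.range (m + 1), tp m (g m) s * pp τ (sh (rem u a m g) s) := by
    rw [Finset.mul_sum]
    refine Finset.sum_congr rfl fun s _ => ?_
    rw [hB (ext m g s) g (fun i hi => ext_le (by omega))]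
    have : rem u a (m + 1) (ext m g s) = sh (rem u a m g) s := by
      funext r
      simp only [rem, sh]
      rw [ext_gt (by omega), ext_le ham]
      simp only [up]
      push_cast
      ring
    rw [this]; ring
  rw [e1, ← mul_sub, abs_mul]
  have := step_pt (hg.isP m le_rfl) hk h hx (rem u a m g)
  refine le_trans ?_ this
  have h1 := hB1 g
  nlinarith [abs_nonneg (∑ s ∈ Finset.range (m + 1), tp m (g m) s * pp τ (sh (rem u a m g) s) - pp (τ + x) (rem u a m g))]

lemma block {a b : ℕ} (hab : a ≤ b) (hk : k ≤ a) {x ε : ℝ} (hx : 0 ≤ x) (u : Fin (k + 1) → ℤ)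
    (B : (ℕ → ℕ → ℕ) → ℝ) (hB : ∀ h h', (∀ i ≤ a, h i = h' i) → B h = B h') (hB1 : ∀ h, |B h| ≤ 1)
    (hε : ∀ m, a ≤ m → m < b → ∀ r < k + 1, EE m (fun a => |tp m a r - x|) ≤ x * ε) :
    |WE b (fun h => B h * if ∀ r, (h b (r : Fin (k + 1)) : ℤ) - (h a r : ℤ) = u r then 1 else 0) - WE a B * pp ((b - a) * x) u|
      ≤ (b - a) * x * ((k + 1) * ε + 2 * (k + 1) ^ 2 * x) := by
  set q : ℕ → ℝ := fun m => WE m (fun h => B h * pp (((b : ℝ) - m) * x) (rem u a m h)) with hq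
  have hqb : q b = WE b (fun h => B h * if ∀ r, (h b (r : Fin (k + 1)) : ℤ) - (h a r : ℤ) = u r then 1 else 0) := by
    simp only [hq, sub_self, zero_mul, pp_zero, rem]
    refine WE_congr fun g _ => ?_
    congr 2
    apply propext
    refine forall_congr' fun r => ?_
    omega
  have hqa : q a = WE a B * pp ((b - a) * x) u := by
    simp only [hq]
    rw [mul_comm (WE a B), ← WE_mul]
    refine WE_congr fun g _ => ?_
    have : rem u a a g = u := by funext r; simp [rem]
    rw [this]; ring
  rw [← hqb, ← hqa]
  have key : ∀ d, a + d ≤ b → |q (a + d) - q a| ≤ d * x * ((k + 1) * ε + 2 * (k + 1) ^ 2 * x) := by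
    intro d
    induction d with
    | zero => intro _; simp
    | succ d ih =>
      intro hd
      have h1 := ih (by omega)
      have hτ : (0:ℝ) ≤ ((b : ℝ) - ((a + d + 1 : ℕ) : ℝ)) * x := by
        apply mul_nonneg _ hx
        rw [sub_nonneg]; exact_mod_cast hd
      have h2 := step_WE (k := k) (a := a) (m := a + d) (by omega) (by omega) hτ hx u B hB hB1
      have e : ((b : ℝ) - ((a + d + 1 : ℕ) : ℝ)) * x + x = ((b : ℝ) - ((a + d : ℕ) : ℝ)) * x := by push_cast; ring
      rw [e] at h2
      have h3 : |q (a + d + 1) - q (a + d)| ≤ x * ((k + 1) * ε + 2 * (k + 1) ^ 2 * x) := by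
        refine h2.trans ?_
        have := Finset.sum_le_sum fun r (hr : r ∈ Finset.range (k + 1)) => hε (a + d) (by omega) (by omega) r (Finset.mem_range.mp hr)
        simp only [Finset.sum_const, Finset.card_range, nsmul_eq_mul] at this
        push_cast at this
        nlinarith
      have h4 := abs_sub_le (q (a + d + 1)) (q (a + d)) (q a)
      rw [← add_assoc]
      push_cast
      linarith
  have := key (b - a) (by omega)
  rw [Nat.add_sub_cancel' hab, Nat.cast_sub hab] at this
  exact this

end PG

namespace PG

lemma ti_mono (n : ℕ) {s s' : ℝ} (h : s ≤ s') : timeIndex n s ≤ timeIndex n s' := by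
  unfold timeIndex
  apply Int.toNat_le_toNat
  have : s * Real.sqrt n ≤ s' * Real.sqrt n := by gcongr
  have := Int.floor_le_floor this
  omega

lemma ti_zero (n : ℕ) : timeIndex n 0 = n := by simp [timeIndex]

lemma ti_le (n : ℕ) (s : ℝ) (h : 0 ≤ (n : ℝ) + s * Real.sqrt n) : (timeIndex n s : ℝ) ≤ n + s * Real.sqrt n := by
  unfold timeIndex
  rcases le_total 0 ((n : ℤ) + ⌊s * Real.sqrt n⌋) with h1 | h1
  · have : (((((n : ℤ) + ⌊s * Real.sqrt n⌋).toNat : ℕ) : ℤ) : ℝ) = (((n : ℤ) + ⌊s * Real.sqrt n⌋ : ℤ) : ℝ) := by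
      rw [Int.toNat_of_nonneg h1]
    have h2 := Int.floor_le (s * Real.sqrt n)
    push_cast at this
    linarith
  · rw [Int.toNat_of_nonpos h1]; simpa using h

lemma ti_ge (n : ℕ) (s : ℝ) : (n : ℝ) + s * Real.sqrt n - 1 ≤ timeIndex n s := by
  unfold timeIndex
  have h0 : ((n : ℤ) + ⌊s * Real.sqrt n⌋) ≤ ((((n : ℤ) + ⌊s * Real.sqrt n⌋).toNat : ℕ) : ℤ) := Int.self_le_toNat _
  have h1 : (((n : ℤ) + ⌊s * Real.sqrt n⌋ : ℤ) : ℝ) ≤ (((((n : ℤ) + ⌊s * Real.sqrt n⌋).toNat : ℕ) : ℤ) : ℝ) := by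
    exact_mod_cast h0
  have h2 := Int.sub_one_lt_floor (s * Real.sqrt n)
  push_cast at h1
  linarith

lemma quad_ev (s : ℝ) {c : ℝ} (hc : 0 < c) : ∀ᶠ n : ℕ in atTop, |s| * Real.sqrt n + 1 ≤ c * n := by
  have h1 := tendsto_rt.eventually_ge_atTop (max 1 ((|s| + 1) / c))
  filter_upwards [h1] with n hn
  have hn1 : 1 ≤ Real.sqrt n := (le_max_left _ _).trans hn
  have hn2 : (|s| + 1) / c ≤ Real.sqrt n := (le_max_right _ _).trans hn
  rw [div_le_iff₀ hc] at hn2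
  have h3 : Real.sqrt n * Real.sqrt n = n := Real.mul_self_sqrt (Nat.cast_nonneg n)
  nlinarith [abs_nonneg s]

lemma ti_ev (s : ℝ) {c : ℝ} (hc : 0 < c) (hc1 : c ≤ 1) : ∀ᶠ n : ℕ in atTop,
    (1 - c) * n ≤ timeIndex n s ∧ (timeIndex n s : ℝ) ≤ (1 + c) * n ∧ (timeIndex n s : ℝ) ≤ n + s * Real.sqrt n := by
  filter_upwards [quad_ev s hc] with n hn
  have h0 := Real.sqrt_nonneg (n : ℝ)
  have h1 : s * Real.sqrt n ≤ |s| * Real.sqrt n := by gcongr; exact le_abs_self s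
  have h2 : -(|s| * Real.sqrt n) ≤ s * Real.sqrt n := by nlinarith [neg_abs_le s]
  have h3 : (0 : ℝ) ≤ n := Nat.cast_nonneg n
  have h4 : c * n ≤ n := by nlinarith
  have h5 := ti_le n s (by linarith)
  have h6 := ti_ge n s
  refine ⟨by linarith, by linarith, h5⟩

lemma ti_lim (s : ℝ) : Tendsto (fun n : ℕ => ((timeIndex n s : ℝ) - n) / Real.sqrt n) atTop (nhds s) := by
  have h1 : Tendsto (fun n : ℕ => s - 1 / Real.sqrt n) atTop (nhds (s - 0)) := by
    refine tendsto_const_nhds.sub ?_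
    simpa [Function.comp_def] using tendsto_inv_atTop_zero.comp tendsto_rt
  rw [sub_zero] at h1
  refine tendsto_of_tendsto_of_tendsto_of_le_of_le' h1 tendsto_const_nhds ?_ ?_
  · filter_upwards [tendsto_rt.eventually_gt_atTop 0] with n hn
    rw [le_div_iff₀ hn, sub_mul, div_mul_cancel₀ _ hn.ne']
    linarith [ti_ge n s]
  · filter_upwards [tendsto_rt.eventually_gt_atTop 0, ti_ev s one_pos le_rfl] with n hn h
    rw [div_le_iff₀ hn]
    linarith [h.2.2]

lemma ti_top (s : ℝ) (K : ℕ) : ∀ᶠ n : ℕ in atTop, K ≤ timeIndex n s := by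
  filter_upwards [ti_ev s (c := 1/2) (by norm_num) (by norm_num), eventually_ge_atTop (2 * K)] with n h hn
  have : ((2 * K : ℕ) : ℝ) ≤ n := by exact_mod_cast hn
  push_cast at this
  have h3 : (K : ℝ) ≤ timeIndex n s := by linarith [h.1]
  exact_mod_cast h3

lemma win_pt {n m : ℕ} {c η : ℝ} (hc0 : 0 < c) (hc : c ≤ 1 / 2) (hn : 0 < n)
    (h1 : (1 - c) * n ≤ m) (h2 : (m : ℝ) ≤ (1 + c) * n) (r : ℕ)
    (hE : EE m (fun a => |Real.sqrt m * tp m a r - 1|) ≤ η) :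
    EE m (fun a => |tp m a r - 1 / Real.sqrt n|) ≤ 1 / Real.sqrt n * (2 * (η + c)) := by
  have hn0 : (0 : ℝ) < n := by exact_mod_cast hn
  set y := Real.sqrt n with hy
  set z := Real.sqrt m with hz
  have hy0 : 0 < y := Real.sqrt_pos.2 hn0
  have hz0 : 0 ≤ z := Real.sqrt_nonneg _
  have hyy : y * y = n := Real.mul_self_sqrt hn0.le
  have hzz : z * z = m := Real.mul_self_sqrt (Nat.cast_nonneg m)
  have hz1 : (1 - c) * y ≤ z := by
    by_contra hlt
    push Not at hlt
    have hl := mul_self_lt_mul_self hz0 hlt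
    have hm : 0 ≤ (c * (1 - c)) * (y * y) := mul_nonneg (mul_nonneg hc0.le (by linarith)) (by positivity)
    have he : (1 - c) * y * ((1 - c) * y) = (1 - c) * (y * y) - (c * (1 - c)) * (y * y) := by ring
    rw [hyy] at hm he
    linarith
  have hz2 : z ≤ (1 + c) * y := by
    by_contra hlt
    push Not at hlt
    nlinarith [mul_pos hy0 hy0]
  have hη : 0 ≤ η := le_trans (EE_nonneg fun _ _ => abs_nonneg _) hE
  have key : EE m (fun a => (z * y) * |tp m a r - 1 / y|) ≤ EE m (fun a => y * |z * tp m a r - 1| + c * y) := by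
    refine EE_mono fun a _ => ?_
    have e : (z * y) * |tp m a r - 1 / y| = |(z * y) * (tp m a r - 1 / y)| := by
      rw [abs_mul, abs_of_nonneg (by positivity : 0 ≤ z * y)]
    rw [e]
    have e2 : (z * y) * (tp m a r - 1 / y) = y * (z * tp m a r - 1) + (y - z) := by
      field_simp; ring
    rw [e2]
    refine (abs_add_le _ _).trans ?_
    rw [abs_mul, abs_of_pos hy0]
    have : |y - z| ≤ c * y := by rw [abs_le]; constructor <;> linarith
    linarith
  rw [EE_mul, EE_add, EE_mul, EE_const] at key
  set X := EE m (fun a => |tp m a r - 1 / y|) with hX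
  have hX0 : 0 ≤ X := EE_nonneg fun _ _ => abs_nonneg _
  have h5 : y * X * y ≤ 2 * (η + c) * y := by
    have : y / 2 ≤ z := by nlinarith
    have h6 : (y / 2 * y) * X ≤ z * y * X := by gcongr
    nlinarith
  have h6 : y * X ≤ 2 * (η + c) := le_of_mul_le_mul_right h5 hy0
  rw [one_div, inv_mul_eq_div, le_div_iff₀ hy0]
  linarith

lemma window (k : ℕ) (s s' : ℝ) {ε : ℝ} (hε : 0 < ε) : ∀ᶠ n : ℕ in atTop,
    ∀ m, timeIndex n s ≤ m → m < timeIndex n s' → ∀ r < k + 1,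
      EE m (fun a => |tp m a r - 1 / Real.sqrt n|) ≤ 1 / Real.sqrt n * ε := by
  set c := min (1 / 2) (ε / 4) with hc
  have hc0 : 0 < c := lt_min (by norm_num) (by positivity)
  have hc1 : c ≤ 1 / 2 := min_le_left _ _
  have hc2 : c ≤ ε / 4 := min_le_right _ _
  have hall : ∀ᶠ m : ℕ in atTop, ∀ r ∈ Finset.range (k + 1), EE m (fun a => |Real.sqrt m * tp m a r - 1|) ≤ ε / 4 := by
    rw [Filter.eventually_all_finset]
    intro r _
    exact (tp_lim r).eventually_le_const (by positivity)
  obtain ⟨M, hM⟩ := eventually_atTop.1 hall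
  filter_upwards [ti_ev s hc0 (by linarith), ti_ev s' hc0 (by linarith), ti_top s M, eventually_gt_atTop 0]
    with n h1 h2 h3 h4 m hm1 hm2 r hr
  have hm1' : (timeIndex n s : ℝ) ≤ m := by exact_mod_cast hm1
  have hm2' : (m : ℝ) ≤ timeIndex n s' := by exact_mod_cast hm2.le
  refine (win_pt hc0 hc1 h4 (h1.1.trans hm1') (hm2'.trans h2.2.1) r
    (hM m (h3.trans hm1) r (Finset.mem_range.2 hr))).trans ?_
  gcongr
  linarith

variable {k : ℕ}

lemma block_lim {s s' : ℝ} (hs : s ≤ s') (u : Fin (k + 1) → ℤ) (B : ℕ → (ℕ → ℕ → ℕ) → ℝ)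
    (hB : ∀ n h h', (∀ i ≤ timeIndex n s, h i = h' i) → B n h = B n h') (hB1 : ∀ n h, |B n h| ≤ 1)
    {L : ℝ} (hL : Tendsto (fun n => WE (timeIndex n s) (B n)) atTop (nhds L)) :
    Tendsto (fun n => WE (timeIndex n s') (fun h => B n h *
      if ∀ r, (h (timeIndex n s') (r : Fin (k + 1)) : ℤ) - (h (timeIndex n s) r : ℤ) = u r then 1 else 0))
      atTop (nhds (L * pp (s' - s) u)) := by
  set D : ℕ → ℝ := fun n => ((timeIndex n s' : ℝ) - timeIndex n s) * (1 / Real.sqrt n) with hD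
  have hDl : Tendsto D atTop (nhds (s' - s)) := by
    refine ((ti_lim s').sub (ti_lim s)).congr fun n => ?_
    simp only [hD]; ring
  have hx : Tendsto (fun n : ℕ => 1 / Real.sqrt n) atTop (nhds 0) := by
    simpa [Function.comp_def] using tendsto_inv_atTop_zero.comp tendsto_rt
  have h1 : Tendsto (fun n => WE (timeIndex n s) (B n) * pp (D n) u) atTop (nhds (L * pp (s' - s) u)) :=
    hL.mul (((pp_cont u).tendsto _).comp hDl)
  rw [← tendsto_sub_nhds_zero_iff] at h1 ⊢
  have h2 : Tendsto (fun n => WE (timeIndex n s') (fun h => B n h *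
      if ∀ r, (h (timeIndex n s') (r : Fin (k + 1)) : ℤ) - (h (timeIndex n s) r : ℤ) = u r then 1 else 0)
      - WE (timeIndex n s) (B n) * pp (D n) u) atTop (nhds 0) := by
    rw [Metric.tendsto_nhds]
    intro η hη
    have hd : 0 < s' - s + 1 := by linarith
    set ε := η / (2 * (s' - s + 1) * (k + 1)) with hε
    have hε0 : 0 < ε := by positivity
    have hx2 : Tendsto (fun n : ℕ => (s' - s + 1) * (2 * ((k : ℝ) + 1) ^ 2 * (1 / Real.sqrt n))) atTop (nhds 0) := by
      simpa using (hx.const_mul (2 * ((k : ℝ) + 1) ^ 2)).const_mul (s' - s + 1)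
    filter_upwards [window k s s' hε0, ti_top s k, hDl.eventually_lt_const (by linarith : s' - s < s' - s + 1),
      hx2.eventually_lt_const (by positivity : 0 < η / 2)] with n w1 w2 w3 w4
    rw [Real.dist_eq, sub_zero]
    have hb := block (ti_mono n hs) w2 (x := 1 / Real.sqrt n) (ε := ε) (by positivity) u (B n) (hB n) (hB1 n) w1
    refine lt_of_le_of_lt hb ?_
    have e : (s' - s + 1) * (((k : ℝ) + 1) * ε) = η / 2 := by
      rw [hε]; field_simp
    have hx0 : 0 ≤ 1 / Real.sqrt (n : ℝ) := by positivity
    calc D n * (((k : ℝ) + 1) * ε + 2 * ((k : ℝ) + 1) ^ 2 * (1 / Real.sqrt n))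
        ≤ (s' - s + 1) * (((k : ℝ) + 1) * ε + 2 * ((k : ℝ) + 1) ^ 2 * (1 / Real.sqrt n)) := by gcongr
      _ < η := by rw [mul_add, e]; linarith
  have h3 := h2.add h1
  rw [add_zero] at h3
  refine h3.congr fun n => ?_
  ring

lemma chain_lim (T : ℕ → ℝ) (hT : Monotone T) (u : ℕ → Fin (k + 1) → ℤ) (j : ℕ) :
    Tendsto (fun n => WE (timeIndex n (T j)) (fun h => ∏ i ∈ Finset.range j,
      if ∀ r, (h (timeIndex n (T (i + 1))) (r : Fin (k + 1)) : ℤ) - (h (timeIndex n (T i)) r : ℤ) = u i r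
        then (1 : ℝ) else 0)) atTop (nhds (∏ i ∈ Finset.range j, pp (T (i + 1) - T i) (u i))) := by
  induction j with
  | zero => simp [WE_one]
  | succ j ih =>
    simp only [Finset.prod_range_succ]
    refine block_lim (hT (Nat.le_succ j)) (u j) _ ?_ ?_ ih
    · intro n h h' hh
      refine Finset.prod_congr rfl fun i hi => ?_
      have hi := Finset.mem_range.1 hi
      rw [hh _ (ti_mono n (hT (by omega : i + 1 ≤ j))), hh _ (ti_mono n (hT (by omega : i ≤ j)))]
    · intro n h
      rw [Finset.abs_prod]
      refine Finset.prod_le_one (fun _ _ => abs_nonneg _) fun i _ => ?_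
      split_ifs <;> simp

theorem main {Ω : Type*} [MeasurableSpace Ω] (P : Measure Ω)
    (lam : ℕ → Ω → YoungDiagram) (hPGP : IsPlancherelGrowthProcess P lam) (k : ℕ)
    (l : ℕ) (t : Fin (l + 1) → ℝ) (ht : Monotone t)
    (j₀ : Fin (l + 1)) (ht0 : t j₀ = 0) (v : Fin (l + 1) → Fin (k + 1) → ℤ) :
    Filter.Tendsto
      (fun n : ℕ => (P {ω | ∀ (j : Fin (l + 1)) (r : Fin (k + 1)),
          ((lam (timeIndex n (t j)) ω).rowLen r : ℤ) - ((lam n ω).rowLen r : ℤ) = v j r}).toReal)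
      Filter.atTop
      (nhds (if ∀ r : Fin (k + 1), v j₀ r = 0 then
          ∏ r : Fin (k + 1), ∏ j : Fin l,
            poissonProbZ (t j.succ - t j.castSucc) (v j.succ r - v j.castSucc r)
        else 0)) := by
  have hj0 : ∀ n, timeIndex n (t j₀) = n := fun n => by rw [ht0, ti_zero]
  split_ifs with hv
  swap
  · refine tendsto_const_nhds.congr fun n => ?_
    have : {ω | ∀ (j : Fin (l + 1)) (r : Fin (k + 1)),
          ((lam (timeIndex n (t j)) ω).rowLen r : ℤ) - ((lam n ω).rowLen r : ℤ) = v j r} = ∅ := by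
      refine Set.eq_empty_of_forall_notMem fun ω hω => hv fun r => ?_
      have := hω j₀ r
      rw [hj0, sub_self] at this
      exact this.symm
    rw [this]; simp
  have hlt : ∀ i, min i l < l + 1 := fun i => by omega
  set T : ℕ → ℝ := fun i => t ⟨min i l, hlt i⟩ with hT
  set V : ℕ → Fin (k + 1) → ℤ := fun i => v ⟨min i l, hlt i⟩ with hV
  have hTm : Monotone T := fun i j hij => ht (by rw [Fin.mk_le_mk]; omega)
  have hTt : ∀ j : Fin (l + 1), T j = t j := fun j => by
    simp only [hT]; congr 1; ext; simp; omega
  have hVv : ∀ j : Fin (l + 1), V j = v j := fun j => by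
    simp only [hV]; congr 1; ext; simp; omega
  have hc := chain_lim T hTm (fun i r => V (i + 1) r - V i r) l
  have hlim : ∏ i ∈ Finset.range l, pp (T (i + 1) - T i) (fun r => V (i + 1) r - V i r) =
      ∏ r : Fin (k + 1), ∏ j : Fin l,
            poissonProbZ (t j.succ - t j.castSucc) (v j.succ r - v j.castSucc r) := by
    rw [Finset.prod_comm, Finset.prod_range]
    refine Finset.prod_congr rfl fun j _ => ?_
    have e1 := hTt j.succ
    have e2 := hTt j.castSucc
    have e3 := hVv j.succ
    have e4 := hVv j.castSucc
    simp only [Fin.val_succ, Fin.val_castSucc] at e1 e2 e3 e4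
    rw [e1, e2, e3, e4]
    rfl
  rw [hlim] at hc
  refine hc.congr fun n => ?_
  classical
  set Q : (ℕ → ℕ → ℕ) → Prop := fun h => ∀ (j : Fin (l + 1)) (r : Fin (k + 1)),
    (h (timeIndex n (t j)) r : ℤ) - (h n r : ℤ) = v j r with hQ
  have hM : ∀ j, timeIndex n (t j) ≤ timeIndex n (T l) := fun j => by
    rw [← hTt j]; exact ti_mono n (hTm (by omega))
  have hpe := prob_eq hPGP (timeIndex n (T l)) Q (by
    intro h h' hh
    have h0 := hh n (by have := hM j₀; rwa [hj0] at this)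
    refine forall_congr' fun j => forall_congr' fun r => ?_
    rw [hh _ (hM j), h0])
  refine Eq.trans ?_ hpe.symm
  refine WE_congr fun h _ => ?_
  have hiff : Q h ↔ ∀ i ∈ Finset.range l, ∀ r : Fin (k + 1),
      (h (timeIndex n (T (i + 1))) r : ℤ) - (h (timeIndex n (T i)) r : ℤ) = V (i + 1) r - V i r := by
    constructor
    · intro hq i hi r
      have hi := Finset.mem_range.1 hi
      have q1 := hq ⟨i + 1, by omega⟩ r
      have q2 := hq ⟨i, by omega⟩ r
      rw [← hTt, ← hVv] at q1 q2
      simp only at q1 q2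
      omega
    · intro hq
      have tele : ∀ i, i ≤ l → ∀ r : Fin (k + 1),
          (h (timeIndex n (T i)) r : ℤ) - V i r = (h (timeIndex n (T 0)) r : ℤ) - V 0 r := by
        intro i
        induction i with
        | zero => intros; rfl
        | succ i ih =>
          intro hi r
          have a1 := ih (by omega) r
          have a2 := hq i (Finset.mem_range.2 (by omega)) r
          omega
      intro j r
      have b1 := tele j (by omega) r
      have b2 := tele j₀ (by omega) r
      rw [hTt, hVv] at b1 b2
      rw [hj0] at b2
      have b3 := hv r
      omega
  rw [Finset.prod_ite_zero]
  simp only [Finset.prod_const_one]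
  by_cases hq : Q h
  · rw [if_pos hq, if_pos (hiff.1 hq)]
  · rw [if_neg hq, if_neg (fun x => hq (hiff.2 x))]

end PG

/-- **Poisson limit theorem for the Plancherel growth process.**
Fix `k ≥ 0`.  As `n → ∞`, the random function `t ↦ Λ⁽ⁿᵗ⁾ - Λ⁽ⁿ⁾ ∈ ℤ^{k+1}` (where
`Λ⁽ⁿ⁾ = (λ⁽ⁿ⁾_0, …, λ⁽ⁿ⁾_k)` are the bottom `k+1` row lengths and `n_t = n + ⌊t√n⌋`)
converges in the sense of finite-dimensional distributions to a tuple of `k+1` independent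
standard two-sided Poisson processes.

Finite-dimensional distributions are tested on an arbitrary weakly increasing tuple of times
`t_0 ≤ t_1 ≤ ⋯ ≤ t_l` containing the anchor time `t_{j₀} = 0`; since the limiting processes
vanish at `0` and have independent Poisson increments, the limiting joint probability mass at
values `v : Fin (l+1) → Fin (k+1) → ℤ` is `∏_r ∏_j poissonProbZ (t_{j+1} - t_j) (v_{j+1,r} - v_{j,r})`
if `v_{j₀} = 0` and `0` otherwise. -/
theorem poisson_limit_plancherel_growth {Ω : Type*} [MeasurableSpace Ω] (P : Measure Ω)
    (lam : ℕ → Ω → YoungDiagram) (hPGP : IsPlancherelGrowthProcess P lam) (k : ℕ)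
    (l : ℕ) (t : Fin (l + 1) → ℝ) (ht : Monotone t)
    (j₀ : Fin (l + 1)) (ht0 : t j₀ = 0) (v : Fin (l + 1) → Fin (k + 1) → ℤ) :
    Filter.Tendsto
      (fun n : ℕ => (P {ω | ∀ (j : Fin (l + 1)) (r : Fin (k + 1)),
          ((lam (timeIndex n (t j)) ω).rowLen r : ℤ) - ((lam n ω).rowLen r : ℤ) = v j r}).toReal)
      Filter.atTop
      (nhds (if ∀ r : Fin (k + 1), v j₀ r = 0 then
          ∏ r : Fin (k + 1), ∏ j : Fin l,
            poissonProbZ (t j.succ - t j.castSucc) (v j.succ r - v j.castSucc r)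
        else 0)) := by
  exact PG.main P lam hPGP k l t ht j₀ ht0 v
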